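/- Suppose admissible domains (G_n, a_n, c_n, d_n) containing 0 converge to an admissible domain (G, a, c, d) containing 0. Let φ_n : 𝔻 → G_n and φ : 𝔻 → G be the unique conformal maps with φ_n(0) = 0, φ_n'(0) > 0 and φ(0) = 0, φ'(0) > 0. Then φ_n → φ uniformly on 𝔻̄. -/

import Mathlib

/-- A monotone, endpoint-preserving, continuous reparametrization of `[0,1]`. -/
def IsReparam (φ : unitInterval → unitInterval) : Prop :=
  Continuous φ ∧ Monotone φ ∧ φ 0 = 0 ∧ φ 1 = 1

/-- The uniform distance between curves in `ℂ`, modulo monotone reparametrization. -/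
noncomputable def curveDist (γ₁ γ₂ : C(unitInterval, ℂ)) : ℝ :=
  sInf { r : ℝ | 0 ≤ r ∧ ∃ φ ψ : unitInterval → unitInterval,
    IsReparam φ ∧ IsReparam ψ ∧ ∀ t, dist (γ₁ (φ t)) (γ₂ (ψ t)) ≤ r }

/-- A bounded simply connected domain `G`, admissible with respect to three
counterclockwise boundary points `a, c, d`: the boundary is the union of three
simple arcs `J₁ = d⌢a`, `J₂ = a⌢c`, `J₃ = c⌢d`; `J₃` does not touch the interiors
of `J₁` and `J₂`; and every point of `J₃` can be joined to infinity by a path not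
crossing `∂G`. -/
structure AdmissibleDomain where
  G : Set ℂ
  a : ℂ
  c : ℂ
  d : ℂ
  J1 : C(unitInterval, ℂ)
  J2 : C(unitInterval, ℂ)
  J3 : C(unitInterval, ℂ)
  isOpen : IsOpen G
  bounded : Bornology.IsBounded G
  connected : IsConnected G
  simplyConnected : SimplyConnectedSpace G
  inj1 : Function.Injective J1
  inj2 : Function.Injective J2
  inj3 : Function.Injective J3
  e10 : J1 0 = d
  e11 : J1 1 = a
  e20 : J2 0 = a
  e21 : J2 1 = c
  e30 : J3 0 = c
  e31 : J3 1 = d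
  boundary : Set.range J1 ∪ Set.range J2 ∪ Set.range J3 = frontier G
  noTouch1 : Set.range J3 ∩ (Set.range J1 \ {d, a}) = ∅
  noTouch2 : Set.range J3 ∩ (Set.range J2 \ {a, c}) = ∅
  toInfinity : ∀ p ∈ Set.range J3, ∃ γ : ℝ → ℂ, Continuous γ ∧ γ 0 = p ∧
    Filter.Tendsto (fun t => ‖γ t‖) Filter.atTop Filter.atTop ∧
    ∀ t : ℝ, 0 < t → γ t ∉ frontier G

/-- Convergence of admissible domains: the three boundary arcs converge in the
uniform curve metric and the marked points converge. -/
def AdmConverges (Dn : ℕ → AdmissibleDomain) (D : AdmissibleDomain) : Prop :=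
  Filter.Tendsto (fun n => curveDist (Dn n).J1 D.J1) Filter.atTop (nhds 0) ∧
  Filter.Tendsto (fun n => curveDist (Dn n).J2 D.J2) Filter.atTop (nhds 0) ∧
  Filter.Tendsto (fun n => curveDist (Dn n).J3 D.J3) Filter.atTop (nhds 0) ∧
  Filter.Tendsto (fun n => (Dn n).a) Filter.atTop (nhds D.a) ∧
  Filter.Tendsto (fun n => (Dn n).c) Filter.atTop (nhds D.c) ∧
  Filter.Tendsto (fun n => (Dn n).d) Filter.atTop (nhds D.d)

/-- Uniform local connectedness of a sequence of closed sets. -/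
def UnifLocallyConnected (A : ℕ → Set ℂ) : Prop :=
  ∀ ε : ℝ, 0 < ε → ∃ δ : ℝ, 0 < δ ∧ ∀ n : ℕ, ∀ a ∈ A n, ∀ b ∈ A n,
    dist a b < δ → ∃ B : Set ℂ, B ⊆ A n ∧ a ∈ B ∧ b ∈ B ∧
      IsCompact B ∧ IsConnected B ∧ Metric.diam B < ε

section
open Set Filter Topology Metric

namespace RMC

/-- continuous logarithm on the real line -/
theorem exists_log_real (f : ℝ → ℂ) (hf : Continuous f) (h0 : ∀ t, f t ≠ 0) :
    ∃ l : ℝ → ℂ, Continuous l ∧ ∀ t, Complex.exp (l t) = f t := by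
  obtain ⟨F, ⟨-, hF⟩, -⟩ := Complex.isCoveringMapOn_exp.existsUnique_continuousMap_lifts
    (⟨f, hf⟩ : C(ℝ, ℂ)) (a₀ := 0) (e₀ := Complex.log (f 0)) (Complex.exp_log (h0 0))
    (fun a => h0 a)
  exact ⟨F, F.continuous, fun t => congrFun hF t⟩

theorem exists_log_complex (f : ℂ → ℂ) (hf : Continuous f) (h0 : ∀ t, f t ≠ 0) :
    ∃ l : ℂ → ℂ, Continuous l ∧ ∀ t, Complex.exp (l t) = f t := by
  obtain ⟨F, ⟨-, hF⟩, -⟩ := Complex.isCoveringMapOn_exp.existsUnique_continuousMap_lifts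
    (⟨f, hf⟩ : C(ℂ, ℂ)) (a₀ := 0) (e₀ := Complex.log (f 0)) (Complex.exp_log (h0 0))
    (fun a => h0 a)
  exact ⟨F, F.continuous, fun t => congrFun hF t⟩

theorem exists_log_Icc (f : ℝ → ℂ) {a b : ℝ} (hab : a ≤ b) (hf : ContinuousOn f (Icc a b))
    (h0 : ∀ t ∈ Icc a b, f t ≠ 0) :
    ∃ l : ℝ → ℂ, Continuous l ∧ ∀ t ∈ Icc a b, Complex.exp (l t) = f t := by
  have hc : Continuous (IccExtend hab ((Icc a b).domRestrict f)) :=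
    (continuousOn_iff_continuous_domRestrict.1 hf).Icc_extend'
  obtain ⟨l, hl, hl'⟩ := exists_log_real _ hc (fun t => h0 _ (projIcc a b hab t).2)
  refine ⟨l, hl, fun t ht => ?_⟩
  rw [hl', IccExtend_of_mem _ _ ht]; rfl

theorem exp_eq_one_norm_lt {z : ℂ} (h : Complex.exp z = 1) (hz : ‖z‖ < 6) : z = 0 := by
  obtain ⟨n, hn⟩ := Complex.exp_eq_one_iff.1 h
  have : n = 0 := by
    by_contra hne
    have h1 : (1:ℝ) ≤ |(n:ℝ)| := by exact_mod_cast Int.one_le_abs hne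
    rw [hn] at hz
    simp only [Complex.norm_mul, Complex.norm_intCast, Complex.norm_ofNat, Complex.norm_real,
      Complex.norm_I, mul_one, Real.norm_eq_abs, abs_of_pos Real.pi_pos] at hz
    nlinarith [Real.pi_gt_three]
  simp [hn, this]

/-- A continuous function on a preconnected set with `exp = 1` is constant. -/
theorem const_of_exp {X : Type*} [TopologicalSpace X] {S : Set X} (hS : IsPreconnected S)
    {g : X → ℂ} (hg : ContinuousOn g S) (h : ∀ x ∈ S, Complex.exp (g x) = 1)
    {x y : X} (hx : x ∈ S) (hy : y ∈ S) : g x = g y := by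
  have := isPreconnected_iff_preconnectedSpace.1 hS
  have hl : IsLocallyConstant (S.domRestrict g) := by
    rw [IsLocallyConstant.iff_exists_open]
    intro z
    have hc : Continuous (S.domRestrict g) := continuousOn_iff_continuous_domRestrict.1 hg
    refine ⟨(S.domRestrict g) ⁻¹' (ball (g z) 6), isOpen_ball.preimage hc, mem_ball_self (by norm_num), ?_⟩
    intro w hw
    have hw' : ‖g w - g z‖ < 6 := by
      have h5 : dist (g w) (g z) < 6 := hw
      rwa [dist_eq_norm] at h5
    have := exp_eq_one_norm_lt (z := g w - g z) (by rw [Complex.exp_sub, h _ w.2, h _ z.2]; simp) hw'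
    exact sub_eq_zero.1 this
  exact hl.apply_eq_of_preconnectedSpace ⟨x, hx⟩ ⟨y, hy⟩

open Classical in
/-- increment of a continuous logarithm of `f` from `a` to `b` -/
noncomputable def linc (f : ℝ → ℂ) (a b : ℝ) : ℂ :=
  if h : ∃ l : ℝ → ℂ, ContinuousOn l (uIcc a b) ∧ ∀ t ∈ uIcc a b, Complex.exp (l t) = f t then
    h.choose b - h.choose a else 0

theorem linc_eq {f l : ℝ → ℂ} {a b : ℝ} (hl : ContinuousOn l (uIcc a b))
    (hf : ∀ t ∈ uIcc a b, Complex.exp (l t) = f t) : linc f a b = l b - l a := by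
  have h : ∃ l : ℝ → ℂ, ContinuousOn l (uIcc a b) ∧ ∀ t ∈ uIcc a b, Complex.exp (l t) = f t :=
    ⟨l, hl, hf⟩
  unfold linc
  rw [dif_pos h]
  have h1 := h.choose_spec.1
  have h2 := h.choose_spec.2
  have := const_of_exp (S := uIcc a b) isPreconnected_uIcc (g := fun t => h.choose t - l t)
    (h1.sub hl) (fun x hx => by
      have : Complex.exp (l x) ≠ 0 := Complex.exp_ne_zero _
      rw [Complex.exp_sub, h2 x hx, ← hf x hx, div_self this]) left_mem_uIcc right_mem_uIcc
  linear_combination -this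

/-- `f` is continuous and nonvanishing on `S`. -/
def Good (f : ℝ → ℂ) (S : Set ℝ) : Prop := ContinuousOn f S ∧ ∀ t ∈ S, f t ≠ 0

theorem Good.mono {f : ℝ → ℂ} {S T : Set ℝ} (h : Good f S) (hT : T ⊆ S) : Good f T :=
  ⟨h.1.mono hT, fun t ht => h.2 t (hT ht)⟩

theorem Good.exists_log {f : ℝ → ℂ} {a b : ℝ} (h : Good f (uIcc a b)) :
    ∃ l : ℝ → ℂ, Continuous l ∧ ∀ t ∈ uIcc a b, Complex.exp (l t) = f t :=
  exists_log_Icc f min_le_max h.1 h.2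

theorem linc_exp {f : ℝ → ℂ} {a b : ℝ} (h : Good f (uIcc a b)) :
    Complex.exp (linc f a b) = f b / f a := by
  obtain ⟨l, hl, hl'⟩ := h.exists_log
  rw [linc_eq hl.continuousOn hl', Complex.exp_sub, hl' _ right_mem_uIcc, hl' _ left_mem_uIcc]

theorem linc_self (f : ℝ → ℂ) (a : ℝ) : linc f a a = 0 := by
  unfold linc; split_ifs <;> simp

theorem linc_congr {f g : ℝ → ℂ} {a b : ℝ} (h : ∀ t ∈ uIcc a b, f t = g t) :
    linc f a b = linc g a b := by
  by_cases hf : ∃ l : ℝ → ℂ, ContinuousOn l (uIcc a b) ∧ ∀ t ∈ uIcc a b, Complex.exp (l t) = f t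
  · obtain ⟨l, hl, hl'⟩ := hf
    rw [linc_eq hl hl', linc_eq hl (fun t ht => (hl' t ht).trans (h t ht))]
  · have hg : ¬ ∃ l : ℝ → ℂ, ContinuousOn l (uIcc a b) ∧ ∀ t ∈ uIcc a b, Complex.exp (l t) = g t := by
      rintro ⟨l, hl, hl'⟩
      exact hf ⟨l, hl, fun t ht => (hl' t ht).trans (h t ht).symm⟩
    unfold linc
    rw [dif_neg hf, dif_neg hg]

theorem linc_add {f : ℝ → ℂ} {a b c A B : ℝ} (h : Good f (Icc A B)) (ha : a ∈ Icc A B)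
    (hb : b ∈ Icc A B) (hc : c ∈ Icc A B) : linc f a b + linc f b c = linc f a c := by
  have hAB : A ≤ B := ha.1.trans ha.2
  obtain ⟨l, hl, hl'⟩ := exists_log_Icc f hAB h.1 h.2
  rw [linc_eq hl.continuousOn (fun t ht => hl' t (ordConnected_Icc.uIcc_subset ha hb ht)),
    linc_eq hl.continuousOn (fun t ht => hl' t (ordConnected_Icc.uIcc_subset hb hc ht)),
    linc_eq hl.continuousOn (fun t ht => hl' t (ordConnected_Icc.uIcc_subset ha hc ht))]
  ring

theorem linc_symm {f : ℝ → ℂ} {a b : ℝ} (h : Good f (uIcc a b)) : linc f b a = - linc f a b := by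
  have := linc_add (a := a) (b := b) (c := a) h left_mem_uIcc right_mem_uIcc left_mem_uIcc
  rw [linc_self] at this
  linear_combination this

theorem linc_mul {f g : ℝ → ℂ} {a b : ℝ} (hf : Good f (uIcc a b)) (hg : Good g (uIcc a b)) :
    linc (fun t => f t * g t) a b = linc f a b + linc g a b := by
  obtain ⟨l, hl, hl'⟩ := hf.exists_log
  obtain ⟨m, hm, hm'⟩ := hg.exists_log
  rw [linc_eq hl.continuousOn hl', linc_eq hm.continuousOn hm',
    linc_eq (l := fun t => l t + m t) (hl.add hm).continuousOn
      (fun t ht => by rw [Complex.exp_add, hl' t ht, hm' t ht])]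
  ring

theorem linc_comp' {f : ℝ → ℂ} {u : ℝ → ℝ} {a b A B : ℝ} (hf : Good f (Icc A B))
    (hu : ContinuousOn u (uIcc a b)) (hm : MapsTo u (uIcc a b) (Icc A B)) :
    linc (fun t => f (u t)) a b = linc f (u a) (u b) := by
  have ha := hm left_mem_uIcc
  have hb := hm right_mem_uIcc
  obtain ⟨l, hl, hl'⟩ := exists_log_Icc f (ha.1.trans ha.2) hf.1 hf.2
  rw [linc_eq (l := fun t => l (u t)) (hl.comp_continuousOn hu) (fun t ht => hl' _ (hm ht)),
    linc_eq hl.continuousOn (fun t ht => hl' t (ordConnected_Icc.uIcc_subset ha hb ht))]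

theorem linc_near {f : ℝ → ℂ} {a b : ℝ} (hf : ContinuousOn f (uIcc a b))
    (h : ∀ t ∈ uIcc a b, f t ∈ Complex.slitPlane) :
    linc f a b = Complex.log (f b) - Complex.log (f a) :=
  linc_eq (l := fun t => Complex.log (f t)) (hf.clog h)
    (fun t ht => Complex.exp_log (Complex.slitPlane_ne_zero (h t ht)))

/-- Continuity of the increment under uniform convergence. -/
theorem linc_tendsto {ι : Type*} {p : Filter ι} {F : ι → ℝ → ℂ} {f : ℝ → ℂ} {a b : ℝ}
    (hf : Good f (uIcc a b)) (hF : ∀ᶠ k in p, ContinuousOn (F k) (uIcc a b))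
    (hu : TendstoUniformlyOn F f p (uIcc a b)) :
    Tendsto (fun k => linc (F k) a b) p (𝓝 (linc f a b)) := by
  obtain ⟨m, hm, hm'⟩ : ∃ m > 0, ∀ t ∈ uIcc a b, m ≤ ‖f t‖ := by
    obtain ⟨t0, ht0, hmin⟩ := (isCompact_uIcc (a := a) (b := b)).exists_isMinOn nonempty_uIcc
      hf.1.norm
    exact ⟨‖f t0‖, norm_pos_iff.2 (hf.2 _ ht0), fun t ht => hmin ht⟩
  rw [Metric.tendstoUniformlyOn_iff] at hu
  have key : ∀ᶠ k in p, linc (F k) a b = linc f a b +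
      (Complex.log (F k b / f b) - Complex.log (F k a / f a)) := by
    filter_upwards [hF, hu m hm] with k hk hk2
    have hs : ∀ t ∈ uIcc a b, F k t / f t ∈ Complex.slitPlane := by
      intro t ht
      have h1 : ‖F k t - f t‖ < ‖f t‖ := by
        have := hk2 t ht
        rw [dist_comm, dist_eq_norm] at this
        exact this.trans_le (hm' t ht)
      have hne := hf.2 t ht
      have h2 : ‖F k t / f t - 1‖ < 1 := by
        rw [div_sub_one hne, norm_div, div_lt_one (norm_pos_iff.2 hne)]; exact h1
      have := Complex.mem_slitPlane_of_norm_lt_one h2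
      simpa using this
    have hc : ContinuousOn (fun t => F k t / f t) (uIcc a b) := hk.div hf.1 hf.2
    rw [← linc_near hc hs, ← linc_mul hf ⟨hc, fun t ht => Complex.slitPlane_ne_zero (hs t ht)⟩]
    exact linc_congr (fun t ht => by rw [mul_div_cancel₀ _ (hf.2 t ht)])
  have hlim : ∀ t ∈ uIcc a b, Tendsto (fun k => Complex.log (F k t / f t)) p (𝓝 0) := by
    intro t ht
    have h1 : Tendsto (fun k => F k t) p (𝓝 (f t)) := by
      rw [Metric.tendsto_nhds]
      intro ε hε
      filter_upwards [hu ε hε] with k hk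
      rw [dist_comm]; exact hk t ht
    have h2 := h1.div_const (f t)
    rw [div_self (hf.2 t ht)] at h2
    have h3 := h2.clog (by simp)
    simpa using h3
  have := ((hlim b right_mem_uIcc).sub (hlim a left_mem_uIcc)).const_add (linc f a b)
  rw [sub_zero, add_zero] at this
  exact this.congr' (key.mono fun k hk => hk.symm)

end RMC
end

section
open Set Filter Topology Metric

namespace RMC

theorem circle_log_aux (R : ℝ) (hR : 0 < R) (a b : ℝ) :
    linc (fun θ : ℝ => (R:ℂ) * Complex.exp (θ * Complex.I)) a b = (b - a) * Complex.I := by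
  rw [linc_eq (l := fun θ : ℝ => Complex.log R + θ * Complex.I) (by fun_prop)]
  · ring
  · intro t _
    rw [Complex.exp_add, Complex.exp_log (by exact_mod_cast hR.ne')]

theorem exp_per (a : ℝ) : Complex.exp (((a + 2 * Real.pi : ℝ) : ℂ) * Complex.I) =
    Complex.exp ((a:ℂ) * Complex.I) := by
  push_cast
  rw [add_mul, Complex.exp_add, Complex.exp_two_pi_mul_I, mul_one]

/-- index of a circle: inside -/
theorem circ_in {R : ℝ} {w : ℂ} (hw : ‖w‖ < R) (a : ℝ) :
    linc (fun θ : ℝ => (R:ℂ) * Complex.exp (θ * Complex.I) - w) a (a + 2 * Real.pi) =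
      2 * Real.pi * Complex.I := by
  have hR : 0 < R := (norm_nonneg _).trans_lt hw
  have hne : ∀ θ : ℝ, (R:ℂ) * Complex.exp (θ * Complex.I) ≠ 0 := fun θ =>
    mul_ne_zero (by exact_mod_cast hR.ne') (Complex.exp_ne_zero _)
  have hnorm : ∀ θ : ℝ, ‖(R:ℂ) * Complex.exp (θ * Complex.I)‖ = R := fun θ => by
    rw [norm_mul, Complex.norm_exp_ofReal_mul_I]; simp [abs_of_pos hR]
  have hs : ∀ θ : ℝ, 1 - w / ((R:ℂ) * Complex.exp (θ * Complex.I)) ∈ Complex.slitPlane := by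
    intro θ
    have := Complex.mem_slitPlane_of_norm_lt_one
      (z := -(w / ((R:ℂ) * Complex.exp (θ * Complex.I))))
      (by rw [norm_neg, norm_div, hnorm, div_lt_one hR]; exact hw)
    simpa [sub_eq_add_neg] using this
  have hc : Continuous (fun θ : ℝ => 1 - w / ((R:ℂ) * Complex.exp (θ * Complex.I))) := by
    refine continuous_const.sub (continuous_const.div (by fun_prop) hne)
  rw [linc_congr (g := fun θ : ℝ => ((R:ℂ) * Complex.exp (θ * Complex.I)) *
    (1 - w / ((R:ℂ) * Complex.exp (θ * Complex.I)))) (fun θ _ => by rw [mul_sub, mul_one, mul_div_cancel₀ _ (hne θ)]),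
    linc_mul (f := fun θ : ℝ => (R:ℂ) * Complex.exp (θ * Complex.I))
      ⟨by fun_prop, fun θ _ => hne θ⟩
      ⟨hc.continuousOn, fun θ _ => Complex.slitPlane_ne_zero (hs θ)⟩, circle_log_aux R hR,
    linc_near hc.continuousOn (fun θ _ => hs θ)]
  rw [exp_per]
  push_cast; ring

theorem circ_out {R : ℝ} {w : ℂ} (hR : 0 ≤ R) (hw : R < ‖w‖) (a : ℝ) :
    linc (fun θ : ℝ => (R:ℂ) * Complex.exp (θ * Complex.I) - w) a (a + 2 * Real.pi) = 0 := by
  have hw0 : w ≠ 0 := norm_pos_iff.1 (hR.trans_lt hw)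
  have hnorm : ∀ θ : ℝ, ‖(R:ℂ) * Complex.exp (θ * Complex.I)‖ = R := fun θ => by
    rw [norm_mul, Complex.norm_exp_ofReal_mul_I]; simp [abs_of_nonneg hR]
  have hs : ∀ θ : ℝ, 1 - ((R:ℂ) * Complex.exp (θ * Complex.I)) / w ∈ Complex.slitPlane := by
    intro θ
    have := Complex.mem_slitPlane_of_norm_lt_one
      (z := -(((R:ℂ) * Complex.exp (θ * Complex.I)) / w))
      (by rw [norm_neg, norm_div, hnorm, div_lt_one (norm_pos_iff.2 hw0)]; exact hw)
    simpa [sub_eq_add_neg] using this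
  have hc : Continuous (fun θ : ℝ => 1 - ((R:ℂ) * Complex.exp (θ * Complex.I)) / w) := by
    fun_prop
  rw [linc_congr (g := fun θ : ℝ => (-w) *
    (1 - ((R:ℂ) * Complex.exp (θ * Complex.I)) / w)) (fun θ _ => by field_simp; ring),
    linc_mul (f := fun θ : ℝ => -w)
      ⟨by fun_prop, fun θ _ => neg_ne_zero.2 hw0⟩
      ⟨hc.continuousOn, fun θ _ => Complex.slitPlane_ne_zero (hs θ)⟩,
    linc_near hc.continuousOn (fun θ _ => hs θ),
    linc_eq (l := fun _ => Complex.log (-w)) (by fun_prop)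
      (fun t _ => Complex.exp_log (neg_ne_zero.2 hw0))]
  rw [exp_per]
  ring

theorem no_retract (F : ℂ → ℂ) (hF : Continuous F) (h0 : ∀ z, F z ≠ 0) (h : ℂ) (R : ℝ)
    (hR : ∀ z, R ≤ ‖z‖ → F z = z - h) : False := by
  obtain ⟨l, hl, hl'⟩ := exists_log_complex F hF h0
  set R' := |R| + ‖h‖ + 1 with hR'
  have hpos : 0 < R' := by positivity
  have h1 := circ_in (R := R') (w := h) (by rw [hR']; linarith [abs_nonneg R]) 0
  rw [linc_eq (l := fun θ : ℝ => l ((R':ℂ) * Complex.exp (θ * Complex.I)))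
    (by fun_prop) (fun t _ => by
      rw [hl', hR]
      rw [norm_mul, Complex.norm_exp_ofReal_mul_I]
      simp only [Complex.norm_real, Real.norm_eq_abs, abs_of_pos hpos, mul_one]
      rw [hR']; linarith [le_abs_self R, norm_nonneg h])] at h1
  simp only [exp_per, sub_self] at h1
  have : (2 * Real.pi * Complex.I : ℂ) ≠ 0 := by simp [Real.pi_ne_zero]
  exact this h1.symm

theorem isPreconnected_outside {R : ℝ} (hR : 0 < R) : IsPreconnected {z : ℂ | R < ‖z‖} := by
  have : {z : ℂ | R < ‖z‖} = Complex.exp '' {z : ℂ | Real.log R < z.re} := by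
    ext z
    constructor
    · intro hz
      have hz' : R < ‖z‖ := hz
      refine ⟨Complex.log z, ?_, Complex.exp_log (norm_pos_iff.1 (hR.trans hz'))⟩
      simp only [mem_ofPred_eq, Complex.log_re]
      exact Real.log_lt_log hR hz
    · rintro ⟨w, hw, rfl⟩
      simp only [mem_ofPred_eq] at hw ⊢
      rw [Complex.norm_exp]
      exact (Real.log_lt_iff_lt_exp hR).1 hw
  rw [this]
  refine IsPreconnected.image ?_ _ Complex.continuous_exp.continuousOn
  exact (convex_halfSpace_re_gt _).isPreconnected

/-- coordinate function on an arc plus a point -/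
theorem arc_coord {γ : ℝ → ℂ} {c : ℂ} (hγ : ContinuousOn γ (Icc 0 1)) (hi : InjOn γ (Icc 0 1))
    (hc : c ∉ γ '' Icc 0 1) : ∃ u : ℂ → ℝ, Continuous u ∧ (∀ v ∈ Icc (0:ℝ) 1, u (γ v) = v) ∧
      u c = 2 := by
  let e : (Icc (0:ℝ) 1) ⊕ Unit → ℂ := Sum.elim ((Icc (0:ℝ) 1).domRestrict γ) (fun _ => c)
  have he : Continuous e := Continuous.sumElim
    (continuousOn_iff_continuous_domRestrict.1 hγ) continuous_const
  have hinj : Function.Injective e := by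
    rintro (x | x) (y | y) hxy
    · simp only [e, Sum.elim_inl, domRestrict_apply] at hxy
      rw [Subtype.ext (hi x.2 y.2 hxy)]
    · exact absurd ⟨x, x.2, hxy⟩ hc
    · exact absurd ⟨y, y.2, hxy.symm⟩ hc
    · rfl
  have hce := he.isClosedEmbedding hinj
  obtain ⟨g, hg⟩ := ContinuousMap.exists_extension' hce
    (⟨Sum.elim (fun x => (x:ℝ)) (fun _ => 2), by fun_prop⟩ : C((Icc (0:ℝ) 1) ⊕ Unit, ℝ))
  refine ⟨g, g.continuous, fun v hv => ?_, ?_⟩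
  · exact congrFun hg (Sum.inl ⟨v, hv⟩)
  · exact congrFun hg (Sum.inr ())

theorem nonsep_aux {X H V : Set ℂ} (hH : IsOpen H) (hV : IsOpen V)
    (hd : Disjoint H V) (hcov : Xᶜ ⊆ H ∪ V) {R : ℝ} (hb : ∀ z ∈ H, ‖z‖ ≤ R) {h : ℂ} (hh : h ∈ H)
    {Λ : ℂ → ℂ} (hΛ : Continuous Λ) (hΛX : ∀ z ∈ X, Complex.exp (Λ z) = z - h) : False := by
  classical
  refine no_retract (H.piecewise (fun z => Complex.exp (Λ z)) (fun z => z - h)) ?_ ?_ h (R + 1) ?_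
  · refine Continuous.piecewise ?_ (by fun_prop) (by fun_prop)
    intro a ha
    refine hΛX a ?_
    rw [hH.frontier_eq] at ha
    by_contra hax
    rcases hcov hax with h1 | h1
    · exact ha.2 h1
    · obtain ⟨y, hy⟩ := mem_closure_iff.1 ha.1 V hV h1
      exact disjoint_left.1 hd hy.2 hy.1
  · intro z
    by_cases hz : z ∈ H
    · rw [piecewise_eq_of_mem _ _ _ hz]; exact Complex.exp_ne_zero _
    · rw [piecewise_eq_of_notMem _ _ _ hz]
      intro h0
      exact hz (by rwa [sub_eq_zero.1 h0])
  · intro z hz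
    rw [piecewise_eq_of_notMem]
    intro hzH
    linarith [hb z hzH]

theorem nonsep {γ : ℝ → ℂ} {c : ℂ} (hγ : ContinuousOn γ (Icc 0 1)) (hi : InjOn γ (Icc 0 1))
    (hc : c ∉ γ '' Icc 0 1) : IsPreconnected (γ '' Icc 0 1 ∪ {c})ᶜ := by
  set X := γ '' Icc 0 1 ∪ {c} with hXdef
  have hXc : IsCompact X := (isCompact_Icc.image_of_continuousOn hγ).union isCompact_singleton
  obtain ⟨u, hu, hu1, hu2⟩ := arc_coord hγ hi hc
  have hlog : ∀ h ∉ X, ∃ Λ : ℂ → ℂ, Continuous Λ ∧ ∀ z ∈ X, Complex.exp (Λ z) = z - h := by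
    intro h hh
    have h1 : ∀ t ∈ Icc (0:ℝ) 1, γ t - h ≠ 0 := fun t ht h0 =>
      hh (Or.inl ⟨t, ht, sub_eq_zero.1 h0⟩)
    have h2 : c - h ≠ 0 := fun h0 => hh (Or.inr (sub_eq_zero.1 h0).symm)
    obtain ⟨l, hl, hl'⟩ := exists_log_Icc (fun t => γ t - h) zero_le_one
      (hγ.sub continuousOn_const) h1
    refine ⟨fun z => l (u z) + ((max 0 (u z - 1) : ℝ) : ℂ) * (Complex.log (c - h) - l 2),
      by fun_prop, ?_⟩
    rintro z (⟨t, ht, rfl⟩ | rfl)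
    · beta_reduce
      rw [hu1 t ht, max_eq_left (by linarith [ht.2])]
      simp [hl' t ht]
    · beta_reduce
      rw [hu2]
      norm_num
      exact Complex.exp_log h2
  obtain ⟨R, hR0, hR⟩ : ∃ R : ℝ, 0 < R ∧ ∀ z ∈ X, ‖z‖ ≤ R := by
    obtain ⟨R, hR⟩ := hXc.isBounded.exists_norm_le
    exact ⟨max R 1, by positivity, fun z hz => (hR z hz).trans (le_max_left _ _)⟩
  intro U V hU hV hcov hUn hVn
  by_contra hne
  have hdis : Disjoint (Xᶜ ∩ U) (Xᶜ ∩ V) := by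
    rw [disjoint_left]
    rintro z ⟨h1, h2⟩ ⟨_, h3⟩
    exact hne ⟨z, h1, h2, h3⟩
  have hoU : IsOpen (Xᶜ ∩ U) := hXc.isClosed.isOpen_compl.inter hU
  have hoV : IsOpen (Xᶜ ∩ V) := hXc.isClosed.isOpen_compl.inter hV
  have hsub : {z : ℂ | R < ‖z‖} ⊆ (Xᶜ ∩ U) ∪ (Xᶜ ∩ V) := by
    intro z hz
    have hz1 : z ∈ Xᶜ := fun hzX => absurd (hR z hzX) (not_le.2 hz)
    rcases hcov hz1 with h | h
    · exact Or.inl ⟨hz1, h⟩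
    · exact Or.inr ⟨hz1, h⟩
  have hcov' : Xᶜ ⊆ (Xᶜ ∩ U) ∪ (Xᶜ ∩ V) := by
    intro z hz1
    rcases hcov hz1 with h | h
    · exact Or.inl ⟨hz1, h⟩
    · exact Or.inr ⟨hz1, h⟩
  rcases (isPreconnected_outside hR0).subset_or_subset hoU hoV hdis hsub with h | h
  · obtain ⟨x, hx⟩ := hVn
    obtain ⟨Λ, hΛ, hΛ'⟩ := hlog x hx.1
    refine nonsep_aux hoV hoU hdis.symm (by rwa [union_comm]) (R := R) ?_ hx
      hΛ hΛ'
    intro z hz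
    by_contra hlt
    exact disjoint_left.1 hdis (h (not_le.1 hlt)) hz
  · obtain ⟨x, hx⟩ := hUn
    obtain ⟨Λ, hΛ, hΛ'⟩ := hlog x hx.1
    refine nonsep_aux hoU hoV hdis hcov' (R := R) ?_ hx
      hΛ hΛ'
    intro z hz
    by_contra hlt
    exact disjoint_left.1 hdis hz (h (not_le.1 hlt))

/-- increment of the logarithm of `γ - z` -/
noncomputable def dd (γ : ℝ → ℂ) (a b : ℝ) (z : ℂ) : ℂ := linc (fun t => γ t - z) a b

theorem dd_good {γ : ℝ → ℂ} {S : Set ℝ} (hγ : ContinuousOn γ S) {z : ℂ}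
    (hz : z ∉ γ '' S) : Good (fun t => γ t - z) S :=
  ⟨hγ.sub continuousOn_const, fun t ht h0 => hz ⟨t, ht, sub_eq_zero.1 h0⟩⟩

theorem dd_tendsto {ι : Type*} {p : Filter ι} {γk : ι → ℝ → ℂ} {zk : ι → ℂ} {γ : ℝ → ℂ} {z : ℂ}
    {a b : ℝ} (hγ : ContinuousOn γ (uIcc a b))
    (hγk : ∀ᶠ k in p, ContinuousOn (γk k) (uIcc a b)) (hu : TendstoUniformlyOn γk γ p (uIcc a b))
    (hz : Tendsto zk p (𝓝 z)) (hzn : z ∉ γ '' uIcc a b) :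
    Tendsto (fun k => dd (γk k) a b (zk k)) p (𝓝 (dd γ a b z)) := by
  refine linc_tendsto (dd_good hγ hzn) (hγk.mono fun k hk => hk.sub continuousOn_const) ?_
  rw [Metric.tendstoUniformlyOn_iff] at hu ⊢
  intro ε hε
  filter_upwards [hu (ε / 2) (by positivity), Metric.tendsto_nhds.1 hz (ε / 2) (by positivity)]
    with k h1 h2 t ht
  have := dist_sub_sub_le (γ t) z (γk k t) (zk k)
  rw [dist_comm z] at this
  linarith [h1 t ht]

theorem dd_continuousAt {γ : ℝ → ℂ} {z : ℂ} {a b : ℝ} (hγ : ContinuousOn γ (uIcc a b))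
    (hzn : z ∉ γ '' uIcc a b) : ContinuousAt (dd γ a b) z := by
  refine dd_tendsto (γk := fun _ => γ) (zk := fun w => w) hγ (Eventually.of_forall fun _ => hγ) ?_
    tendsto_id hzn
  rw [Metric.tendstoUniformlyOn_iff]
  intro ε hε
  exact Eventually.of_forall fun _ _ _ => by simpa using hε

theorem dd_exp {γ : ℝ → ℂ} {z : ℂ} {a b : ℝ} (hγ : ContinuousOn γ (uIcc a b))
    (hzn : z ∉ γ '' uIcc a b) : Complex.exp (dd γ a b z) = (γ b - z) / (γ a - z) :=
  linc_exp (dd_good hγ hzn)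

/-- the logarithmic increment along an arc cannot be extended continuously across the arc -/
theorem jump {γ : ℝ → ℂ} {α β v ρ : ℝ} {E' : ℂ → ℂ} (hγ : ContinuousOn γ (Icc α β))
    (hi : InjOn γ (Icc α β)) (hαv : α < v) (hvβ : v < β) (hρ : 0 < ρ)
    (hdense : Dense (γ '' Icc α β)ᶜ)
    (hE' : ContinuousOn E' (ball (γ v) ρ))
    (hEE : ∀ z ∈ ball (γ v) ρ, z ∉ γ '' Icc α β → E' z = dd γ α β z) : False := by
  classical
  have hαβ : α < β := hαv.trans hvβ
  have hvm : v ∈ Icc α β := ⟨hαv.le, hvβ.le⟩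
  have hαm : α ∈ Icc α β := left_mem_Icc.2 hαβ.le
  have hβm : β ∈ Icc α β := right_mem_Icc.2 hαβ.le
  have hu : uIcc α β = Icc α β := uIcc_of_le hαβ.le
  set S := γ '' Icc α β with hS
  have hScomp : IsCompact S := isCompact_Icc.image_of_continuousOn hγ
  set x := γ v with hx
  have h1 : 0 < dist (γ α) x := dist_pos.2 (fun h => hαv.ne (hi hαm hvm h))
  have h2 : 0 < dist (γ β) x := dist_pos.2 (fun h => hvβ.ne' (hi hβm hvm h))
  set r := min ρ (min (dist (γ α) x) (dist (γ β) x)) with hr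
  have hr0 : 0 < r := lt_min hρ (lt_min h1 h2)
  have hrρ : r ≤ ρ := min_le_left _ _
  have hαb : γ α ∉ ball x r := fun h => by
    have h3 : dist (γ α) x < r := h
    exact absurd h3 (not_lt.2 ((min_le_right _ _).trans (min_le_left _ _)))
  have hβb : γ β ∉ ball x r := fun h => by
    have h3 : dist (γ β) x < r := h
    exact absurd h3 (not_lt.2 ((min_le_right _ _).trans (min_le_right _ _)))
  set S0 := γ '' Icc α v \ ball x r with hS0
  set S1 := γ '' Icc v β \ ball x r with hS1
  have hs0 : Icc α v ⊆ Icc α β := Icc_subset_Icc le_rfl hvβ.le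
  have hs1 : Icc v β ⊆ Icc α β := Icc_subset_Icc hαv.le le_rfl
  have hc0 : IsCompact S0 := (isCompact_Icc.image_of_continuousOn (hγ.mono hs0)).diff isOpen_ball
  have hc1 : IsCompact S1 := (isCompact_Icc.image_of_continuousOn (hγ.mono hs1)).diff isOpen_ball
  have hd01 : Disjoint S0 S1 := by
    rw [disjoint_left]
    rintro z ⟨⟨t, ht, rfl⟩, hz⟩ ⟨⟨t', ht', h⟩, -⟩
    have heq := hi (hs1 ht') (hs0 ht) h
    have : t = v := le_antisymm ht.2 (heq ▸ ht'.1)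
    exact hz (by rw [this]; exact mem_ball_self hr0)
  obtain ⟨R, hR⟩ := hScomp.isBounded.exists_norm_le
  have hfar : IsClosed {z : ℂ | R + 1 ≤ ‖z‖} := isClosed_le continuous_const continuous_norm
  have hdf : Disjoint (S0 ∪ {z : ℂ | R + 1 ≤ ‖z‖}) S1 := by
    rw [disjoint_union_left]
    refine ⟨hd01, ?_⟩
    rw [disjoint_left]
    intro z hz hz1
    have hz' : R + 1 ≤ ‖z‖ := hz
    have := hR z (image_mono hs1 hz1.1)
    linarith
  obtain ⟨f, hf0, hf1, -⟩ := exists_continuous_zero_one_of_isClosed (hc0.isClosed.union hfar)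
    hc1.isClosed hdf
  set Et : ℂ → ℂ := fun z => if z ∈ ball x r then E' z else dd γ α β z with hEt
  have hbE : ∀ z, z ∉ S → Et z = dd γ α β z := by
    intro z hz
    simp only [hEt]
    split_ifs with hb
    · exact hEE z (ball_subset_ball hrρ hb) hz
    · rfl
  have hEc : ∀ z, z ∉ S0 → z ∉ S1 → ContinuousAt Et z := by
    intro z hz0 hz1
    by_cases hb : z ∈ ball x r
    · have : ContinuousAt E' z := hE'.continuousAt (isOpen_ball.mem_nhds (ball_subset_ball hrρ hb))
      refine this.congr ?_
      filter_upwards [isOpen_ball.mem_nhds hb] with y hy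
      simp only [hEt, if_pos hy]
    · have hzS : z ∉ S := by
        rintro ⟨t, ht, rfl⟩
        rcases le_total t v with h | h
        · exact hz0 ⟨⟨t, ⟨ht.1, h⟩, rfl⟩, hb⟩
        · exact hz1 ⟨⟨t, ⟨h, ht.2⟩, rfl⟩, hb⟩
      have : ContinuousAt (dd γ α β) z := dd_continuousAt (by rwa [hu]) (by rwa [hu])
      refine this.congr ?_
      filter_upwards [hScomp.isClosed.isOpen_compl.mem_nhds hzS] with y hy
      exact (hbE y hy).symm
  have hα0 : γ α ∈ S0 := ⟨⟨α, ⟨le_rfl, hαv.le⟩, rfl⟩, hαb⟩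
  have hβ1 : γ β ∈ S1 := ⟨⟨β, ⟨hvβ.le, le_rfl⟩, rfl⟩, hβb⟩
  have hexp : ∀ z, z ∉ S0 → z ∉ S1 → Complex.exp (Et z) = (z - γ β) / (z - γ α) := by
    intro z hz0 hz1
    have hne : z - γ α ≠ 0 := fun h => hz0 (by rwa [sub_eq_zero.1 h])
    have hsep : ∀ y ∈ Sᶜ, Complex.exp (Et y) - (y - γ β) / (y - γ α) = 0 := by
      intro y hy
      rw [hbE y hy, dd_exp (by rwa [hu]) (by rwa [hu]), ← neg_sub y, ← neg_sub y (γ α), neg_div_neg_eq,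
        sub_self]
    have hcz : ContinuousAt (fun y => Complex.exp (Et y) - (y - γ β) / (y - γ α)) z :=
      (Complex.continuous_exp.continuousAt.comp (hEc z hz0 hz1)).sub
        (ContinuousAt.div (by fun_prop) (by fun_prop) hne)
    have hfr : ∃ᶠ y in 𝓝 z, Complex.exp (Et y) - (y - γ β) / (y - γ α) ∈ ({0} : Set ℂ) :=
      (mem_closure_iff_frequently.1 (hdense z)).mono fun y hy => hsep y hy
    have := isClosed_singleton.mem_of_frequently_of_tendsto hfr hcz
    exact sub_eq_zero.1 this
  set χ : ℂ → ℝ := fun z => max 0 (min 1 (3 * f z - 1)) with hχ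
  have hχc : Continuous χ := by fun_prop
  refine no_retract (fun z => if 2/3 ≤ f z then z - γ α else
    (z - γ β) * Complex.exp (-(χ z) * Et z)) ?_ ?_ (γ β) (R + 1) ?_
  · rw [continuous_iff_continuousAt]
    intro z
    rcases lt_or_ge (f z) (1/3) with hz | hz
    · have : ContinuousAt (fun z => z - γ β) z := by fun_prop
      refine this.congr ?_
      filter_upwards [f.continuous.continuousAt.eventually (eventually_lt_nhds hz)] with y hy
      rw [if_neg (by linarith)]
      have : χ y = 0 := by
        simp only [hχ]
        exact max_eq_left ((min_le_right _ _).trans (by linarith))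
      simp [this]
    rcases lt_or_ge (2/3) (f z) with hz' | hz'
    · have : ContinuousAt (fun z => z - γ α) z := by fun_prop
      refine this.congr ?_
      filter_upwards [f.continuous.continuousAt.eventually (eventually_gt_nhds hz')] with y hy
      rw [if_pos hy.le]
    have hn0 : z ∉ S0 := fun h => by
      have : f z = 0 := hf0 (Or.inl h)
      linarith
    have hn1 : z ∉ S1 := fun h => by
      have : f z = 1 := hf1 h
      linarith
    have : ContinuousAt (fun z => (z - γ β) * Complex.exp (-(χ z) * Et z)) z := by
      refine ContinuousAt.mul (by fun_prop) (Complex.continuous_exp.continuousAt.comp ?_)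
      exact ContinuousAt.mul (by fun_prop) (hEc z hn0 hn1)
    refine this.congr ?_
    filter_upwards [hc0.isClosed.isOpen_compl.mem_nhds hn0,
      hc1.isClosed.isOpen_compl.mem_nhds hn1] with y hy0 hy1
    split_ifs with hy
    · have h5 : χ y = 1 := by
        simp only [hχ]
        rw [min_eq_left (by linarith)]; simp
      have hb : y - γ β ≠ 0 := fun h => hy1 (by rwa [sub_eq_zero.1 h])
      have ha : y - γ α ≠ 0 := fun h => hy0 (by rwa [sub_eq_zero.1 h])
      rw [h5]
      simp only [Complex.ofReal_one, neg_mul, one_mul, Complex.exp_neg, hexp y hy0 hy1]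
      field_simp
    · rfl
  · intro z
    beta_reduce
    split_ifs with hz
    · intro h
      have : f (γ α) = 0 := hf0 (Or.inl hα0)
      rw [← sub_eq_zero.1 h] at this
      linarith
    · refine mul_ne_zero (fun h => ?_) (Complex.exp_ne_zero _)
      have : f (γ β) = 1 := hf1 hβ1
      rw [← sub_eq_zero.1 h] at this
      linarith
  · intro z hz
    have h0 : f z = 0 := hf0 (Or.inr hz)
    have : χ z = 0 := by simp [hχ, h0]
    beta_reduce
    rw [if_neg (by rw [h0]; norm_num), this]
    simp

end RMC
end

section
open Set Filter Topology Metric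

namespace RMC

/-- the boundary configuration -/
structure Cfg (γ : ℝ → ℂ) (G : Set ℂ) : Prop where
  cont : Continuous γ
  i1 : InjOn γ (Icc 0 1)
  i2 : InjOn γ (Icc 1 2)
  i3 : InjOn γ (Icc 2 3)
  n1 : ∀ τ ∈ Icc (2:ℝ) 3, ∀ σ ∈ Icc (0:ℝ) 1, γ τ = γ σ → σ = 0 ∨ σ = 1
  n2 : ∀ τ ∈ Icc (2:ℝ) 3, ∀ σ ∈ Icc (1:ℝ) 2, γ τ = γ σ → σ = 1 ∨ σ = 2
  closed : γ 0 = γ 3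
  hc : γ 2 ∉ γ '' Icc 0 1
  openG : IsOpen G
  connG : IsPreconnected G
  h0 : (0:ℂ) ∈ G
  fr : frontier G = γ '' Icc 0 3

theorem exp_loc {I : ℂ → ℂ} {z : ℂ} (hc : ContinuousAt I z)
    (he : ∀ᶠ w in 𝓝 z, Complex.exp (I w) = 1) : ∀ᶠ w in 𝓝 z, I w = I z := by
  have hz := he.self_of_nhds
  filter_upwards [he, hc.eventually (Metric.ball_mem_nhds (I z) (by norm_num : (0:ℝ) < 6))]
    with w h1 h2
  have h3 : dist (I w) (I z) < 6 := h2
  rw [dist_eq_norm] at h3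
  exact sub_eq_zero.1 (exp_eq_one_norm_lt (by rw [Complex.exp_sub, h1, hz, div_one]) h3)

theorem bad_empty {G L1 L2 X : Set ℂ} {I1 I2 : ℂ → ℂ} (hG : IsOpen G) (h0 : (0:ℂ) ∈ G)
    (hfr : frontier G = L1 ∪ L2) (hX : L1 ∩ L2 ⊆ X) (hXf : X ⊆ frontier G)
    (hpre : IsPreconnected Xᶜ)
    (l1 : ∀ z ∉ L1, ∀ᶠ w in 𝓝 z, I1 w = I1 z) (l2 : ∀ z ∉ L2, ∀ᶠ w in 𝓝 z, I2 w = I2 z)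
    (g1 : ∀ z ∈ G, I1 z = I1 0) (g2 : ∀ z ∈ G, I2 z = I2 0) :
    ∀ z ∉ frontier G, I1 z = I1 0 ∨ I2 z = I2 0 := by
  intro z hz
  by_contra! hbad
  set Bad : Set ℂ := {z | z ∉ frontier G ∧ I1 z ≠ I1 0 ∧ I2 z ≠ I2 0} with hBad
  have hBo : IsOpen Bad := by
    rw [isOpen_iff_mem_nhds]
    rintro y ⟨hy, hy1, hy2⟩
    have hyL : y ∉ L1 ∧ y ∉ L2 := by rw [hfr] at hy; simpa using hy
    filter_upwards [l1 y hyL.1, l2 y hyL.2, isClosed_frontier.isOpen_compl.mem_nhds hy]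
      with w h1 h2 h3
    exact ⟨h3, by rwa [h1], by rwa [h2]⟩
  have key : ∀ y ∈ closure Bad, y ∉ X → y ∈ Bad := by
    intro y hy hyX
    have hfreq := mem_closure_iff_frequently.1 hy
    have hgen : ∀ I : ℂ → ℂ, (∀ᶠ w in 𝓝 y, I w = I y) → (∀ z ∈ Bad, I z ≠ I 0) → I y ≠ I 0 := by
      intro I hI hB
      obtain ⟨b, hb1, hb2⟩ := (hfreq.and_eventually hI).exists
      rw [← hb2]; exact hB b hb1
    have hcl : ∀ I : ℂ → ℂ, (∀ᶠ w in 𝓝 y, I w = I y) → (I y ≠ I 0) → (∀ z ∈ G, I z = I 0) →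
        y ∉ frontier G := by
      intro I hI hB hg hyf
      have := mem_closure_iff_frequently.1 (frontier_subset_closure hyf)
      obtain ⟨b, hb1, hb2⟩ := (this.and_eventually hI).exists
      exact hB (hb2.symm.trans (hg b hb1))
    have hf : y ∉ frontier G := by
      by_cases hy1 : y ∈ L1
      · have hy2 : y ∉ L2 := fun h => hyX (hX ⟨hy1, h⟩)
        exact hcl I2 (l2 y hy2) (hgen I2 (l2 y hy2) fun z hz => hz.2.2) g2
      · exact hcl I1 (l1 y hy1) (hgen I1 (l1 y hy1) fun z hz => hz.2.1) g1
    have hyL : y ∉ L1 ∧ y ∉ L2 := by rw [hfr] at hf; simpa using hf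
    exact ⟨hf, hgen I1 (l1 y hyL.1) fun z hz => hz.2.1, hgen I2 (l2 y hyL.2) fun z hz => hz.2.2⟩
  have h0f : (0:ℂ) ∉ frontier G := fun h => by rw [hG.frontier_eq] at h; exact h.2 h0
  obtain ⟨y, hy1, hy2, hy3⟩ := hpre Bad (closure Bad)ᶜ hBo isClosed_closure.isOpen_compl
    (fun y hy => by
      by_cases h : y ∈ closure Bad
      · exact Or.inl (key y h hy)
      · exact Or.inr h)
    ⟨z, fun h => hz (hXf h), hz, hbad.1, hbad.2⟩
    ⟨0, fun h => h0f (hXf h), fun h => by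
      obtain ⟨b, hb1, hb2⟩ := mem_closure_iff.1 h G hG h0
      exact hb2.2.1 (g1 b hb1)⟩
  exact hy3 (subset_closure hy2)

namespace Cfg

variable {γ : ℝ → ℂ} {G : Set ℂ}

theorem img (h : Cfg γ G) {τ : ℝ} (hτ : τ ∈ Icc (0:ℝ) 3) : γ τ ∈ frontier G := by
  rw [h.fr]; exact ⟨τ, hτ, rfl⟩

theorem zero_notMem (h : Cfg γ G) : (0:ℂ) ∉ frontier G := fun hf => by
  rw [h.openG.frontier_eq] at hf; exact hf.2 h.h0

theorem dense (h : Cfg γ G) : Dense (frontier G)ᶜ := by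
  rw [← interior_eq_empty_iff_dense_compl]
  rw [← frontier_compl]
  exact interior_frontier h.openG.isClosed_compl

/-- double points lie on `X` -/
theorem dbl (h : Cfg γ G) {τ σ : ℝ} (hτ : τ ∈ Icc (0:ℝ) 3) (hσ : σ ∈ Icc (0:ℝ) 3) (hne : τ ≠ σ)
    (he : γ τ = γ σ) : γ τ ∈ γ '' Icc 0 1 ∪ {γ 2} := by
  by_contra hn
  have ha : ∀ x ∈ Icc (0:ℝ) 3, γ x = γ τ → 1 < x ∧ x ≠ 2 := by
    intro x hx hxe
    refine ⟨?_, ?_⟩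
    · by_contra hx1
      exact hn (Or.inl ⟨x, ⟨hx.1, not_lt.1 hx1⟩, hxe⟩)
    · rintro rfl
      exact hn (Or.inr hxe.symm)
  obtain ⟨t1, t2⟩ := ha τ hτ rfl
  obtain ⟨s1, s2⟩ := ha σ hσ he.symm
  rcases le_total τ 2 with h1 | h1 <;> rcases le_total σ 2 with h2 | h2
  · exact hne (h.i2 ⟨t1.le, h1⟩ ⟨s1.le, h2⟩ he)
  · rcases h.n2 σ ⟨h2, hσ.2⟩ τ ⟨t1.le, h1⟩ he.symm with h3 | h3
    · exact t1.ne' h3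
    · exact t2 h3
  · rcases h.n2 τ ⟨h1, hτ.2⟩ σ ⟨s1.le, h2⟩ he with h3 | h3
    · exact s1.ne' h3
    · exact s2 h3
  · exact hne (h.i3 ⟨h1, hτ.2⟩ ⟨h2, hσ.2⟩ he)

theorem Xsub (h : Cfg γ G) : γ '' Icc 0 1 ∪ {γ 2} ⊆ frontier G := by
  rintro z (⟨t, ht, rfl⟩ | rfl)
  · exact h.img ⟨ht.1, ht.2.trans (by norm_num)⟩
  · exact h.img ⟨by norm_num, by norm_num⟩

variable {s t : ℝ}

theorem fr_eq (h : Cfg γ G) (hs : 0 ≤ s) (hst : s ≤ t) (ht : t ≤ 3) :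
    frontier G = γ '' Icc s t ∪ (γ '' Icc 0 s ∪ γ '' Icc t 3) := by
  rw [h.fr, ← image_union, ← image_union]
  congr 1
  ext x
  simp only [mem_Icc, mem_union]
  constructor
  · intro hx
    rcases le_total x s with h1 | h1
    · exact Or.inr (Or.inl ⟨hx.1, h1⟩)
    rcases le_total x t with h2 | h2
    · exact Or.inl ⟨h1, h2⟩
    · exact Or.inr (Or.inr ⟨h2, hx.2⟩)
  · rintro (⟨h1, h2⟩ | ⟨h1, h2⟩ | ⟨h1, h2⟩) <;> constructor <;> linarith

theorem L12 (h : Cfg γ G) (hs : 0 ≤ s) (hst : s < t) (ht : t ≤ 3) (he : γ s = γ t) :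
    γ '' Icc s t ∩ (γ '' Icc 0 s ∪ γ '' Icc t 3) ⊆ γ '' Icc 0 1 ∪ {γ 2} := by
  have hsm : s ∈ Icc (0:ℝ) 3 := ⟨hs, hst.le.trans ht⟩
  have htm : t ∈ Icc (0:ℝ) 3 := ⟨hs.trans hst.le, ht⟩
  have hp := h.dbl hsm htm hst.ne he
  rintro z ⟨⟨τ, hτ, rfl⟩, hz⟩
  have hτ3 : τ ∈ Icc (0:ℝ) 3 := ⟨hs.trans hτ.1, hτ.2.trans ht⟩
  rcases hz with ⟨σ, hσ, hz⟩ | ⟨σ, hσ, hz⟩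
  · by_cases hne : τ = σ
    · have : τ = s := le_antisymm (hne ▸ hσ.2) hτ.1
      rwa [this]
    · exact h.dbl hτ3 ⟨hσ.1, hσ.2.trans hsm.2⟩ hne hz.symm
  · by_cases hne : τ = σ
    · have : τ = t := le_antisymm hτ.2 (hne ▸ hσ.1)
      rwa [this, ← he]
    · exact h.dbl hτ3 ⟨htm.1.trans hσ.1, hσ.2⟩ hne hz.symm

end Cfg

theorem dd_loc_aux {γ : ℝ → ℂ} (hγ : Continuous γ) {a b : ℝ} (hab : a ≤ b) {z : ℂ}
    (hz : z ∉ γ '' Icc a b) : ∀ᶠ w in 𝓝 z, w ∉ γ '' Icc a b :=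
  ((isCompact_Icc.image hγ).isClosed.isOpen_compl.mem_nhds hz)

theorem dd_exp' {γ : ℝ → ℂ} (hγ : Continuous γ) {a b : ℝ} (hab : a ≤ b) {z : ℂ}
    (hz : z ∉ γ '' Icc a b) : Complex.exp (dd γ a b z) = (γ b - z) / (γ a - z) :=
  dd_exp hγ.continuousOn (by rwa [uIcc_of_le hab])

theorem dd_cont' {γ : ℝ → ℂ} (hγ : Continuous γ) {a b : ℝ} (hab : a ≤ b) {z : ℂ}
    (hz : z ∉ γ '' Icc a b) : ContinuousAt (dd γ a b) z :=
  dd_continuousAt hγ.continuousOn (by rwa [uIcc_of_le hab])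

namespace Cfg

variable {γ : ℝ → ℂ} {G : Set ℂ} {s t : ℝ}

theorem e1 (h : Cfg γ G) (hst : s ≤ t) (he : γ s = γ t) {z : ℂ}
    (hz : z ∉ γ '' Icc s t) : Complex.exp (dd γ s t z) = 1 := by
  rw [dd_exp' h.cont hst hz, he, div_self]
  intro h0
  exact hz ⟨t, right_mem_Icc.2 hst, sub_eq_zero.1 h0⟩

theorem e2 (h : Cfg γ G) (hs : 0 ≤ s) (ht : t ≤ 3) (he : γ s = γ t) {z : ℂ}
    (hz : z ∉ γ '' Icc 0 s ∪ γ '' Icc t 3) :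
    Complex.exp (dd γ 0 s z + dd γ t 3 z) = 1 := by
  rw [mem_union, not_or] at hz
  have h1 : γ t - z ≠ 0 := fun h0 => hz.2 ⟨t, left_mem_Icc.2 ht, sub_eq_zero.1 h0⟩
  have h3 : γ 3 - z ≠ 0 := fun h0 => hz.2 ⟨3, right_mem_Icc.2 ht, sub_eq_zero.1 h0⟩
  rw [Complex.exp_add, dd_exp' h.cont hs hz.1, dd_exp' h.cont ht hz.2, he, h.closed]
  field_simp

theorem l1 (h : Cfg γ G) (hst : s ≤ t) (he : γ s = γ t) :
    ∀ z ∉ γ '' Icc s t, ∀ᶠ w in 𝓝 z, dd γ s t w = dd γ s t z := by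
  intro z hz
  exact exp_loc (dd_cont' h.cont hst hz)
    ((dd_loc_aux h.cont hst hz).mono fun w hw => h.e1 hst he hw)

theorem l2 (h : Cfg γ G) (hs : 0 ≤ s) (ht : t ≤ 3) (he : γ s = γ t) :
    ∀ z ∉ γ '' Icc 0 s ∪ γ '' Icc t 3, ∀ᶠ w in 𝓝 z,
      dd γ 0 s w + dd γ t 3 w = dd γ 0 s z + dd γ t 3 z := by
  intro z hz
  have hz' := hz
  rw [mem_union, not_or] at hz'
  refine exp_loc (I := fun z => dd γ 0 s z + dd γ t 3 z)
    ((dd_cont' h.cont hs hz'.1).add (dd_cont' h.cont ht hz'.2)) ?_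
  filter_upwards [dd_loc_aux h.cont hs hz'.1, dd_loc_aux h.cont ht hz'.2] with w h1 h2
  exact h.e2 hs ht he (by rw [mem_union, not_or]; exact ⟨h1, h2⟩)

theorem G_fr (h : Cfg γ G) {z : ℂ} (hz : z ∈ G) : z ∉ frontier G := fun hf => by
  rw [h.openG.frontier_eq] at hf; exact hf.2 hz

theorem const_of_loc (h : Cfg γ G) {L : Set ℂ} (hL : L ⊆ frontier G) {I : ℂ → ℂ}
    (hl : ∀ z ∉ L, ∀ᶠ w in 𝓝 z, I w = I z) : ∀ z ∈ G, I z = I 0 := by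
  intro z hz
  have hz0 : ∀ z ∈ G, ∀ᶠ w in 𝓝 z, I w = I z := fun z hz => hl z fun hzL => h.G_fr hz (hL hzL)
  by_contra hne
  obtain ⟨y, -, hy1, hy2⟩ := h.connG {y | y ∈ G ∧ I y = I 0} {y | y ∈ G ∧ I y ≠ I 0}
    (by
      rw [isOpen_iff_mem_nhds]
      rintro y ⟨hy, hy0⟩
      filter_upwards [hz0 y hy, h.openG.mem_nhds hy] with w h1 h2
      exact ⟨h2, h1.trans hy0⟩)
    (by
      rw [isOpen_iff_mem_nhds]
      rintro y ⟨hy, hy0⟩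
      filter_upwards [hz0 y hy, h.openG.mem_nhds hy] with w h1 h2
      exact ⟨h2, by rwa [h1]⟩)
    (fun y hy => by
      by_cases hI : I y = I 0
      · exact Or.inl ⟨hy, hI⟩
      · exact Or.inr ⟨hy, hI⟩)
    ⟨0, h.h0, h.h0, rfl⟩ ⟨z, hz, hz, hne⟩
  exact hy2.2 hy1.2

theorem g1 (h : Cfg γ G) (hs : 0 ≤ s) (hst : s ≤ t) (ht : t ≤ 3) (he : γ s = γ t) :
    ∀ z ∈ G, dd γ s t z = dd γ s t 0 :=
  h.const_of_loc (L := γ '' Icc s t)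
    (by rw [h.fr_eq hs hst ht]; exact subset_union_left) (h.l1 hst he)

theorem g2 (h : Cfg γ G) (hs : 0 ≤ s) (hst : s ≤ t) (ht : t ≤ 3) (he : γ s = γ t) :
    ∀ z ∈ G, dd γ 0 s z + dd γ t 3 z = dd γ 0 s 0 + dd γ t 3 0 :=
  h.const_of_loc (L := γ '' Icc 0 s ∪ γ '' Icc t 3) (I := fun z => dd γ 0 s z + dd γ t 3 z)
    (by rw [h.fr_eq hs hst ht]; exact subset_union_right) (h.l2 hs ht he)

theorem T1 (h : Cfg γ G) (hs : 0 ≤ s) (hst : s < t) (ht : t ≤ 3) (he : γ s = γ t) :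
    ∀ z ∉ frontier G, dd γ s t z = dd γ s t 0 ∨
      dd γ 0 s z + dd γ t 3 z = dd γ 0 s 0 + dd γ t 3 0 :=
  bad_empty (I1 := dd γ s t) (I2 := fun z => dd γ 0 s z + dd γ t 3 z) h.openG h.h0
    (h.fr_eq hs hst.le ht) (h.L12 hs hst ht he) h.Xsub
    (nonsep h.cont.continuousOn h.i1 h.hc) (h.l1 hst.le he) (h.l2 hs ht he)
    (h.g1 hs hst.le ht he) (h.g2 hs hst.le ht he)

/-- limit points of bad sets lie on both loops -/
theorem T1' (h : Cfg γ G) (hs : 0 ≤ s) (hst : s < t) (ht : t ≤ 3) (he : γ s = γ t) {z : ℂ}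
    (h1 : z ∉ γ '' Icc s t → dd γ s t z ≠ dd γ s t 0)
    (h2 : z ∉ γ '' Icc 0 s ∪ γ '' Icc t 3 →
      dd γ 0 s z + dd γ t 3 z ≠ dd γ 0 s 0 + dd γ t 3 0) :
    z ∈ γ '' Icc s t ∩ (γ '' Icc 0 s ∪ γ '' Icc t 3) := by
  have hcl : ∀ I : ℂ → ℂ, (∀ᶠ w in 𝓝 z, I w = I z) → (I z ≠ I 0) → (∀ z ∈ G, I z = I 0) →
      z ∉ frontier G := by
    intro I hI hB hg hyf
    have := mem_closure_iff_frequently.1 (frontier_subset_closure hyf)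
    obtain ⟨b, hb1, hb2⟩ := (this.and_eventually hI).exists
    exact hB (hb2.symm.trans (hg b hb1))
  have hfr := h.fr_eq hs hst.le ht
  by_cases hz1 : z ∈ γ '' Icc s t <;> by_cases hz2 : z ∈ γ '' Icc 0 s ∪ γ '' Icc t 3
  · exact ⟨hz1, hz2⟩
  · exact absurd (hfr ▸ Or.inl hz1) (hcl (fun z => dd γ 0 s z + dd γ t 3 z)
      (h.l2 hs ht he z hz2) (h2 hz2) (h.g2 hs hst.le ht he))
  · exact absurd (hfr ▸ Or.inr hz2) (hcl (dd γ s t)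
      (h.l1 hst.le he z hz1) (h1 hz1) (h.g1 hs hst.le ht he))
  · rcases h.T1 hs hst ht he z (by rw [hfr, mem_union, not_or]; exact ⟨hz1, hz2⟩) with h3 | h3
    · exact absurd h3 (h1 hz1)
    · exact absurd h3 (h2 hz2)

end Cfg
end RMC
end

section
open Set Filter Topology Metric

namespace RMC

theorem dd_add {γ : ℝ → ℂ} (hγ : Continuous γ) {A B a b c : ℝ} {z : ℂ} (hz : z ∉ γ '' Icc A B)
    (ha : a ∈ Icc A B) (hb : b ∈ Icc A B) (hc : c ∈ Icc A B) :
    dd γ a b z + dd γ b c z = dd γ a c z :=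
  linc_add (dd_good hγ.continuousOn hz) ha hb hc

theorem dd_evcont {γ : ℝ → ℂ} (hγ : Continuous γ) {a b : ℝ} (hab : a ≤ b) {z : ℂ}
    (hz : z ∉ γ '' Icc a b) : ∀ᶠ y in 𝓝 z, ContinuousAt (dd γ a b) y :=
  (dd_loc_aux hγ hab hz).mono fun _ hy => dd_cont' hγ hab hy

theorem piece {γ : ℝ → ℂ} (hγ : Continuous γ) {a b α β v : ℝ} {w : ℝ → ℝ}
    (hαv : α < v) (hvβ : v < β) (hw : ContinuousOn w (Icc α β))
    (hm : MapsTo w (Icc α β) (Icc a b)) (hinj : InjOn w (Icc α β))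
    (hgw : ∀ r ∈ Icc α β, γ (w r) = γ r) (huniq : ∀ r ∈ Icc a b, γ r = γ v → r = w v) :
    ∃ (ε : ℂ) (R : ℂ → ℂ), (ε = 1 ∨ ε = -1) ∧ (∀ᶠ y in 𝓝 (γ v), ContinuousAt R y) ∧
      ∀ z ∉ γ '' Icc a b, dd γ a b z = ε * dd γ α β z + R z := by
  have hαβ := hαv.trans hvβ
  have hαm : α ∈ Icc α β := left_mem_Icc.2 hαβ.le
  have hβm : β ∈ Icc α β := right_mem_Icc.2 hαβ.le
  have hvm : v ∈ Icc α β := ⟨hαv.le, hvβ.le⟩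
  have hab : a ≤ b := (hm hvm).1.trans (hm hvm).2
  have hmid : ∀ z ∉ γ '' Icc a b, dd γ (w α) (w β) z = dd γ α β z := by
    intro z hz
    unfold dd
    rw [← linc_comp' (f := fun t => γ t - z) (u := w) (a := α) (b := β)
      (dd_good hγ.continuousOn hz) (by rwa [uIcc_of_le hαβ.le]) (by rwa [uIcc_of_le hαβ.le])]
    refine linc_congr fun r hr => ?_
    rw [uIcc_of_le hαβ.le] at hr
    rw [hgw r hr]
  rcases hw.strictMonoOn_of_injOn_Icc' hαβ.le hinj with hmono | hmono
  · have h1 := hmono hαm hvm hαv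
    have h2 := hmono hvm hβm hvβ
    refine ⟨1, fun z => dd γ a (w α) z + dd γ (w β) b z, Or.inl rfl, ?_, ?_⟩
    · have c1 : γ v ∉ γ '' Icc a (w α) := by
        rintro ⟨r, hr, hrv⟩
        have := huniq r ⟨hr.1, hr.2.trans (hm hαm).2⟩ hrv
        linarith [hr.2]
      have c2 : γ v ∉ γ '' Icc (w β) b := by
        rintro ⟨r, hr, hrv⟩
        have := huniq r ⟨(hm hβm).1.trans hr.1, hr.2⟩ hrv
        linarith [hr.1]
      filter_upwards [dd_evcont hγ (hm hαm).1 c1, dd_evcont hγ (hm hβm).2 c2] with y hy1 hy2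
      exact hy1.add hy2
    · intro z hz
      rw [← hmid z hz, ← dd_add hγ hz (left_mem_Icc.2 hab) (hm hαm) (right_mem_Icc.2 hab),
        ← dd_add hγ hz (hm hαm) (hm hβm) (right_mem_Icc.2 hab)]
      ring
  · have h1 := hmono hαm hvm hαv
    have h2 := hmono hvm hβm hvβ
    refine ⟨-1, fun z => dd γ a (w β) z + dd γ (w α) b z, Or.inr rfl, ?_, ?_⟩
    · have c1 : γ v ∉ γ '' Icc a (w β) := by
        rintro ⟨r, hr, hrv⟩
        have := huniq r ⟨hr.1, hr.2.trans (hm hβm).2⟩ hrv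
        linarith [hr.2]
      have c2 : γ v ∉ γ '' Icc (w α) b := by
        rintro ⟨r, hr, hrv⟩
        have := huniq r ⟨(hm hαm).1.trans hr.1, hr.2⟩ hrv
        linarith [hr.1]
      filter_upwards [dd_evcont hγ (hm hβm).1 c1, dd_evcont hγ (hm hαm).2 c2] with y hy1 hy2
      exact hy1.add hy2
    · intro z hz
      rw [← hmid z hz, ← dd_add hγ hz (left_mem_Icc.2 hab) (hm hαm) (right_mem_Icc.2 hab),
        ← dd_add hγ hz (left_mem_Icc.2 hab) (hm hβm) (hm hαm)]
      have := dd_add hγ hz (hm hβm) (hm hαm) (hm hβm)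
      have h3 : dd γ (w β) (w β) z = 0 := linc_self _ _
      rw [h3] at this
      linear_combination this

theorem pre_split {S : Set ℝ} (hS : IsPreconnected S) {s t : ℝ} (hs : s ∉ S) (ht : t ∉ S) :
    S ⊆ Iio s ∨ S ⊆ Ioo s t ∨ S ⊆ Ioi t := by
  have g : ∀ a ∉ S, S ⊆ Iio a ∨ S ⊆ Ioi a := by
    intro a ha
    refine hS.subset_or_subset isOpen_Iio isOpen_Ioi ?_ ?_
    · rw [disjoint_left]
      intro x hx hx'
      exact lt_asymm (mem_Iio.1 hx) (mem_Ioi.1 hx')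
    · intro x hx
      rcases lt_trichotomy x a with h | h | h
      · exact Or.inl h
      · exact absurd (h ▸ hx) ha
      · exact Or.inr h
  rcases g s hs with h1 | h1
  · exact Or.inl h1
  rcases g t ht with h2 | h2
  · exact Or.inr (Or.inl fun x hx => ⟨h1 hx, h2 hx⟩)
  · exact Or.inr (Or.inr h2)

/-- final contradiction -/
theorem T2_fin {γ : ℝ → ℂ} {G : Set ℂ} (h : Cfg γ G) {s t α β v : ℝ}
    (hs : 0 ≤ s) (hst : s < t) (ht : t ≤ 3) (he : γ s = γ t)
    (hα0 : 0 < α) (hβ1 : β < 1) (hαv : α < v) (hvβ : v < β)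
    {ε1 ε2 : ℂ} {R1 R2 : ℂ → ℂ} (h1 : ε1 = 1 ∨ ε1 = -1) (h2 : ε2 = 1 ∨ ε2 = -1)
    (c1 : ∀ᶠ y in 𝓝 (γ v), ContinuousAt R1 y) (c2 : ∀ᶠ y in 𝓝 (γ v), ContinuousAt R2 y)
    (f1 : ∀ z ∉ frontier G, dd γ s t z = ε1 * dd γ α β z + R1 z)
    (f2 : ∀ z ∉ frontier G, dd γ 0 s z + dd γ t 3 z = ε2 * dd γ α β z + R2 z) : False := by
  have hfr := h.fr_eq hs hst.le ht
  have q1 : ε1 * ε1 = 1 := by rcases h1 with rfl | rfl <;> norm_num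
  have q2 : ε2 * ε2 = 1 := by rcases h2 with rfl | rfl <;> norm_num
  have hpow : ∀ ε : ℂ, (ε = 1 ∨ ε = -1) → ∀ x, Complex.exp x = 1 → Complex.exp (ε * x) = 1 := by
    rintro ε (rfl | rfl) x hx
    · rwa [one_mul]
    · rw [neg_one_mul, Complex.exp_neg, hx, inv_one]
  obtain ⟨ρ, hρ, hball⟩ := Metric.eventually_nhds_iff_ball.1 (c1.and c2)
  set Q : ℂ → ℂ := fun z => ε1 * R1 z - ε2 * R2 z with hQ
  have hQc : ∀ z ∈ ball (γ v) ρ, ContinuousAt Q z := fun z hz =>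
    ((hball z hz).1.const_mul ε1).sub ((hball z hz).2.const_mul ε2)
  have hv01 : v ∈ Icc (0:ℝ) 1 := ⟨by linarith, by linarith⟩
  have hQe : ∀ z ∉ frontier G, Q z = ε1 * dd γ s t z - ε2 * (dd γ 0 s z + dd γ t 3 z) := by
    intro z hz
    rw [f1 z hz, f2 z hz, hQ]
    linear_combination (-dd γ α β z) * q1 + (dd γ α β z) * q2
  have hQ1 : ∀ z ∉ frontier G, Complex.exp (Q z) = 1 := by
    intro z hz
    rw [hQe z hz]
    rw [hfr, mem_union, not_or] at hz
    rw [Complex.exp_sub, hpow _ h1 _ (h.e1 hst.le he hz.1), hpow _ h2 _ (h.e2 hs ht he hz.2), div_one]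
  have hQ1' : ∀ z ∈ ball (γ v) ρ, Complex.exp (Q z) = 1 := by
    intro z hz
    have hfq : ∃ᶠ y in 𝓝 z, Complex.exp (Q y) ∈ ({1} : Set ℂ) :=
      (mem_closure_iff_frequently.1 (h.dense z)).mono fun y hy => hQ1 y hy
    exact isClosed_singleton.mem_of_frequently_of_tendsto hfq
      (Complex.continuous_exp.continuousAt.comp (hQc z hz))
  have hvf : γ v ∈ frontier G := h.img ⟨by linarith, by linarith⟩
  obtain ⟨g, hgG, hgb⟩ : ∃ g ∈ G, g ∈ ball (γ v) ρ := by
    obtain ⟨g, hg1, hg2⟩ := mem_closure_iff.1 (frontier_subset_closure hvf) _ isOpen_ball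
      (mem_ball_self hρ)
    exact ⟨g, hg2, hg1⟩
  have hQconst : ∀ z ∈ ball (γ v) ρ, Q z = ε1 * dd γ s t 0 - ε2 * (dd γ 0 s 0 + dd γ t 3 0) := by
    intro z hz
    rw [const_of_exp (convex_ball (γ v) ρ).isPreconnected
      (fun y hy => (hQc y hy).continuousWithinAt) hQ1' hz hgb, hQe g (h.G_fr hgG),
      h.g1 hs hst.le ht he g hgG, h.g2 hs hst.le ht he g hgG]
  have hI1 : ∀ z ∈ ball (γ v) ρ, z ∉ frontier G → dd γ s t z = dd γ s t 0 := by
    intro z hz hzf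
    have a1 := hQconst z hz
    rw [hQe z hzf] at a1
    rcases h.T1 hs hst ht he z hzf with h3 | h3
    · exact h3
    · rw [h3] at a1
      have : ε1 * dd γ s t z = ε1 * dd γ s t 0 := by linear_combination a1
      linear_combination (ε1) * this - (dd γ s t z - dd γ s t 0) * q1
  have hsub : γ '' Icc α β ⊆ frontier G := by
    rintro z ⟨r, hr, rfl⟩
    exact h.img ⟨by linarith [hr.1], by linarith [hr.2]⟩
  have hαβ := hαv.trans hvβ
  refine jump (E' := fun z => ε1 * (dd γ s t 0 - R1 z)) (γ := γ) (α := α) (β := β)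
    h.cont.continuousOn (h.i1.mono (Icc_subset_Icc hα0.le hβ1.le)) hαv hvβ hρ
    (h.dense.mono (compl_subset_compl.2 hsub)) ?_ ?_
  · intro z hz
    exact ((continuousAt_const.sub (hball z hz).1).const_mul ε1).continuousWithinAt
  · intro z hz hzS
    have hfq : ∃ᶠ y in 𝓝 z, y ∈ ball (γ v) ρ ∧ y ∉ frontier G :=
      ((mem_closure_iff_frequently.1 (h.dense z)).and_eventually (isOpen_ball.mem_nhds hz)).mono
        fun y hy => ⟨hy.2, hy.1⟩
    have hfq' : ∃ᶠ y in 𝓝 z, ε1 * (dd γ s t 0 - R1 y) - dd γ α β y ∈ ({0} : Set ℂ) := by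
      refine hfq.mono fun y hy => ?_
      have a1 := f1 y hy.2
      rw [hI1 y hy.1 hy.2] at a1
      rw [mem_singleton_iff, a1]
      linear_combination (dd γ α β y) * q1
    have := isClosed_singleton.mem_of_frequently_of_tendsto hfq'
      (((continuousAt_const.sub (hball z hz).1).const_mul ε1).sub (dd_cont' h.cont hαβ.le hzS))
    exact sub_eq_zero.1 this

theorem T2 {γ : ℝ → ℂ} {G : Set ℂ} (h : Cfg γ G) {s t v0 v1 : ℝ}
    (hs : 0 ≤ s) (hst : s < t) (ht : t ≤ 3) (he : γ s = γ t)
    (hv0 : 0 ≤ v0) (hv : v0 < v1) (hv1 : v1 ≤ 1)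
    (hL : ∀ v ∈ Ioo v0 v1, γ v ∈ γ '' Icc s t ∩ (γ '' Icc 0 s ∪ γ '' Icc t 3)) : False := by
  -- the second arc coordinate
  obtain ⟨u2, hu2, hu2', -⟩ := arc_coord (γ := fun r => γ (1 + r)) (c := 0)
    (h.cont.comp (by fun_prop)).continuousOn
    (fun x hx y hy hxy => by
      have := h.i2 (x₁ := 1 + x) (x₂ := 1 + y) ⟨by linarith [hx.1], by linarith [hx.2]⟩
        ⟨by linarith [hy.1], by linarith [hy.2]⟩ hxy
      linarith)
    (by
      rintro ⟨r, hr, hr0⟩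
      exact h.zero_notMem (hr0 ▸ h.img ⟨by linarith [hr.1], by linarith [hr.2]⟩))
  set W : ℝ → ℝ := fun r => 1 + u2 (γ r) with hW
  have hWc : Continuous W := continuous_const.add (hu2.comp h.cont)
  have uniq : ∀ r ∈ Ioo (0:ℝ) 1, ∀ τ ∈ Icc (0:ℝ) 3, γ τ = γ r → τ = r ∨ τ = W r := by
    intro r hr τ hτ hτr
    rcases le_or_gt τ 1 with h1 | h1
    · exact Or.inl (h.i1 ⟨hτ.1, h1⟩ ⟨hr.1.le, hr.2.le⟩ hτr)
    rcases le_or_gt 2 τ with h2 | h2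
    · rcases h.n1 τ ⟨h2, hτ.2⟩ r ⟨hr.1.le, hr.2.le⟩ hτr with h3 | h3
      · exact absurd h3 hr.1.ne'
      · exact absurd h3 hr.2.ne
    · right
      have := hu2' (τ - 1) ⟨by linarith, by linarith⟩
      simp only [add_sub_cancel] at this
      simp only [hW]
      rw [← hτr, this]; ring
  -- choose the interval
  obtain ⟨v, δ, hδ, hvδ⟩ : ∃ v δ : ℝ, 0 < δ ∧ ∀ r ∈ Icc (v - δ) (v + δ),
      r ∈ Ioo v0 v1 ∧ r ≠ s ∧ r ≠ t ∧ γ r ≠ γ s := by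
    have hfin : ({r | r ∈ Icc (0:ℝ) 1 ∧ γ r = γ s} : Set ℝ).Subsingleton := by
      rintro x ⟨hx, hx'⟩ y ⟨hy, hy'⟩
      exact h.i1 hx hy (hx'.trans hy'.symm)
    have hF : ({s, t} ∪ {r | r ∈ Icc (0:ℝ) 1 ∧ γ r = γ s} : Set ℝ).Finite :=
      (Set.toFinite _).union hfin.finite
    obtain ⟨v, hv, hvF⟩ := ((Ioo_infinite hv).sdiff hF).nonempty
    obtain ⟨δ, hδ, hb⟩ := Metric.nhds_basis_closedBall.mem_iff.1
      ((isOpen_Ioo.sdiff hF.isClosed).mem_nhds ⟨hv, hvF⟩)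
    refine ⟨v, δ, hδ, fun r hr => ?_⟩
    rw [Real.closedBall_eq_Icc] at hb
    obtain ⟨h1, h2⟩ := hb hr
    refine ⟨h1, fun h3 => h2 (Or.inl (by simp [h3])), fun h3 => h2 (Or.inl (by simp [h3])),
      fun h3 => h2 (Or.inr ⟨⟨hv0.trans h1.1.le, h1.2.le.trans hv1⟩, h3⟩)⟩
  set α := v - δ with hα
  set β := v + δ with hβ
  have hαv : α < v := by linarith
  have hvβ : v < β := by linarith
  have hαm : α ∈ Icc α β := ⟨le_rfl, by linarith⟩
  have hβm : β ∈ Icc α β := ⟨by linarith, le_rfl⟩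
  have hvm : v ∈ Icc α β := ⟨by linarith, by linarith⟩
  have hα0 : 0 < α := hv0.trans_lt (hvδ α hαm).1.1
  have hβ1 : β < 1 := (hvδ β hβm).1.2.trans_le hv1
  have h01 : ∀ r ∈ Icc α β, r ∈ Ioo (0:ℝ) 1 := fun r hr =>
    ⟨by linarith [hr.1], by linarith [hr.2]⟩
  -- the second preimage
  have claim : ∀ r ∈ Icc α β, γ (W r) = γ r ∧ W r ∈ Icc (0:ℝ) 3 ∧
      ((r ∈ Icc s t ∧ (W r ≤ s ∨ t ≤ W r)) ∨ (W r ∈ Icc s t ∧ (r ≤ s ∨ t ≤ r))) := by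
    intro r hr
    obtain ⟨hri, hrs, hrt, hrp⟩ := hvδ r hr
    obtain ⟨⟨τ, hτ, hτr⟩, hσ'⟩ := hL r hri
    obtain ⟨σ, hσ3, hσ, hσr⟩ : ∃ σ ∈ Icc (0:ℝ) 3, (σ ≤ s ∨ t ≤ σ) ∧ γ σ = γ r := by
      rcases hσ' with ⟨σ, hσ, hσr⟩ | ⟨σ, hσ, hσr⟩
      · exact ⟨σ, ⟨hσ.1, by linarith [hσ.2]⟩, Or.inl hσ.2, hσr⟩
      · exact ⟨σ, ⟨by linarith [hσ.1], hσ.2⟩, Or.inr hσ.1, hσr⟩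
    have hτ3 : τ ∈ Icc (0:ℝ) 3 := ⟨hs.trans hτ.1, hτ.2.trans ht⟩
    have hne : τ ≠ σ := by
      rintro rfl
      rcases hσ with h1 | h1
      · exact hrp (by rw [← hτr, le_antisymm h1 hτ.1])
      · exact hrp (by rw [← hτr, le_antisymm hτ.2 h1, he])
    rcases uniq r (h01 r hr) τ hτ3 hτr with h1 | h1 <;>
      rcases uniq r (h01 r hr) σ hσ3 hσr with h2 | h2
    · exact absurd (h1.trans h2.symm) hne
    · subst h1; rw [← h2]
      exact ⟨hσr, hσ3, Or.inl ⟨hτ, hσ⟩⟩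
    · subst h2; rw [← h1]
      exact ⟨hτr, hτ3, Or.inr ⟨hτ, hσ⟩⟩
    · exact absurd (h1.trans h2.symm) hne
  have hWinj : InjOn W (Icc α β) := by
    intro x hx y hy hxy
    have : γ x = γ y := by rw [← (claim x hx).1, ← (claim y hy).1, hxy]
    exact h.i1 ⟨(h01 x hx).1.le, (h01 x hx).2.le⟩ ⟨(h01 y hy).1.le, (h01 y hy).2.le⟩ this
  have sub3 : ∀ {a b : ℝ}, 0 ≤ a → b ≤ 3 → ∀ z ∉ frontier G, z ∉ γ '' Icc a b := by
    rintro a b ha hb z hz ⟨r, hr, rfl⟩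
    exact hz (h.img ⟨ha.trans hr.1, hr.2.trans hb⟩)
  have Hid : ∀ a b : ℝ, 0 ≤ a → b ≤ 3 → (∀ r ∈ Icc α β, r ∈ Icc a b) → W v ∉ Icc a b →
      ∃ (ε : ℂ) (R : ℂ → ℂ), (ε = 1 ∨ ε = -1) ∧ (∀ᶠ y in 𝓝 (γ v), ContinuousAt R y) ∧
      ∀ z ∉ frontier G, dd γ a b z = ε * dd γ α β z + R z := by
    intro a b ha hb hab hWv
    obtain ⟨ε, R, p1, p2, p3⟩ := piece h.cont (a := a) (b := b) (w := id) hαv hvβ continuousOn_id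
      hab (injOn_id _) (fun _ _ => rfl) (fun r hr hrv => by
        rcases uniq v (h01 v hvm) r ⟨ha.trans hr.1, hr.2.trans hb⟩ hrv with h1 | h1
        · exact h1
        · exact absurd (h1 ▸ hr) hWv)
    exact ⟨ε, R, p1, p2, fun z hz => p3 z (sub3 ha hb z hz)⟩
  have HW : ∀ a b : ℝ, 0 ≤ a → b ≤ 3 → (∀ r ∈ Icc α β, W r ∈ Icc a b) → v ∉ Icc a b →
      ∃ (ε : ℂ) (R : ℂ → ℂ), (ε = 1 ∨ ε = -1) ∧ (∀ᶠ y in 𝓝 (γ v), ContinuousAt R y) ∧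
      ∀ z ∉ frontier G, dd γ a b z = ε * dd γ α β z + R z := by
    intro a b ha hb hab hv
    obtain ⟨ε, R, p1, p2, p3⟩ := piece h.cont (a := a) (b := b) (w := W) hαv hvβ hWc.continuousOn
      hab hWinj (fun r hr => (claim r hr).1) (fun r hr hrv => by
        rcases uniq v (h01 v hvm) r ⟨ha.trans hr.1, hr.2.trans hb⟩ hrv with h1 | h1
        · exact absurd (h1 ▸ hr) hv
        · exact h1)
    exact ⟨ε, R, p1, p2, fun z hz => p3 z (sub3 ha hb z hz)⟩
  have HC : ∀ a b : ℝ, 0 ≤ a → a ≤ b → b ≤ 3 → v ∉ Icc a b → W v ∉ Icc a b →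
      ∀ᶠ y in 𝓝 (γ v), ContinuousAt (dd γ a b) y := by
    intro a b ha hab hb hv hWv
    refine dd_evcont h.cont hab ?_
    rintro ⟨r, hr, hrv⟩
    rcases uniq v (h01 v hvm) r ⟨ha.trans hr.1, hr.2.trans hb⟩ hrv with h1 | h1
    · exact hv (h1 ▸ hr)
    · exact hWv (h1 ▸ hr)
  have fin : (∃ (ε : ℂ) (R : ℂ → ℂ), (ε = 1 ∨ ε = -1) ∧ (∀ᶠ y in 𝓝 (γ v), ContinuousAt R y) ∧
      ∀ z ∉ frontier G, dd γ s t z = ε * dd γ α β z + R z) →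
      (∃ (ε : ℂ) (R : ℂ → ℂ), (ε = 1 ∨ ε = -1) ∧ (∀ᶠ y in 𝓝 (γ v), ContinuousAt R y) ∧
      ∀ z ∉ frontier G, dd γ 0 s z + dd γ t 3 z = ε * dd γ α β z + R z) → False := by
    rintro ⟨ε1, R1, p1, p2, p3⟩ ⟨ε2, R2, q1, q2, q3⟩
    exact T2_fin h hs hst ht he hα0 hβ1 hαv hvβ p1 q1 p2 q2 p3 q3
  have JC : (∃ (ε : ℂ) (R : ℂ → ℂ), (ε = 1 ∨ ε = -1) ∧ (∀ᶠ y in 𝓝 (γ v), ContinuousAt R y) ∧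
      ∀ z ∉ frontier G, dd γ 0 s z = ε * dd γ α β z + R z) →
      (∀ᶠ y in 𝓝 (γ v), ContinuousAt (dd γ t 3) y) →
      (∃ (ε : ℂ) (R : ℂ → ℂ), (ε = 1 ∨ ε = -1) ∧ (∀ᶠ y in 𝓝 (γ v), ContinuousAt R y) ∧
      ∀ z ∉ frontier G, dd γ 0 s z + dd γ t 3 z = ε * dd γ α β z + R z) := by
    rintro ⟨ε1, R1, p1, p2, p3⟩ q
    refine ⟨ε1, fun z => R1 z + dd γ t 3 z, p1, ?_, fun z hz => ?_⟩
    · filter_upwards [p2, q] with y h1 h2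
      exact h1.add h2
    · rw [p3 z hz]; ring
  have CJ : (∃ (ε : ℂ) (R : ℂ → ℂ), (ε = 1 ∨ ε = -1) ∧ (∀ᶠ y in 𝓝 (γ v), ContinuousAt R y) ∧
      ∀ z ∉ frontier G, dd γ t 3 z = ε * dd γ α β z + R z) →
      (∀ᶠ y in 𝓝 (γ v), ContinuousAt (dd γ 0 s) y) →
      (∃ (ε : ℂ) (R : ℂ → ℂ), (ε = 1 ∨ ε = -1) ∧ (∀ᶠ y in 𝓝 (γ v), ContinuousAt R y) ∧
      ∀ z ∉ frontier G, dd γ 0 s z + dd γ t 3 z = ε * dd γ α β z + R z) := by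
    rintro ⟨ε1, R1, p1, p2, p3⟩ q
    refine ⟨ε1, fun z => R1 z + dd γ 0 s z, p1, ?_, fun z hz => ?_⟩
    · filter_upwards [p2, q] with y h1 h2
      exact h1.add h2
    · rw [p3 z hz]; ring
  have ws : s ∉ W '' Icc α β := by
    rintro ⟨r, hr, hrs⟩
    exact (hvδ r hr).2.2.2 (by rw [← (claim r hr).1, hrs])
  have wt : t ∉ W '' Icc α β := by
    rintro ⟨r, hr, hrs⟩
    exact (hvδ r hr).2.2.2 (by rw [← (claim r hr).1, hrs, he])
  have A1 := pre_split (S := Icc α β) isPreconnected_Icc (s := s) (t := t)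
    (fun hh => (hvδ s hh).2.1 rfl) (fun hh => (hvδ t hh).2.2.1 rfl)
  have A2 := pre_split (S := W '' Icc α β) (isPreconnected_Icc.image _ hWc.continuousOn) ws wt
  have B := claim v hvm
  rcases A1 with a1 | a1 | a1 <;> rcases A2 with a2 | a2 | a2
  all_goals
    have b1 := a1 hvm
    have b2 := a2 ⟨v, hvm, rfl⟩
    simp only [mem_Iio, mem_Ioo, mem_Ioi] at b1 b2
  · exfalso
    rcases B.2.2 with ⟨h1, h2⟩ | ⟨h1, h2⟩
    · linarith [h1.1]
    · linarith [h1.1]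
  · refine fin (HW s t hs ht (fun r hr => Ioo_subset_Icc_self (a2 ⟨r, hr, rfl⟩))
      (fun hh => by linarith [hh.1])) (JC (Hid 0 s le_rfl (by linarith)
      (fun r hr => ⟨(h01 r hr).1.le, (a1 hr).le⟩) (fun hh => by linarith [hh.2]))
      (HC t 3 (by linarith) ht le_rfl (fun hh => by linarith [hh.1]) (fun hh => by linarith [hh.1])))
  · exfalso
    rcases B.2.2 with ⟨h1, h2⟩ | ⟨h1, h2⟩
    · linarith [h1.1]
    · linarith [h1.2]
  · refine fin (Hid s t hs ht (fun r hr => Ioo_subset_Icc_self (a1 hr))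
      (fun hh => by linarith [hh.1])) (JC (HW 0 s le_rfl (by linarith)
      (fun r hr => ⟨(claim r hr).2.1.1, (a2 ⟨r, hr, rfl⟩ : W r < s).le⟩)
        (fun hh => by linarith [hh.2]))
      (HC t 3 (by linarith) ht le_rfl (fun hh => by linarith [hh.1]) (fun hh => by linarith [hh.1])))
  · exfalso
    rcases B.2.2 with ⟨h1, h2⟩ | ⟨h1, h2⟩
    · rcases h2 with h2 | h2 <;> linarith
    · rcases h2 with h2 | h2 <;> linarith
  · refine fin (Hid s t hs ht (fun r hr => Ioo_subset_Icc_self (a1 hr))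
      (fun hh => by linarith [hh.2])) (CJ (HW t 3 (by linarith) le_rfl
      (fun r hr => ⟨(a2 ⟨r, hr, rfl⟩ : t < W r).le, (claim r hr).2.1.2⟩)
        (fun hh => by linarith [hh.1]))
      (HC 0 s le_rfl hs (by linarith) (fun hh => by linarith [hh.2]) (fun hh => by linarith [hh.2])))
  · exfalso
    rcases B.2.2 with ⟨h1, h2⟩ | ⟨h1, h2⟩
    · linarith [h1.2]
    · linarith [h1.1]
  · refine fin (HW s t hs ht (fun r hr => Ioo_subset_Icc_self (a2 ⟨r, hr, rfl⟩))
      (fun hh => by linarith [hh.2])) (CJ (Hid t 3 (by linarith) le_rfl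
      (fun r hr => ⟨(a1 hr : t < r).le, by linarith [(h01 r hr).2]⟩) (fun hh => by linarith [hh.1]))
      (HC 0 s le_rfl hs (by linarith) (fun hh => by linarith [hh.2]) (fun hh => by linarith [hh.2])))
  · exfalso
    rcases B.2.2 with ⟨h1, h2⟩ | ⟨h1, h2⟩
    · linarith [h1.2]
    · linarith [h1.2]

end RMC
end

section
open Set Filter Topology Metric

namespace RMC

theorem dd_reparam {γ : ℝ → ℂ} {A B a b : ℝ} {z : ℂ} (hγ : ContinuousOn γ (Icc A B))
    (hz : z ∉ γ '' Icc A B) (ha : a ∈ Icc A B) (hb : b ∈ Icc A B) :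
    dd (fun r => γ (a + r * (b - a))) 0 1 z = dd γ a b z := by
  have := linc_comp' (f := fun t => γ t - z) (u := fun r => a + r * (b - a)) (a := 0) (b := 1)
    (dd_good hγ hz) (by fun_prop) (by
      intro r hr
      rw [uIcc_of_le zero_le_one] at hr
      have := convex_Icc A B ha hb (sub_nonneg.2 hr.2) hr.1 (by ring)
      simp only [smul_eq_mul] at this
      convert this using 1; ring)
  unfold dd
  rw [this]
  congr 1 <;> ring

theorem dd_conv {ι : Type*} {p : Filter ι} {γ : ℝ → ℂ} (hγ : Continuous γ) {γk : ι → ℝ → ℂ}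
    (hγk : ∀ k, Continuous (γk k)) (hu : TendstoUniformlyOn γk γ p (Icc 0 3))
    {ak bk : ι → ℝ} {a b : ℝ} (hak : ∀ k, ak k ∈ Icc (0:ℝ) 3) (hbk : ∀ k, bk k ∈ Icc (0:ℝ) 3)
    (ha : Tendsto ak p (𝓝 a)) (hb : Tendsto bk p (𝓝 b)) (ha3 : a ∈ Icc (0:ℝ) 3)
    (hb3 : b ∈ Icc (0:ℝ) 3) (hab : a ≤ b) {zk : ι → ℂ} {z : ℂ}
    (hzk : Tendsto zk p (𝓝 z)) (hz : z ∉ γ '' Icc a b)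
    (hzn : ∀ᶠ k in p, zk k ∉ γk k '' Icc 0 3) :
    Tendsto (fun k => dd (γk k) (ak k) (bk k) (zk k)) p (𝓝 (dd γ a b z)) := by
  rw [← dd_reparam hγ.continuousOn hz (left_mem_Icc.2 hab) (right_mem_Icc.2 hab)]
  have hmem : ∀ {x y r : ℝ}, x ∈ Icc (0:ℝ) 3 → y ∈ Icc (0:ℝ) 3 → r ∈ Icc (0:ℝ) 1 →
      x + r * (y - x) ∈ Icc (0:ℝ) 3 := by
    intro x y r hx hy hr
    have := convex_Icc (0:ℝ) 3 hx hy (sub_nonneg.2 hr.2) hr.1 (by ring)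
    simp only [smul_eq_mul] at this
    convert this using 1; ring
  have main : Tendsto (fun k => dd (fun r => γk k (ak k + r * (bk k - ak k))) 0 1 (zk k)) p
      (𝓝 (dd (fun r => γ (a + r * (b - a))) 0 1 z)) := by
    refine dd_tendsto (by fun_prop) (Eventually.of_forall fun k =>
      ((hγk k).comp (by fun_prop)).continuousOn) ?_ hzk ?_
    · rw [uIcc_of_le zero_le_one]
      rw [Metric.tendstoUniformlyOn_iff] at hu ⊢
      intro ε hε
      obtain ⟨δ, hδ, hδ'⟩ := Metric.uniformContinuousOn_iff.1
        ((isCompact_Icc (a := (0:ℝ)) (b := 3)).uniformContinuousOn_of_continuous hγ.continuousOn)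
        (ε / 2) (by positivity)
      filter_upwards [hu (ε / 2) (by positivity), Metric.tendsto_nhds.1 ha (δ / 2) (by positivity),
        Metric.tendsto_nhds.1 hb (δ / 2) (by positivity)] with k h1 h2 h3 r hr
      have m1 := hmem ha3 hb3 hr
      have m2 := hmem (hak k) (hbk k) hr
      have d1 := hδ' _ m1 _ m2 (by
        rw [Real.dist_eq] at h2 h3 ⊢
        have e : a + r * (b - a) - (ak k + r * (bk k - ak k)) =
          (1 - r) * (-(ak k - a)) + r * (-(bk k - b)) := by ring
        rw [e]
        calc _ ≤ |(1 - r) * (-(ak k - a))| + |r * (-(bk k - b))| := abs_add_le _ _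
          _ = (1 - r) * |ak k - a| + r * |bk k - b| := by
            rw [abs_mul, abs_mul, abs_neg, abs_neg, abs_of_nonneg (sub_nonneg.2 hr.2),
              abs_of_nonneg hr.1]
          _ < δ := by nlinarith [hr.1, hr.2, abs_nonneg (ak k - a), abs_nonneg (bk k - b)])
      have d2 := h1 _ m2
      exact (dist_triangle _ _ _).trans_lt (by linarith)
    · rw [uIcc_of_le zero_le_one]
      rintro ⟨r, hr, hrz⟩
      refine hz ⟨_, ?_, hrz⟩
      have := convex_Icc a b (left_mem_Icc.2 hab) (right_mem_Icc.2 hab) (sub_nonneg.2 hr.2) hr.1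
        (by ring)
      simp only [smul_eq_mul] at this
      convert this using 1; ring
  refine main.congr' (hzn.mono fun k hk => ?_)
  exact dd_reparam (hγk k).continuousOn hk (hak k) (hbk k)

theorem T3 {ι : Type*} (U : Ultrafilter ι) {γ : ℝ → ℂ} {G : Set ℂ} (h : Cfg γ G)
    {γk : ι → ℝ → ℂ} (hγk : ∀ k, Continuous (γk k)) (hu : TendstoUniformlyOn γk γ U (Icc 0 3))
    {sk tk : ι → ℝ} (hs : ∀ k, 0 ≤ sk k) (hst : ∀ k, sk k ≤ tk k) (ht : ∀ k, tk k ≤ 3)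
    {C : ι → ℝ → ℂ} (hC : ∀ k, ContinuousOn (C k) (Icc 0 1)) (hC0 : ∀ k, C k 0 = γk k (tk k))
    (hC1 : ∀ k, C k 1 = γk k (sk k))
    (hCd : ∀ ε > 0, ∀ᶠ k in U, ∀ θ ∈ Icc (0:ℝ) 1, dist (C k θ) (γk k (tk k)) < ε)
    (hz0 : ∀ k, (0:ℂ) ∉ γk k '' Icc 0 3) (hzC : ∀ k, (0:ℂ) ∉ C k '' Icc 0 1)
    {B : ι → Set ℂ} (hBp : ∀ k, IsPreconnected (B k)) {M : ℝ} (hBM : ∀ k, ∀ z ∈ B k, ‖z‖ ≤ M)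
    (hB0 : ∀ k, ∀ z ∈ B k, z ∉ γk k '' Icc 0 3 ∧ z ∉ C k '' Icc 0 1)
    (hB1 : ∀ k, ∀ z ∈ B k, dd (γk k) (sk k) (tk k) z + dd (C k) 0 1 z ≠
      dd (γk k) (sk k) (tk k) 0 + dd (C k) 0 1 0)
    (hB2 : ∀ k, ∀ z ∈ B k, dd (γk k) 0 3 z = dd (γk k) 0 3 0)
    {w w' : ι → ℂ} (hw : ∀ k, w k ∈ B k) (hw' : ∀ k, w' k ∈ B k) :
    Tendsto (fun k => dist (w k) (w' k)) U (𝓝 0) := by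
  have hsm : ∀ k, sk k ∈ Icc (0:ℝ) 3 := fun k => ⟨hs k, (hst k).trans (ht k)⟩
  have htm : ∀ k, tk k ∈ Icc (0:ℝ) 3 := fun k => ⟨(hs k).trans (hst k), ht k⟩
  obtain ⟨s, hs3, hsl⟩ := (isCompact_Icc (a := (0:ℝ)) (b := 3)).ultrafilter_le_nhds' (U.map sk)
    (Eventually.of_forall (f := (U : Filter ι)) hsm)
  obtain ⟨t, ht3, htl⟩ := (isCompact_Icc (a := (0:ℝ)) (b := 3)).ultrafilter_le_nhds' (U.map tk)
    (Eventually.of_forall (f := (U : Filter ι)) htm)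
  have hsl' : Tendsto sk U (𝓝 s) := hsl
  have htl' : Tendsto tk U (𝓝 t) := htl
  have hst' : s ≤ t := le_of_tendsto_of_tendsto' hsl' htl' hst
  have hval : ∀ {ak : ι → ℝ} {a : ℝ}, (∀ k, ak k ∈ Icc (0:ℝ) 3) → a ∈ Icc (0:ℝ) 3 →
      Tendsto ak U (𝓝 a) → Tendsto (fun k => γk k (ak k)) U (𝓝 (γ a)) := by
    intro ak a hak ha hl
    refine hu.tendsto_comp h.cont.continuousWithinAt (x := a) ?_
    exact tendsto_nhdsWithin_iff.2 ⟨hl, Eventually.of_forall hak⟩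
  have hvt := hval htm ht3 htl'
  have hvs := hval hsm hs3 hsl'
  have he : γ s = γ t := by
    have hd : Tendsto (fun k => dist (γk k (sk k)) (γk k (tk k))) U (𝓝 0) := by
      rw [Metric.tendsto_nhds]
      intro ε hε
      filter_upwards [hCd ε hε] with k hk
      have := hk 1 (right_mem_Icc.2 zero_le_one)
      rw [hC1] at this
      rwa [Real.dist_0_eq_abs, abs_of_nonneg dist_nonneg]
    exact dist_eq_zero.1 (tendsto_nhds_unique (hvs.dist hvt) hd)
  have hCu : TendstoUniformlyOn C (fun _ => γ t) U (uIcc 0 1) := by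
    rw [uIcc_of_le zero_le_one, Metric.tendstoUniformlyOn_iff]
    intro ε hε
    filter_upwards [hCd (ε / 2) (by positivity),
      Metric.tendsto_nhds.1 hvt (ε / 2) (by positivity)] with k h1 h2 r hr
    have := h1 r hr
    rw [dist_comm] at this h2
    exact (dist_triangle _ _ _).trans_lt (by linarith)
  have hCconv : ∀ {zk : ι → ℂ} {z : ℂ}, Tendsto zk U (𝓝 z) → z ≠ γ t →
      Tendsto (fun k => dd (C k) 0 1 (zk k)) U (𝓝 0) := by
    intro zk z hz hne
    have := dd_tendsto (γ := fun _ => γ t) (a := 0) (b := 1) (by fun_prop)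
      (Eventually.of_forall fun k => by rw [uIcc_of_le zero_le_one]; exact hC k) hCu hz
      (by rintro ⟨r, -, hr⟩; exact hne hr.symm)
    have h0 : dd (fun _ => γ t) 0 1 z = 0 := by
      unfold dd
      rw [linc_eq (l := fun _ => Complex.log (γ t - z)) continuousOn_const
        (fun _ _ => Complex.exp_log (sub_ne_zero.2 hne.symm)), sub_self]
    rwa [h0] at this
  have hexp : ∀ k z, z ∉ γk k '' Icc 0 3 → z ∉ C k '' Icc 0 1 →
      Complex.exp (dd (γk k) (sk k) (tk k) z + dd (C k) 0 1 z) = 1 := by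
    intro k z hz1 hz2
    have hz1' : z ∉ γk k '' Icc (sk k) (tk k) := fun hh =>
      hz1 (image_mono (Icc_subset_Icc (hs k) (ht k)) hh)
    have n1 : γk k (sk k) - z ≠ 0 := fun h0 => hz1 ⟨_, hsm k, sub_eq_zero.1 h0⟩
    have n2 : γk k (tk k) - z ≠ 0 := fun h0 => hz1 ⟨_, htm k, sub_eq_zero.1 h0⟩
    rw [Complex.exp_add, dd_exp' (hγk k) (hst k) hz1', dd_exp (by
      rw [uIcc_of_le zero_le_one]; exact hC k) (by rwa [uIcc_of_le zero_le_one]), hC0, hC1]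
    field_simp
  have hp : (0:ℂ) ≠ γ t := fun h0 => h.zero_notMem (h0 ▸ h.img ht3)
  have z0L : ∀ {a b : ℝ}, 0 ≤ a → b ≤ 3 → (0:ℂ) ∉ γ '' Icc a b := by
    rintro a b ha hb ⟨r, hr, hr0⟩
    exact h.zero_notMem (hr0 ▸ h.img ⟨ha.trans hr.1, hr.2.trans hb⟩)
  -- the increments are bounded away from zero
  have hsix : ∀ k, ∀ z ∈ B k, 6 ≤ ‖(dd (γk k) (sk k) (tk k) z + dd (C k) 0 1 z) -
      (dd (γk k) (sk k) (tk k) 0 + dd (C k) 0 1 0)‖ := by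
    intro k z hz
    by_contra hlt
    refine hB1 k z hz (sub_eq_zero.1 (exp_eq_one_norm_lt ?_ (not_le.1 hlt)))
    rw [Complex.exp_sub, hexp k z (hB0 k z hz).1 (hB0 k z hz).2, hexp k 0 (hz0 k) (hzC k), div_one]
  have c0 : Tendsto (fun _ : ι => (0:ℝ)) U (𝓝 0) := tendsto_const_nhds
  have c3 : Tendsto (fun _ : ι => (3:ℝ)) U (𝓝 3) := tendsto_const_nhds
  have cz : Tendsto (fun _ : ι => (0:ℂ)) U (𝓝 0) := tendsto_const_nhds
  have m0 : (0:ℝ) ∈ Icc (0:ℝ) 3 := ⟨le_rfl, by norm_num⟩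
  have m3 : (3:ℝ) ∈ Icc (0:ℝ) 3 := ⟨by norm_num, le_rfl⟩
  have ev0 : ∀ᶠ k in (U : Filter ι), (0:ℂ) ∉ γk k '' Icc 0 3 := Eventually.of_forall hz0
  have lim1 : ∀ {zk : ι → ℂ} {z : ℂ}, (∀ᶠ k in (U : Filter ι), zk k ∈ B k) → Tendsto zk U (𝓝 z) →
      z ∉ γ '' Icc s t → dd γ s t z ≠ dd γ s t 0 := by
    intro zk z hzk hz hzL heq
    have t1 := dd_conv h.cont hγk hu hsm htm hsl' htl' hs3 ht3 hst' hz hzL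
      (hzk.mono fun k hk => (hB0 k _ hk).1)
    have t2 := dd_conv h.cont hγk hu hsm htm hsl' htl' hs3 ht3 hst' cz (z0L hs3.1 ht3.2) ev0
    have t3 := hCconv hz (fun hh => hzL ⟨t, right_mem_Icc.2 hst', hh.symm⟩)
    have t4 := hCconv cz hp
    have t5 := ((t1.add t3).sub (t2.add t4)).norm
    rw [heq, sub_self, norm_zero] at t5
    have := ge_of_tendsto t5 (hzk.mono fun k hk => hsix k _ hk)
    norm_num at this
  have lim2 : ∀ {zk : ι → ℂ} {z : ℂ}, (∀ᶠ k in (U : Filter ι), zk k ∈ B k) → Tendsto zk U (𝓝 z) →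
      z ∉ γ '' Icc 0 s ∪ γ '' Icc t 3 →
      dd γ 0 s z + dd γ t 3 z ≠ dd γ 0 s 0 + dd γ t 3 0 := by
    intro zk z hzk hz hzL heq
    have hzL' := hzL
    rw [mem_union, not_or] at hzL'
    have evz := hzk.mono fun k hk => (hB0 k _ hk).1
    have t1 := dd_conv h.cont hγk hu (fun _ => m0) hsm c0 hsl' m0 hs3 hs3.1 hz hzL'.1 evz
    have t1' := dd_conv h.cont hγk hu htm (fun _ => m3) htl' c3 ht3 m3 ht3.2 hz hzL'.2 evz
    have t2 := dd_conv h.cont hγk hu (fun _ => m0) hsm c0 hsl' m0 hs3 hs3.1 cz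
      (z0L le_rfl hs3.2) ev0
    have t2' := dd_conv h.cont hγk hu htm (fun _ => m3) htl' c3 ht3 m3 ht3.2 cz
      (z0L ht3.1 le_rfl) ev0
    have t3 := hCconv hz (fun hh => hzL'.2 ⟨t, left_mem_Icc.2 ht3.2, hh.symm⟩)
    have t4 := hCconv cz hp
    have t5 := (((t1.add t1').sub t3).sub ((t2.add t2').sub t4)).norm
    rw [heq, sub_self, norm_zero] at t5
    have := ge_of_tendsto t5 (hzk.mono fun k hk => by
      have a1 := hsix k _ hk
      rw [← norm_neg] at a1
      refine a1.trans (le_of_eq ?_)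
      congr 1
      have e1 := dd_add (hγk k) (hB0 k _ hk).1 m0 (hsm k) (htm k)
      have e2 := dd_add (hγk k) (hB0 k _ hk).1 m0 (htm k) m3
      have e3 := dd_add (hγk k) (hz0 k) m0 (hsm k) (htm k)
      have e4 := dd_add (hγk k) (hz0 k) m0 (htm k) m3
      have e5 := hB2 k _ hk
      linear_combination -e1 - e2 + e3 + e4 - e5)
    norm_num at this
  -- limits of the two sequences
  have hlim : ∀ zk : ι → ℂ, (∀ᶠ k in (U : Filter ι), zk k ∈ B k) → ∃ z, Tendsto zk U (𝓝 z) := by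
    intro zk hzk
    obtain ⟨z, -, hz⟩ := (isCompact_closedBall (0:ℂ) M).ultrafilter_le_nhds' (U.map zk)
      (hzk.mono fun k hk => by
        rw [mem_closedBall_zero_iff]; exact hBM k _ hk)
    exact ⟨z, hz⟩
  obtain ⟨z, hz⟩ := hlim w (Eventually.of_forall hw)
  obtain ⟨z', hz'⟩ := hlim w' (Eventually.of_forall hw')
  suffices hzz : z = z' by
    have := hz.dist hz'
    rwa [hzz, dist_self] at this
  rcases hst'.eq_or_lt with heq | hlt
  · have hpt : ∀ {zk : ι → ℂ} {z : ℂ}, (∀ᶠ k in (U : Filter ι), zk k ∈ B k) →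
        Tendsto zk U (𝓝 z) → z = γ t := by
      intro zk z hzk hz
      by_contra hne
      refine lim1 hzk hz ?_ ?_
      · rw [heq]; simpa using hne
      · rw [heq]
        rw [show dd γ t t z = 0 from linc_self _ _, show dd γ t t 0 = 0 from linc_self _ _]
    rw [hpt (Eventually.of_forall hw) hz, hpt (Eventually.of_forall hw') hz']
  · have hLL : ∀ {zk : ι → ℂ} {z : ℂ}, (∀ᶠ k in (U : Filter ι), zk k ∈ B k) →
        Tendsto zk U (𝓝 z) → z ∈ γ '' Icc s t ∩ (γ '' Icc 0 s ∪ γ '' Icc t 3) :=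
      fun hzk hz => h.T1' hs3.1 hlt ht3.2 he (lim1 hzk hz) (lim2 hzk hz)
    have hXX := h.L12 hs3.1 hlt ht3.2 he
    obtain ⟨u, huc, hu1, hu2⟩ := arc_coord h.cont.continuousOn h.i1 h.hc
    have hux : ∀ x ∈ γ '' Icc 0 1 ∪ {γ 2}, (u x ∈ Icc (0:ℝ) 1 ∧ γ (u x) = x) ∨ (u x = 2 ∧ x = γ 2) := by
      rintro x (⟨v, hv, rfl⟩ | rfl)
      · left; rw [hu1 v hv]; exact ⟨hv, rfl⟩
      · right; exact ⟨hu2, rfl⟩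
    have hbetw : ∀ {w w' : ι → ℂ} {z z' : ℂ}, (∀ k, w k ∈ B k) → (∀ k, w' k ∈ B k) →
        Tendsto w U (𝓝 z) → Tendsto w' U (𝓝 z') → u z < u z' → False := by
      intro w w' z z' hw hw' hz hz' huz
      have hmid : ∀ y ∈ Ioo (u z) (u z'), (y ∈ Icc (0:ℝ) 1 ∧
          γ y ∈ γ '' Icc s t ∩ (γ '' Icc 0 s ∪ γ '' Icc t 3)) ∨ y = 2 := by
        intro y hy
        have ex : ∀ k, ∃ x, (u (w k) < y ∧ y < u (w' k)) → x ∈ B k ∧ u x = y := by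
          intro k
          by_cases hk : u (w k) < y ∧ y < u (w' k)
          · obtain ⟨x, hx, hxy⟩ := (hBp k).intermediate_value (hw k) (hw' k) huc.continuousOn
              ⟨hk.1.le, hk.2.le⟩
            exact ⟨x, fun _ => ⟨hx, hxy⟩⟩
          · exact ⟨0, fun hh => absurd hh hk⟩
        choose zk hzk using ex
        have hev : ∀ᶠ k in (U : Filter ι), zk k ∈ B k ∧ u (zk k) = y := by
          filter_upwards [((huc.tendsto z).comp hz).eventually (eventually_lt_nhds hy.1),
            ((huc.tendsto z').comp hz').eventually (eventually_gt_nhds hy.2)] with k h1 h2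
          exact hzk k ⟨h1, h2⟩
        obtain ⟨x, hx⟩ := hlim zk (hev.mono fun k hk => hk.1)
        have hxL := hLL (hev.mono fun k hk => hk.1) hx
        have huy : u x = y := by
          refine tendsto_nhds_unique ((huc.tendsto x).comp hx) ?_
          exact tendsto_const_nhds.congr' (hev.mono fun k hk => hk.2.symm)
        rcases hux x (hXX hxL) with ⟨h1, h2⟩ | ⟨h1, h2⟩
        · left
          rw [huy] at h1 h2
          exact ⟨h1, by rw [h2]; exact hxL⟩
        · right; rw [← huy, h1]
      have a1 := hux z (hXX (hLL (Eventually.of_forall hw) hz))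
      have a2 := hux z' (hXX (hLL (Eventually.of_forall hw') hz'))
      have b1 : u z ∈ Icc (0:ℝ) 1 := by
        rcases a1 with a1 | a1
        · exact a1.1
        · rcases a2 with a2 | a2
          · linarith [a2.1.2]
          · linarith
      have b2 : u z' ≤ 1 := by
        rcases a2 with a2 | a2
        · exact a2.1.2
        · rcases hmid (3/2) ⟨by linarith [b1.2], by linarith⟩ with h1 | h1
          · linarith [h1.1.2]
          · norm_num at h1
      refine T2 h hs3.1 hlt ht3.2 he b1.1 huz b2 fun v hv => ?_
      rcases hmid v hv with h1 | h1
      · exact h1.2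
      · linarith [hv.2]
    have hueq : u z = u z' := by
      rcases lt_trichotomy (u z) (u z') with h1 | h1 | h1
      · exact (hbetw hw hw' hz hz' h1).elim
      · exact h1
      · exact (hbetw hw' hw hz' hz h1).elim
    rcases hux z (hXX (hLL (Eventually.of_forall hw) hz)) with a1 | a1 <;>
      rcases hux z' (hXX (hLL (Eventually.of_forall hw') hz')) with a2 | a2
    · rw [← a1.2, ← a2.2, hueq]
    · linarith [a1.1.2]
    · linarith [a2.1.2]
    · rw [a1.2, a2.2]

end RMC
end

section
open Set Filter Topology Metric
namespace RMC

/-- a conformal map of the disc with continuous extension to the closed disc -/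
structure Conf (Φ : ℂ → ℂ) (G : Set ℂ) : Prop where
  d : DifferentiableOn ℂ Φ (ball 0 1)
  b : BijOn Φ (ball 0 1) G
  z : Φ 0 = 0
  c : ContinuousOn Φ (closedBall 0 1)
  o : IsOpen G

namespace Conf
variable {Φ : ℂ → ℂ} {G : Set ℂ}

theorem inv (h : Conf Φ G) : ∃ g : ℂ → ℂ, ContinuousOn g G ∧ MapsTo g G (ball 0 1) ∧
    (∀ z ∈ G, Φ (g z) = z) ∧ (∀ w ∈ ball (0:ℂ) 1, g (Φ w) = w) := by
  have hinv := h.b.invOn_invFunOn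
  set g := Function.invFunOn Φ (ball 0 1) with hg
  have hmaps : MapsTo g G (ball 0 1) := h.b.surjOn.mapsTo_invFunOn
  refine ⟨g, ?_, hmaps, fun z hz => hinv.2 hz, fun w hw => hinv.1 hw⟩
  have han : AnalyticOnNhd ℂ Φ (ball 0 1) := h.d.analyticOnNhd isOpen_ball
  have hop : ∀ s ⊆ ball (0:ℂ) 1, IsOpen s → IsOpen (Φ '' s) := by
    rcases han.is_constant_or_isOpen (convex_ball 0 1).isPreconnected with ⟨w, hw⟩ | h1
    · exfalso
      have h1 : (0:ℂ) ∈ ball (0:ℂ) 1 := by simp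
      have h2 : (1/2:ℂ) ∈ ball (0:ℂ) 1 := by simp; norm_num
      have := h.b.injOn h1 h2 ((hw _ h1).trans (hw _ h2).symm)
      norm_num at this
    · exact h1
  intro y hy
  refine ContinuousAt.continuousWithinAt ?_
  intro V hV
  have hV' : V ∩ ball 0 1 ∈ 𝓝 (g y) := inter_mem hV (isOpen_ball.mem_nhds (hmaps hy))
  obtain ⟨W, hW, hWo, hyW⟩ := _root_.mem_nhds_iff.1 hV'
  have : Φ '' W ∈ 𝓝 y := (hop W (fun x hx => (hW hx).2) hWo).mem_nhds ⟨g y, hyW, hinv.2 hy⟩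
  rw [mem_map]
  filter_upwards [this]
  rintro _ ⟨w, hw, rfl⟩
  show g (Φ w) ∈ V
  rw [hinv.1 (hW hw).2]
  exact (hW hw).1

theorem deriv_ne_inv (h : Conf Φ G) : ∃ g : ℂ → ℂ, DifferentiableOn ℂ g G ∧ MapsTo g G (ball 0 1) ∧
    (∀ z ∈ G, Φ (g z) = z) ∧ (∀ w ∈ ball (0:ℂ) 1, g (Φ w) = w) ∧
    ∀ w ∈ ball (0:ℂ) 1, deriv Φ w ≠ 0 := by
  obtain ⟨g, gc, gm, gr, gl⟩ := h.inv
  have han : AnalyticOnNhd ℂ Φ (ball 0 1) := h.d.analyticOnNhd isOpen_ball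
  have hD : ∀ w ∈ ball (0:ℂ) 1, DifferentiableAt ℂ Φ w := fun w hw =>
    h.d.differentiableAt (isOpen_ball.mem_nhds hw)
  have hreg : ∀ w ∈ ball (0:ℂ) 1, deriv Φ w ≠ 0 → HasDerivAt g (deriv Φ w)⁻¹ (Φ w) := by
    intro w hw hne
    have hG : Φ w ∈ G := h.b.mapsTo hw
    refine HasDerivAt.of_local_left_inverse (f := Φ) (gc.continuousAt (h.o.mem_nhds hG)) ?_ hne ?_
    · rw [gl w hw]; exact (hD w hw).hasDerivAt
    · filter_upwards [h.o.mem_nhds hG] with y hy using gr y hy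
  have hev : ∀ w ∈ ball (0:ℂ) 1, ∀ᶠ z in 𝓝[≠] w, deriv Φ z ≠ 0 := by
    intro w hw
    rcases (han w hw).deriv.eventually_eq_zero_or_eventually_ne_zero with h1 | h1
    · exfalso
      obtain ⟨r, hr, hr'⟩ := Metric.eventually_nhds_iff_ball.1
        (h1.and (isOpen_ball.mem_nhds hw))
      have h2 : ∃ x ∈ ball w r, x ≠ w := ⟨w + (r/2 : ℝ), by
          simp [abs_of_pos hr]; linarith, by simp [hr.ne']⟩
      obtain ⟨x, hx, hxw⟩ := h2
      have := isOpen_ball.is_const_of_deriv_eq_zero (f := Φ) (convex_ball w r).isPreconnected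
        (h.d.mono fun z hz => (hr' z hz).2) (fun z hz => (hr' z hz).1) hx (mem_ball_self hr)
      exact hxw (h.b.injOn (hr' x hx).2 hw this)
    · exact h1
  have hga : ∀ w ∈ ball (0:ℂ) 1, DifferentiableAt ℂ g (Φ w) := by
    intro w hw
    have hG : Φ w ∈ G := h.b.mapsTo hw
    have hca := gc.continuousAt (h.o.mem_nhds hG)
    refine (Complex.analyticAt_of_differentiable_on_punctured_nhds_of_continuousAt ?_ hca).differentiableAt
    have h1 := eventually_nhdsWithin_iff.1 (hev w hw)
    have h2 : Tendsto g (𝓝 (Φ w)) (𝓝 w) := by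
      have := hca.tendsto; rwa [gl w hw] at this
    rw [eventually_nhdsWithin_iff]
    filter_upwards [h2.eventually h1, h.o.mem_nhds hG] with y hy hyG hne
    have h3 : g y ≠ w := fun h4 => hne (by simp [← h4, gr y hyG])
    have := hreg (g y) (gm hyG) (hy h3)
    rw [gr y hyG] at this
    exact this.differentiableAt
  refine ⟨g, ?_, gm, gr, gl, ?_⟩
  · intro y hy
    have := hga (g y) (gm hy)
    rw [gr y hy] at this
    exact this.differentiableWithinAt
  · intro w hw h0
    have h1 : HasDerivAt (fun z => g (Φ z)) (deriv g (Φ w) * deriv Φ w) w :=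
      (hga w hw).hasDerivAt.comp w (hD w hw).hasDerivAt
    have h2 : HasDerivAt (fun z => g (Φ z)) 1 w := by
      refine (hasDerivAt_id w).congr_of_eventuallyEq ?_
      filter_upwards [isOpen_ball.mem_nhds hw] with z hz using gl z hz
    have := h1.unique h2
    rw [h0, mul_zero] at this
    exact zero_ne_one this

theorem bdry (h : Conf Φ G) {ζ : ℂ} (hζ : ‖ζ‖ = 1) : Φ ζ ∈ frontier G := by
  have hζ' : ζ ∈ closedBall (0:ℂ) 1 := by simp [hζ]
  rw [h.o.frontier_eq]
  have hcl : ζ ∈ closure (ball (0:ℂ) 1) := by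
    rw [closure_ball _ one_ne_zero]; exact hζ'
  have : (𝓝[ball (0:ℂ) 1] ζ).NeBot := mem_closure_iff_nhdsWithin_neBot.1 hcl
  have ht : Tendsto Φ (𝓝[ball (0:ℂ) 1] ζ) (𝓝 (Φ ζ)) := (h.c ζ hζ').mono ball_subset_closedBall
  refine ⟨mem_closure_of_tendsto ht ?_, ?_⟩
  · filter_upwards [self_mem_nhdsWithin] with z hz using h.b.mapsTo hz
  · intro hG
    obtain ⟨g, gc, gm, gr, gl⟩ := h.inv
    have h1 : Tendsto (fun z => g (Φ z)) (𝓝[ball (0:ℂ) 1] ζ) (𝓝 (g (Φ ζ))) :=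
      (gc.continuousAt (h.o.mem_nhds hG)).tendsto.comp ht
    have h2 : Tendsto (fun z => g (Φ z)) (𝓝[ball (0:ℂ) 1] ζ) (𝓝 ζ) := by
      refine (tendsto_id.mono_left nhdsWithin_le_nhds).congr' ?_
      filter_upwards [self_mem_nhdsWithin] with z hz using (gl z hz).symm
    have h3 := tendsto_nhds_unique h1 h2
    have h4 := gm hG
    rw [h3] at h4
    simp [hζ] at h4

theorem sep (h : Conf Φ G) {p w : ℂ} (hp : ‖p‖ ≤ 1) (hw : ‖w‖ < 1) (hne : p ≠ w) : Φ p ≠ Φ w := by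
  intro he
  have hwb : w ∈ ball (0:ℂ) 1 := by simpa using hw
  rcases hp.lt_or_eq with h1 | h1
  · exact hne (h.b.injOn (by simpa using h1) hwb he)
  · have := h.bdry h1
    rw [h.o.frontier_eq, he] at this
    exact this.2 (h.b.mapsTo hwb)

open Classical in
/-- difference quotient -/
noncomputable def Q (Φ : ℂ → ℂ) (w z : ℂ) : ℂ :=
  if z = w then deriv Φ w else (Φ z - Φ w) / (z - w)

theorem Q_mul (Φ : ℂ → ℂ) (w z : ℂ) : (z - w) * Q Φ w z = Φ z - Φ w := by
  unfold Q
  split_ifs with h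
  · simp [h]
  · rw [mul_div_cancel₀]; exact sub_ne_zero.2 h

theorem Q_ne (h : Conf Φ G) {p w : ℂ} (hp : ‖p‖ ≤ 1) (hw : ‖w‖ < 1) : Q Φ w p ≠ 0 := by
  unfold Q
  split_ifs with h1
  · obtain ⟨g, -, -, -, -, hg⟩ := h.deriv_ne_inv
    exact hg w (by simpa using hw)
  · exact div_ne_zero (sub_ne_zero.2 (h.sep hp hw h1)) (sub_ne_zero.2 h1)

theorem Q_cont (h : Conf Φ G) :
    ContinuousOn (Function.uncurry (Q Φ)) (ball (0:ℂ) 1 ×ˢ closedBall (0:ℂ) 1) := by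
  rintro ⟨w0, z0⟩ ⟨hw0, hz0⟩
  simp only at hw0 hz0
  have han : AnalyticOnNhd ℂ Φ (ball 0 1) := h.d.analyticOnNhd isOpen_ball
  by_cases hne : z0 = w0
  · subst hne
    refine ContinuousAt.continuousWithinAt ?_
    have hs : HasStrictDerivAt Φ (deriv Φ z0) z0 := (han z0 hw0).hasStrictDerivAt
    rw [Metric.continuousAt_iff']
    intro ε hε
    have h1 := (hasStrictFDerivAt_iff_isLittleO.1 hs.hasStrictFDerivAt).def (half_pos hε)
    have h2 : ∀ᶠ w in 𝓝 z0, dist (deriv Φ w) (deriv Φ z0) < ε :=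
      (Metric.continuousAt_iff'.1 (han z0 hw0).deriv.continuousAt) ε hε
    have h3 : ∀ᶠ x : ℂ × ℂ in 𝓝 (z0, z0), dist (deriv Φ x.1) (deriv Φ z0) < ε :=
      (continuous_fst.tendsto (z0, z0)).eventually h2
    filter_upwards [h1, h3] with x h1 h3
    have e0 : Function.uncurry (Q Φ) (z0, z0) = deriv Φ z0 := by simp [Function.uncurry, Q]
    rw [e0]
    obtain ⟨w, z⟩ := x
    by_cases hz : z = w
    · subst hz; simpa [Function.uncurry, Q] using h3
    · simp only [Function.uncurry, Q, if_neg hz]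
      have hpos : 0 < ‖z - w‖ := norm_pos_iff.2 (sub_ne_zero.2 hz)
      simp only [ContinuousLinearMap.toSpanSingleton_apply, smul_eq_mul] at h1
      rw [← norm_neg, norm_sub_rev w z] at h1
      have h4 : -(Φ w - Φ z - (w - z) * deriv Φ z0) = (z - w) * ((Φ z - Φ w) / (z - w) - deriv Φ z0) := by
        rw [mul_sub, mul_div_cancel₀ _ (sub_ne_zero.2 hz)]; ring
      rw [h4, norm_mul, mul_comm] at h1
      rw [dist_eq_norm]
      have := le_of_mul_le_mul_right h1 hpos
      linarith
  · have hform : ContinuousWithinAt (fun x : ℂ × ℂ => (Φ x.2 - Φ x.1) / (x.2 - x.1))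
        (ball (0:ℂ) 1 ×ˢ closedBall (0:ℂ) 1) (w0, z0) := by
      refine ContinuousWithinAt.div (ContinuousWithinAt.sub ?_ ?_) (by fun_prop) (sub_ne_zero.2 hne)
      · exact (h.c z0 hz0).comp (by fun_prop) (fun x hx => hx.2)
      · exact (h.c w0 (ball_subset_closedBall hw0)).comp (t := closedBall 0 1) (by fun_prop)
          (fun x hx => ball_subset_closedBall hx.1)
    refine hform.congr_of_eventuallyEq ?_ (by simp [Function.uncurry, Q, hne])
    refine eventually_nhdsWithin_of_eventually_nhds ?_
    have : ∀ᶠ x : ℂ × ℂ in 𝓝 (w0, z0), x.2 ≠ x.1 :=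
      (isOpen_ne_fun continuous_snd continuous_fst).mem_nhds hne
    filter_upwards [this] with x hx
    simp [Function.uncurry, Q, hx]
end Conf

theorem linc_contOn {S : Set ℂ} {F : ℂ → ℝ → ℂ} {a b : ℝ}
    (hF : ContinuousOn (Function.uncurry F) (S ×ˢ uIcc a b))
    (h0 : ∀ w ∈ S, ∀ t ∈ uIcc a b, F w t ≠ 0) : ContinuousOn (fun w => linc (F w) a b) S := by
  have hc : ∀ w ∈ S, ContinuousOn (F w) (uIcc a b) := fun w hw =>
    hF.comp (f := fun t => (w, t)) (by fun_prop) (fun t ht => ⟨hw, ht⟩)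
  intro w hw
  refine linc_tendsto ⟨hc w hw, h0 w hw⟩ ?_ ?_
  · filter_upwards [self_mem_nhdsWithin] with v hv using hc v hv
  · intro u hu
    obtain ⟨v, hv, hv'⟩ := isCompact_uIcc.mem_uniformity_of_prod hF hw (symm_le_uniformity hu)
    filter_upwards [hv] with p hp x hx using hv' p hp x hx

end RMC
end

section
open Set Filter Topology Metric
namespace RMC

/-- circle of radius `ρ` about the boundary point `ζ` -/
noncomputable def arc (ζ : ℂ) (ρ θ : ℝ) : ℂ := ζ * (1 - ρ * Complex.exp (θ * Complex.I))

theorem arc_cont (ζ : ℂ) (ρ : ℝ) : Continuous (arc ζ ρ) := by unfold arc; fun_prop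

theorem arc_dist {ζ : ℂ} (hζ : ‖ζ‖ = 1) {ρ : ℝ} (hρ : 0 < ρ) (θ : ℝ) : ‖arc ζ ρ θ - ζ‖ = ρ := by
  have : arc ζ ρ θ - ζ = -(ζ * ρ * Complex.exp (θ * Complex.I)) := by unfold arc; ring
  rw [this, norm_neg, norm_mul, norm_mul, hζ, Complex.norm_exp_ofReal_mul_I]
  simp [abs_of_pos hρ]

theorem arc_norm_sq {ζ : ℂ} (hζ : ‖ζ‖ = 1) (ρ : ℝ) (θ : ℝ) :
    ‖arc ζ ρ θ‖ ^ 2 = 1 - 2 * ρ * Real.cos θ + ρ ^ 2 := by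
  unfold arc
  rw [norm_mul, hζ, one_mul, ← Complex.normSq_eq_norm_sq, Complex.normSq_apply]
  have h1 : (Complex.exp (θ * Complex.I)).re = Real.cos θ := Complex.exp_ofReal_mul_I_re θ
  have h2 : (Complex.exp (θ * Complex.I)).im = Real.sin θ := Complex.exp_ofReal_mul_I_im θ
  simp only [Complex.sub_re, Complex.sub_im, Complex.one_re, Complex.one_im, Complex.mul_re,
    Complex.mul_im, Complex.ofReal_re, Complex.ofReal_im, h1, h2]
  nlinarith [Real.sin_sq_add_cos_sq θ]

theorem arc_le {ζ : ℂ} (hζ : ‖ζ‖ = 1) {ρ : ℝ} (hρ : 0 < ρ) {θ : ℝ} :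
    ‖arc ζ ρ θ‖ ≤ 1 ↔ ρ / 2 ≤ Real.cos θ := by
  have h := arc_norm_sq hζ ρ θ
  have h0 := norm_nonneg (arc ζ ρ θ)
  constructor
  · intro h1; nlinarith
  · intro h1; nlinarith

theorem arc_lt {ζ : ℂ} (hζ : ‖ζ‖ = 1) {ρ : ℝ} (hρ : 0 < ρ) {θ : ℝ} :
    ‖arc ζ ρ θ‖ < 1 ↔ ρ / 2 < Real.cos θ := by
  have h := arc_norm_sq hζ ρ θ
  have h0 := norm_nonneg (arc ζ ρ θ)
  constructor
  · intro h1; nlinarith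
  · intro h1; nlinarith

theorem cos_in {ρ : ℝ} (hρ : 0 < ρ) (hρ1 : ρ < 1) {θ : ℝ} (h : |θ| ≤ Real.arccos (ρ / 2)) :
    ρ / 2 ≤ Real.cos θ := by
  rw [← Real.cos_abs]
  calc ρ / 2 = Real.cos (Real.arccos (ρ / 2)) := (Real.cos_arccos (by linarith) (by linarith)).symm
    _ ≤ _ := Real.cos_le_cos_of_nonneg_of_le_pi (abs_nonneg _) (Real.arccos_le_pi _) h

theorem cos_in' {ρ : ℝ} (hρ : 0 < ρ) (hρ1 : ρ < 1) {θ : ℝ} (h : |θ| < Real.arccos (ρ / 2)) :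
    ρ / 2 < Real.cos θ := by
  rw [← Real.cos_abs]
  calc ρ / 2 = Real.cos (Real.arccos (ρ / 2)) := (Real.cos_arccos (by linarith) (by linarith)).symm
    _ < _ := Real.cos_lt_cos_of_nonneg_of_le_pi (abs_nonneg _) (Real.arccos_le_pi _) h

theorem cos_out {ρ : ℝ} (hρ : 0 < ρ) (hρ1 : ρ < 1) {θ : ℝ} (h : Real.arccos (ρ / 2) ≤ θ)
    (h' : θ ≤ 2 * Real.pi - Real.arccos (ρ / 2)) : Real.cos θ ≤ ρ / 2 := by
  have h0 := Real.arccos_nonneg (ρ / 2)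
  rcases le_total θ Real.pi with h1 | h1
  · calc Real.cos θ ≤ Real.cos (Real.arccos (ρ / 2)) :=
        Real.cos_le_cos_of_nonneg_of_le_pi h0 h1 h
      _ = _ := Real.cos_arccos (by linarith) (by linarith)
  · rw [← Real.cos_two_pi_sub]
    calc Real.cos (2 * Real.pi - θ) ≤ Real.cos (Real.arccos (ρ / 2)) :=
        Real.cos_le_cos_of_nonneg_of_le_pi h0 (by linarith) (by linarith)
      _ = _ := Real.cos_arccos (by linarith) (by linarith)

namespace Conf
variable {Φ : ℂ → ℂ} {G : Set ℂ}

theorem loop (h : Conf Φ G) {γ : ℝ → ℂ} (hγ : Continuous γ) (hfr : frontier G = γ '' Icc 0 3)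
    {ζ : ℂ} (hζ : ‖ζ‖ = 1) {ρ : ℝ} (hρ : 0 < ρ) (hρ1 : ρ < 1) {s t : ℝ} (hs : s ∈ Icc (0:ℝ) 3)
    (ht : t ∈ Icc (0:ℝ) 3) {θ0 : ℝ} (hθ0 : θ0 = Real.arccos (ρ / 2))
    (hts : Φ (arc ζ ρ (-θ0)) = γ s) (htt : Φ (arc ζ ρ θ0) = γ t) :
    ∀ w ∈ ball (0:ℂ) 1 ∩ ball ζ ρ, dd γ s t (Φ w) + dd (fun θ => Φ (arc ζ ρ θ)) θ0 (-θ0) (Φ w) ≠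
      dd γ s t 0 + dd (fun θ => Φ (arc ζ ρ θ)) θ0 (-θ0) 0 := by
  have hζ0 : ζ ≠ 0 := by rintro rfl; simp at hζ
  have hθp : 0 ≤ θ0 := hθ0 ▸ Real.arccos_nonneg _
  have hθ2 : θ0 ≤ Real.pi := hθ0 ▸ Real.arccos_le_pi _
  have hui : uIcc θ0 (-θ0) = Icc (-θ0) θ0 := by rw [uIcc_comm, uIcc_of_le (by linarith)]
  have harc : ∀ θ ∈ uIcc θ0 (-θ0), ‖arc ζ ρ θ‖ ≤ 1 := fun θ hθ => by
    rw [hui] at hθ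
    exact (arc_le hζ hρ).2 (cos_in hρ hρ1 (hθ0 ▸ abs_le.2 hθ))
  -- factors
  let E : ℂ → ℝ → ℂ := fun w θ => (ρ:ℂ) * Complex.exp (θ * Complex.I) - (1 - w / ζ)
  let q : ℂ → ℝ → ℂ := fun w θ => -ζ * Q Φ w (arc ζ ρ θ)
  have hE : ∀ w θ, -ζ * E w θ = arc ζ ρ θ - w := by
    intro w θ; simp only [E, arc]; field_simp; ring
  have hEq : ∀ w θ, E w θ * q w θ = Φ (arc ζ ρ θ) - Φ w := by
    intro w θ
    rw [← Q_mul, ← hE]; simp only [q]; ring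
  have hE0 : ∀ w θ, arc ζ ρ θ ≠ w → E w θ ≠ 0 := by
    intro w θ hne h0
    have := hE w θ
    rw [h0, mul_zero] at this
    exact hne (sub_eq_zero.1 this.symm)
  have hEc : Continuous (Function.uncurry E) := by
    simp only [E, Function.uncurry_def]; fun_prop
  have hq0 : ∀ w ∈ ball (0:ℂ) 1, ∀ θ ∈ uIcc θ0 (-θ0), q w θ ≠ 0 := by
    intro w hw θ hθ
    exact mul_ne_zero (neg_ne_zero.2 hζ0) (h.Q_ne (harc θ hθ) (by simpa using hw))
  have hqc : ContinuousOn (Function.uncurry q) (ball 0 1 ×ˢ uIcc θ0 (-θ0)) := by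
    refine continuousOn_const.mul ?_
    refine h.Q_cont.comp (f := fun x : ℂ × ℝ => (x.1, arc ζ ρ x.2)) ?_ ?_
    · exact (continuous_fst.prodMk ((arc_cont ζ ρ).comp continuous_snd)).continuousOn
    · intro x hx
      exact ⟨hx.1, by simpa using harc _ hx.2⟩
  have hout : ∀ w ∈ ball (0:ℂ) 1, ∀ θ ∈ uIcc θ0 (2 * Real.pi - θ0), E w θ ≠ 0 := by
    intro w hw θ hθ
    rw [uIcc_of_le (by linarith)] at hθ
    refine hE0 w θ ?_
    rintro rfl
    have h1 : ‖arc ζ ρ θ‖ < 1 := by simpa using hw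
    have := (arc_lt hζ hρ).1 h1
    have := cos_out hρ hρ1 (hθ0 ▸ hθ.1) (hθ0 ▸ hθ.2)
    linarith
  have hγ0 : ∀ w ∈ ball (0:ℂ) 1, ∀ τ ∈ uIcc s t, γ τ - Φ w ≠ 0 := by
    intro w hw τ hτ h0
    have h1 : γ τ ∈ frontier G := by
      rw [hfr]; exact ⟨τ, ordConnected_Icc.uIcc_subset hs ht hτ, rfl⟩
    rw [h.o.frontier_eq, sub_eq_zero.1 h0] at h1
    exact h1.2 (h.b.mapsTo hw)
  let H : ℂ → ℂ := fun w => linc (fun τ => γ τ - Φ w) s t + linc (q w) θ0 (-θ0) +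
    linc (E w) θ0 (2 * Real.pi - θ0)
  have hH : ContinuousOn H (ball 0 1) := by
    refine ContinuousOn.add (ContinuousOn.add ?_ ?_) ?_
    · refine linc_contOn (F := fun w τ => γ τ - Φ w) ?_ hγ0
      refine ContinuousOn.sub (hγ.comp continuous_snd).continuousOn ?_
      exact h.d.continuousOn.comp continuous_fst.continuousOn (fun x hx => hx.1)
    · exact linc_contOn hqc hq0
    · exact linc_contOn hEc.continuousOn hout
  have hqg : ∀ w ∈ ball (0:ℂ) 1, Good (q w) (uIcc θ0 (-θ0)) := fun w hw =>
    ⟨hqc.comp (f := fun θ => (w, θ)) (by fun_prop) (fun θ hθ => ⟨hw, hθ⟩), hq0 w hw⟩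
  have hEcw : ∀ w, Continuous (E w) := fun w => by simp only [E]; fun_prop
  have hper : ∀ w, E w (2 * Real.pi - θ0) = E w (-θ0) := by
    intro w
    have := exp_per (-θ0)
    simp only [E]
    rw [← this, show (2 * Real.pi - θ0) = -θ0 + 2 * Real.pi by ring]
  have hexp : ∀ w ∈ ball (0:ℂ) 1, Complex.exp (H w) = 1 := by
    intro w hw
    have e1 := linc_exp (f := fun τ => γ τ - Φ w) (a := s) (b := t) ⟨by fun_prop, hγ0 w hw⟩
    have e2 := linc_exp (hqg w hw)
    have e3 := linc_exp (f := E w) (a := θ0) (b := 2 * Real.pi - θ0)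
      ⟨(hEcw w).continuousOn, hout w hw⟩
    simp only [H]
    rw [Complex.exp_add, Complex.exp_add, e1, e2, e3, hper]
    have g1 := hEq w θ0
    have g2 := hEq w (-θ0)
    rw [htt] at g1
    rw [hts] at g2
    rw [← g1, ← g2]
    have n1 : E w θ0 ≠ 0 := hout w hw θ0 left_mem_uIcc
    have n2 : E w (-θ0) ≠ 0 := hper w ▸ hout w hw _ right_mem_uIcc
    have n3 := hq0 w hw θ0 left_mem_uIcc
    have n4 := hq0 w hw (-θ0) right_mem_uIcc
    field_simp
  have hconst : ∀ w ∈ ball (0:ℂ) 1, H w = H 0 := fun w hw =>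
    const_of_exp (convex_ball (0:ℂ) 1).isPreconnected hH hexp hw (by simp)
  -- relation with the loop
  have hJ : ∀ w ∈ ball (0:ℂ) 1, ‖w - ζ‖ ≠ ρ →
      dd γ s t (Φ w) + dd (fun θ => Φ (arc ζ ρ θ)) θ0 (-θ0) (Φ w) =
        H w - linc (E w) (-θ0) (-θ0 + 2 * Real.pi) := by
    intro w hw hn
    have hEn : ∀ θ, E w θ ≠ 0 := fun θ => hE0 w θ (by
      rintro rfl; exact hn (arc_dist hζ hρ θ))
    have k1 : dd (fun θ => Φ (arc ζ ρ θ)) θ0 (-θ0) (Φ w) =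
        linc (E w) θ0 (-θ0) + linc (q w) θ0 (-θ0) := by
      rw [← linc_mul ⟨(hEcw w).continuousOn, fun θ _ => hEn θ⟩ (hqg w hw)]
      unfold dd
      exact linc_congr fun θ _ => (hEq w θ).symm
    have k2 := linc_add (f := E w) (A := -θ0) (B := 2 * Real.pi) (a := θ0) (b := -θ0)
      (c := -θ0 + 2 * Real.pi)
      ⟨(hEcw w).continuousOn, fun θ _ => hEn θ⟩ ⟨by linarith, by linarith⟩
      ⟨by linarith, by linarith [Real.pi_pos]⟩ ⟨by linarith [Real.pi_pos], by linarith⟩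
    rw [k1]
    simp only [H, dd]
    rw [show 2 * Real.pi - θ0 = -θ0 + 2 * Real.pi by ring, ← k2]
    ring
  have hu : ∀ w, ‖1 - w / ζ‖ = ‖w - ζ‖ := by
    intro w
    rw [show 1 - w / ζ = -((w - ζ) / ζ) by field_simp; ring, norm_neg, norm_div, hζ, div_one]
  rintro w ⟨hw, hwρ⟩
  have hwρ' : ‖w - ζ‖ < ρ := by simpa [dist_eq_norm] using hwρ
  have a1 := hJ w hw hwρ'.ne
  have a2 := hJ 0 (by simp) (by simp [hζ]; linarith)
  rw [h.z] at a2
  rw [a1, a2, hconst w hw]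
  have b1 : linc (E w) (-θ0) (-θ0 + 2 * Real.pi) = 2 * Real.pi * Complex.I :=
    circ_in (by rw [hu]; exact hwρ') (-θ0)
  have b2 : linc (E 0) (-θ0) (-θ0 + 2 * Real.pi) = 0 :=
    circ_out hρ.le (by rw [hu]; simpa [hζ] using hρ1) (-θ0)
  rw [b1, b2]
  intro hcon
  have : (2 * Real.pi * Complex.I : ℂ) = 0 := by linear_combination -hcon
  simp [Real.pi_ne_zero] at this

set_option maxHeartbeats 800000 in
theorem crosscut (h : Conf Φ G) {γ : ℝ → ℂ} (hγ : Continuous γ) (hfr : frontier G = γ '' Icc 0 3)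
    {ζ : ℂ} (hζ : ‖ζ‖ = 1) {ρ : ℝ} (hρ : 0 < ρ) (hρ1 : ρ < 1) :
    ∃ s t : ℝ, ∃ C : ℝ → ℂ, 0 ≤ s ∧ s ≤ t ∧ t ≤ 3 ∧ ContinuousOn C (Icc 0 1) ∧ C 0 = γ t ∧ C 1 = γ s ∧
      (∀ x ∈ Icc (0:ℝ) 1, ∃ p, ‖p‖ ≤ 1 ∧ ‖p - ζ‖ = ρ ∧ C x = Φ p) ∧
      ∀ w ∈ ball (0:ℂ) 1 ∩ ball ζ ρ, dd γ s t (Φ w) + dd C 0 1 (Φ w) ≠ dd γ s t 0 + dd C 0 1 0 := by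
  obtain ⟨θ0, hθ0⟩ : ∃ θ0, θ0 = Real.arccos (ρ / 2) := ⟨_, rfl⟩
  have hθp : 0 ≤ θ0 := hθ0 ▸ Real.arccos_nonneg _
  have harc : ∀ θ ∈ Icc (-θ0) θ0, ‖arc ζ ρ θ‖ ≤ 1 := fun θ hθ =>
    (arc_le hζ hρ).2 (cos_in hρ hρ1 (hθ0 ▸ abs_le.2 hθ))
  have hc0 : Real.cos θ0 = ρ / 2 := by rw [hθ0, Real.cos_arccos (by linarith) (by linarith)]
  have hend : ∀ θ, Real.cos θ = ρ / 2 → Φ (arc ζ ρ θ) ∈ γ '' Icc 0 3 := by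
    intro θ hθ
    rw [← hfr]
    apply h.bdry
    apply le_antisymm ((arc_le hζ hρ).2 hθ.ge)
    by_contra hcon
    have := (arc_lt hζ hρ).1 (not_le.1 hcon)
    linarith
  obtain ⟨t, ht, htt⟩ := hend θ0 hc0
  obtain ⟨s, hs, hss⟩ := hend (-θ0) (by rw [Real.cos_neg, hc0])
  have key := h.loop hγ hfr hζ hρ hρ1 hs ht hθ0 hss.symm htt.symm
  have hFc : ContinuousOn (fun θ => Φ (arc ζ ρ θ)) (Icc (-θ0) θ0) :=
    h.c.comp (arc_cont ζ ρ).continuousOn (fun θ hθ => by simpa using harc θ hθ)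
  have hFg : ∀ w, ‖w‖ < 1 → ‖w - ζ‖ ≠ ρ → Good (fun θ => Φ (arc ζ ρ θ) - Φ w) (Icc (-θ0) θ0) := by
    intro w hw hn
    refine ⟨hFc.sub continuousOn_const, fun θ hθ => sub_ne_zero.2 (h.sep (harc θ hθ) hw ?_)⟩
    rintro rfl; exact hn (arc_dist hζ hρ θ)
  have hγg : ∀ w, ‖w‖ < 1 → Good (fun τ => γ τ - Φ w) (uIcc s t) := by
    intro w hw
    refine ⟨by fun_prop, fun τ hτ h0 => ?_⟩
    have h1 : γ τ ∈ frontier G := by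
      rw [hfr]; exact ⟨τ, ordConnected_Icc.uIcc_subset hs ht hτ, rfl⟩
    rw [h.o.frontier_eq, sub_eq_zero.1 h0] at h1
    exact h1.2 (h.b.mapsTo (by simpa using hw))
  have h0ζ : ‖(0:ℂ) - ζ‖ ≠ ρ := by simp [hζ]; linarith
  have hm1 : MapsTo (fun x : ℝ => θ0 - 2 * θ0 * x) (Icc 0 1) (Icc (-θ0) θ0) := fun x hx =>
    ⟨by nlinarith [hx.2], by nlinarith [hx.1]⟩
  have hm2 : MapsTo (fun x : ℝ => -θ0 + 2 * θ0 * x) (Icc 0 1) (Icc (-θ0) θ0) := fun x hx =>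
    ⟨by nlinarith [hx.1], by nlinarith [hx.2]⟩
  rcases le_total s t with hst | hst
  · have hd : ∀ w, ‖w‖ < 1 → ‖w - ζ‖ ≠ ρ → dd (fun x => Φ (arc ζ ρ (θ0 - 2 * θ0 * x))) 0 1 (Φ w) =
        dd (fun θ => Φ (arc ζ ρ θ)) θ0 (-θ0) (Φ w) := by
      intro w hw hn
      have := linc_comp' (u := fun x : ℝ => θ0 - 2 * θ0 * x) (a := 0) (b := 1) (hFg w hw hn)
        (by fun_prop) (by rw [uIcc_of_le zero_le_one]; exact hm1)
      simp only [dd]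
      rw [this]
      congr 1 <;> ring
    refine ⟨s, t, fun x => Φ (arc ζ ρ (θ0 - 2 * θ0 * x)), hs.1, hst, ht.2,
      hFc.comp (f := fun x : ℝ => θ0 - 2 * θ0 * x) (by fun_prop) hm1, ?_, ?_, ?_, ?_⟩
    · simp [htt]
    · have e : θ0 - 2 * θ0 * 1 = -θ0 := by ring
      show Φ (arc ζ ρ (θ0 - 2 * θ0 * 1)) = γ s
      rw [e, hss]
    · intro x hx
      exact ⟨_, harc _ (hm1 hx), arc_dist hζ hρ _, rfl⟩
    · intro w hw
      have hw1 : ‖w‖ < 1 := by simpa using hw.1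
      have hw2 : ‖w - ζ‖ < ρ := by simpa [dist_eq_norm] using hw.2
      have e0 := hd 0 (by simp) h0ζ
      rw [h.z] at e0
      rw [hd w hw1 hw2.ne, e0]
      exact key w hw
  · have hd : ∀ w, ‖w‖ < 1 → ‖w - ζ‖ ≠ ρ → dd (fun x => Φ (arc ζ ρ (-θ0 + 2 * θ0 * x))) 0 1 (Φ w) =
        - dd (fun θ => Φ (arc ζ ρ θ)) θ0 (-θ0) (Φ w) := by
      intro w hw hn
      have := linc_comp' (u := fun x : ℝ => -θ0 + 2 * θ0 * x) (a := 0) (b := 1) (hFg w hw hn)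
        (by fun_prop) (by rw [uIcc_of_le zero_le_one]; exact hm2)
      simp only [dd]
      rw [this, ← linc_symm]
      · congr 1 <;> ring
      · rw [uIcc_comm, uIcc_of_le (by linarith)]; exact hFg w hw hn
    have hd2 : ∀ w, ‖w‖ < 1 → dd γ t s (Φ w) = - dd γ s t (Φ w) := fun w hw => linc_symm (hγg w hw)
    refine ⟨t, s, fun x => Φ (arc ζ ρ (-θ0 + 2 * θ0 * x)), ht.1, hst, hs.2,
      hFc.comp (f := fun x : ℝ => -θ0 + 2 * θ0 * x) (by fun_prop) hm2, ?_, ?_, ?_, ?_⟩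
    · simp [hss]
    · have e : -θ0 + 2 * θ0 * 1 = θ0 := by ring
      show Φ (arc ζ ρ (-θ0 + 2 * θ0 * 1)) = γ t
      rw [e, htt]
    · intro x hx
      exact ⟨_, harc _ (hm2 hx), arc_dist hζ hρ _, rfl⟩
    · intro w hw
      have hw1 : ‖w‖ < 1 := by simpa using hw.1
      have hw2 : ‖w - ζ‖ < ρ := by simpa [dist_eq_norm] using hw.2
      have e0 := hd 0 (by simp) h0ζ
      have e1 := hd2 0 (by simp)
      rw [h.z] at e0 e1
      rw [hd w hw1 hw2.ne, e0, hd2 w hw1, e1]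
      intro hcon
      exact key w hw (by linear_combination -hcon)

end Conf
end RMC
end

section
open Set Filter Topology Metric
namespace RMC
open MeasureTheory

theorem det_hol (a : ℂ) :
    ((ContinuousLinearMap.toSpanSingleton ℂ a).restrictScalars ℝ).det = ‖a‖ ^ 2 := by
  have h1 : (((ContinuousLinearMap.toSpanSingleton ℂ a).restrictScalars ℝ : ℂ →L[ℝ] ℂ) : ℂ →ₗ[ℝ] ℂ)
      = Algebra.lmul ℝ ℂ a := by
    ext <;> simp [mul_comm]
  rw [ContinuousLinearMap.det, h1, ← Algebra.norm_apply, Algebra.norm_complex_apply,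
    Complex.normSq_eq_norm_sq]

theorem area {f f' : ℂ → ℂ} {s : Set ℂ} (hs : MeasurableSet s) (hf : ∀ z ∈ s, HasDerivAt f (f' z) z)
    (hi : InjOn f s) : ∫⁻ z in s, ENNReal.ofReal (‖f' z‖ ^ 2) = volume (f '' s) := by
  have := lintegral_image_eq_lintegral_abs_det_fderiv_mul volume hs
    (f' := fun z => (ContinuousLinearMap.toSpanSingleton ℂ (f' z)).restrictScalars ℝ)
    (fun z hz => ((hf z hz).hasFDerivAt.restrictScalars ℝ).hasFDerivWithinAt) hi (fun _ => 1)
  simp only [lintegral_const, det_hol, mul_one, abs_pow, abs_norm] at this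
  rw [← this]
  simp

namespace Conf
variable {Φ : ℂ → ℂ} {G : Set ℂ}

open Classical in
/-- energy density in coordinates centred at the boundary point -/
noncomputable def dens (Φ : ℂ → ℂ) (ζ z : ℂ) : ENNReal :=
  (ball (1:ℂ) 1).indicator (fun z => ENNReal.ofReal (‖deriv Φ (ζ * (1 - z))‖ ^ 2)) z

theorem dens_meas (Φ : ℂ → ℂ) (ζ : ℂ) : Measurable (dens Φ ζ) := by
  unfold dens
  refine Measurable.indicator ?_ measurableSet_ball
  have : Measurable (fun z => deriv Φ (ζ * (1 - z))) :=
    (measurable_deriv Φ).comp (by fun_prop : Measurable fun z : ℂ => ζ * (1 - z))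
  exact (this.norm.pow_const 2).ennreal_ofReal

theorem dens_int (h : Conf Φ G) {ζ : ℂ} (hζ : ‖ζ‖ = 1) : ∫⁻ z, dens Φ ζ z ≤ volume G := by
  have hζ0 : ζ ≠ 0 := by rintro rfl; simp at hζ
  have hm : ∀ z ∈ ball (1:ℂ) 1, ζ * (1 - z) ∈ ball (0:ℂ) 1 := by
    intro z hz
    have : ‖z - 1‖ < 1 := by simpa [dist_eq_norm] using hz
    simpa [hζ, norm_sub_rev 1 z] using this
  unfold dens
  rw [lintegral_indicator measurableSet_ball]
  have := area (f := fun z => Φ (ζ * (1 - z))) (f' := fun z => deriv Φ (ζ * (1 - z)) * (-ζ))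
    (s := ball (1:ℂ) 1) measurableSet_ball ?_ ?_
  · simp only [norm_mul, norm_neg, hζ, mul_one] at this
    rw [this]
    refine measure_mono ?_
    rintro _ ⟨z, hz, rfl⟩
    exact h.b.mapsTo (hm z hz)
  · intro z hz
    have h1 : HasDerivAt (fun z : ℂ => ζ * (1 - z)) (-ζ) z := by
      simpa using ((hasDerivAt_id z).const_sub 1).const_mul ζ
    exact (h.d.differentiableAt (isOpen_ball.mem_nhds (hm z hz))).hasDerivAt.comp z h1
  · intro z hz z' hz' he
    have := h.b.injOn (hm z hz) (hm z' hz') he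
    have := mul_left_cancel₀ hζ0 this
    linear_combination -this

theorem good_radius (h : Conf Φ G) {ζ : ℂ} (hζ : ‖ζ‖ = 1) {δ δ0 κ : ℝ} (hδ : 0 < δ) (hδ0 : δ < δ0)
    (hκ : 0 < κ) (hV : volume G < ENNReal.ofReal (κ * Real.log (δ0 / δ))) :
    ∃ ρ ∈ Ioo δ δ0, ∫⁻ θ in Ioo (-Real.pi) Real.pi,
      ENNReal.ofReal (ρ ^ 2) * dens Φ ζ ((ρ:ℂ) * Complex.exp (θ * Complex.I)) < ENNReal.ofReal κ := by
  by_contra hcon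
  push Not at hcon
  have h1 : ENNReal.ofReal (κ * Real.log (δ0 / δ)) ≤ ∫⁻ z, dens Φ ζ z := by
    rw [← Complex.lintegral_comp_polarCoord_symm]
    have hsub : Ioo δ δ0 ×ˢ Ioo (-Real.pi) Real.pi ⊆ polarCoord.target := by
      rw [polarCoord_target]
      exact prod_mono (fun x hx => hδ.trans hx.1) (le_refl _)
    refine le_trans ?_ (lintegral_mono_set hsub)
    have hmeas : Measurable (fun p : ℝ × ℝ => ENNReal.ofReal p.1 • dens Φ ζ (Complex.polarCoord.symm p)) := by
      refine (measurable_fst.ennreal_ofReal).smul ((dens_meas Φ ζ).comp ?_)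
      have : (Complex.polarCoord.symm : ℝ × ℝ → ℂ) =
          fun p => p.1 * (Real.cos p.2 + Real.sin p.2 * Complex.I) :=
        funext Complex.polarCoord_symm_apply
      rw [this]
      fun_prop
    rw [Measure.volume_eq_prod, setLIntegral_prod _ hmeas.aemeasurable]
    have h2 : ENNReal.ofReal (κ * Real.log (δ0 / δ)) = ∫⁻ r in Ioo δ δ0, ENNReal.ofReal (κ * r⁻¹) := by
      rw [← ofReal_integral_eq_lintegral_ofReal]
      · rw [← integral_Ioc_eq_integral_Ioo, ← intervalIntegral.integral_of_le hδ0.le,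
          intervalIntegral.integral_const_mul, integral_inv_of_pos hδ (hδ.trans hδ0)]
      · refine IntegrableOn.mono_set ?_ Ioo_subset_Icc_self
        refine ContinuousOn.integrableOn_Icc ?_
        exact continuousOn_const.mul (continuousOn_id.inv₀ fun x hx => (hδ.trans_le hx.1).ne')
      · refine (ae_restrict_iff' measurableSet_Ioo).2 (Eventually.of_forall fun x hx => ?_)
        have : 0 < x := hδ.trans hx.1
        simp only [Pi.zero_apply]; positivity
    rw [h2]
    refine setLIntegral_mono' measurableSet_Ioo fun r hr => ?_
    have hr0 : 0 < r := hδ.trans hr.1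
    have h3 := hcon r hr
    have h4 : ∀ θ : ℝ, Complex.polarCoord.symm (r, θ) = (r:ℂ) * Complex.exp (θ * Complex.I) := by
      intro θ
      rw [Complex.polarCoord_symm_apply, Complex.exp_mul_I]; simp
    calc ENNReal.ofReal (κ * r⁻¹) = ENNReal.ofReal r⁻¹ * ENNReal.ofReal κ := by
          rw [mul_comm, ENNReal.ofReal_mul (by positivity)]
      _ ≤ ENNReal.ofReal r⁻¹ * ∫⁻ θ in Ioo (-Real.pi) Real.pi,
          ENNReal.ofReal (r ^ 2) * dens Φ ζ ((r:ℂ) * Complex.exp (θ * Complex.I)) := by gcongr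
      _ = _ := by
          rw [← lintegral_const_mul']
          · refine lintegral_congr fun θ => ?_
            rw [h4, ← mul_assoc, ← ENNReal.ofReal_mul (by positivity), smul_eq_mul]
            congr 2
            field_simp
          · exact ENNReal.ofReal_ne_top
  exact absurd (h1.trans (h.dens_int hζ)) (not_le.2 hV)

theorem osc_open (h : Conf Φ G) {ζ : ℂ} (hζ : ‖ζ‖ = 1) {ρ ε : ℝ} (hρ : 0 < ρ) (hρ1 : ρ < 1) (hε : 0 < ε)
    (hA : ∫⁻ θ in Ioo (-Real.pi) Real.pi,
      ENNReal.ofReal (ρ ^ 2) * dens Φ ζ ((ρ:ℂ) * Complex.exp (θ * Complex.I)) <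
        ENNReal.ofReal (ε ^ 2 / 8)) {a b : ℝ} (hab : a ≤ b) (ha : -Real.arccos (ρ / 2) < a)
    (hb : b < Real.arccos (ρ / 2)) : dist (Φ (arc ζ ρ b)) (Φ (arc ζ ρ a)) ≤ ε := by
  have hpi : Real.arccos (ρ / 2) ≤ Real.pi := Real.arccos_le_pi _
  have hin : ∀ θ ∈ Icc a b, arc ζ ρ θ ∈ ball (0:ℂ) 1 := fun θ hθ => by
    have := (arc_lt hζ hρ).2 (cos_in' hρ hρ1 (θ := θ) (abs_lt.2 ⟨by linarith [hθ.1], by linarith [hθ.2]⟩))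
    simpa using this
  let F' : ℝ → ℂ := fun θ => deriv Φ (arc ζ ρ θ) * (-ζ * ρ * Complex.exp (θ * Complex.I) * Complex.I)
  have hF' : ∀ θ ∈ Icc a b, HasDerivAt (fun θ : ℝ => Φ (arc ζ ρ θ)) (F' θ) θ := by
    intro θ hθ
    have h1 : HasDerivAt (arc ζ ρ) (-ζ * ρ * Complex.exp (θ * Complex.I) * Complex.I) θ := by
      have e : HasDerivAt (fun θ : ℝ => (θ:ℂ) * Complex.I) Complex.I θ := by
        simpa using (Complex.ofRealCLM.hasDerivAt (x := θ)).mul_const Complex.I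
      have := (((e.cexp).const_mul (ρ:ℂ)).const_sub 1).const_mul ζ
      refine this.congr_deriv ?_
      ring
    exact (h.d.differentiableAt (isOpen_ball.mem_nhds (hin θ hθ))).hasDerivAt.comp θ h1
  have hnorm : ∀ θ, ‖F' θ‖ = ρ * ‖deriv Φ (arc ζ ρ θ)‖ := by
    intro θ
    simp only [F', norm_mul, norm_neg, hζ, Complex.norm_exp_ofReal_mul_I, Complex.norm_I,
      Complex.norm_real, Real.norm_eq_abs, abs_of_pos hρ]
    ring
  have hc : ContinuousOn F' (Icc a b) := by
    have hd : ContinuousOn (deriv Φ) (ball 0 1) := (h.d.analyticOnNhd isOpen_ball).deriv.continuousOn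
    refine ContinuousOn.mul (hd.comp (arc_cont ζ ρ).continuousOn hin) (by fun_prop)
  have hftc : ∫ θ in a..b, F' θ = Φ (arc ζ ρ b) - Φ (arc ζ ρ a) :=
    intervalIntegral.integral_eq_sub_of_hasDerivAt (by rwa [uIcc_of_le hab])
      (ContinuousOn.intervalIntegrable (by rwa [uIcc_of_le hab]))
  have hsqc : ContinuousOn (fun θ => ‖F' θ‖ ^ 2) (Icc a b) := hc.norm.pow 2
  have hsqi : IntervalIntegrable (fun θ => ‖F' θ‖ ^ 2) volume a b :=
    ContinuousOn.intervalIntegrable (by rwa [uIcc_of_le hab])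
  have hen : ∫ θ in a..b, ‖F' θ‖ ^ 2 ≤ ε ^ 2 / 8 := by
    rw [← ENNReal.ofReal_le_ofReal_iff (by positivity), intervalIntegral.integral_of_le hab,
      ofReal_integral_eq_lintegral_ofReal
        ((hsqc.integrableOn_Icc).mono_set Ioc_subset_Icc_self)
        (Eventually.of_forall fun x => by positivity)]
    refine le_trans ?_ hA.le
    refine le_trans ?_ (lintegral_mono_set (s := Ioc a b) (fun x hx => ⟨by linarith [hx.1], by linarith [hx.2]⟩))
    refine setLIntegral_mono' measurableSet_Ioc fun θ hθ => ?_
    have h1 : (ρ:ℂ) * Complex.exp (θ * Complex.I) ∈ ball (1:ℂ) 1 := by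
      have := hin θ ⟨hθ.1.le, hθ.2⟩
      simp only [mem_ball, dist_zero_right, arc, norm_mul, hζ, one_mul] at this
      rw [mem_ball, dist_eq_norm, norm_sub_rev]; exact this
    rw [dens, indicator_of_mem h1, ← ENNReal.ofReal_mul (by positivity), hnorm, mul_pow]
    rfl
  rw [dist_eq_norm, ← hftc]
  have hεi : 0 < ε / 8 := by positivity
  calc ‖∫ θ in a..b, F' θ‖ ≤ ∫ θ in a..b, (ε / 16 + 4 / ε * ‖F' θ‖ ^ 2) := by
        refine intervalIntegral.norm_integral_le_of_norm_le hab ?_ ?_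
        · refine Eventually.of_forall fun θ _ => ?_
          have h1 : ‖F' θ‖ * ε ≤ (ε / 16 + 4 / ε * ‖F' θ‖ ^ 2) * ε := by
            have : (ε / 16 + 4 / ε * ‖F' θ‖ ^ 2) * ε = ε ^ 2 / 16 + 4 * ‖F' θ‖ ^ 2 := by field_simp
            rw [this]
            nlinarith [sq_nonneg (ε / 4 - 2 * ‖F' θ‖)]
          exact le_of_mul_le_mul_right h1 hε
        · exact (intervalIntegrable_const).add (hsqi.const_mul _)
    _ = (b - a) * (ε / 16) + 4 / ε * ∫ θ in a..b, ‖F' θ‖ ^ 2 := by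
        rw [intervalIntegral.integral_add intervalIntegrable_const (hsqi.const_mul _),
          intervalIntegral.integral_const, intervalIntegral.integral_const_mul, smul_eq_mul]
    _ ≤ 8 * (ε / 16) + 4 / ε * (ε ^ 2 / 8) := by
        gcongr
        linarith [Real.pi_le_four]
    _ = ε := by field_simp; norm_num

theorem arc_param {ζ : ℂ} (hζ : ‖ζ‖ = 1) {ρ : ℝ} (hρ : 0 < ρ) {p : ℂ} (hp : ‖p‖ ≤ 1)
    (hpρ : ‖p - ζ‖ = ρ) : ∃ θ ∈ Icc (-Real.arccos (ρ / 2)) (Real.arccos (ρ / 2)), p = arc ζ ρ θ := by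
  have hζ0 : ζ ≠ 0 := by rintro rfl; simp at hζ
  have hu : ‖1 - p / ζ‖ = ρ := by
    rw [show 1 - p / ζ = -((p - ζ) / ζ) by field_simp; ring, norm_neg, norm_div, hζ, div_one, hpρ]
  have he := Complex.norm_mul_exp_arg_mul_I (1 - p / ζ)
  rw [hu] at he
  have hpe : p = arc ζ ρ (Complex.arg (1 - p / ζ)) := by
    unfold arc; rw [he]; field_simp; ring
  refine ⟨_, ?_, hpe⟩
  rw [mem_Icc, ← abs_le]
  have h1 : ρ / 2 ≤ Real.cos (Complex.arg (1 - p / ζ)) := (arc_le hζ hρ).1 (hpe ▸ hp)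
  rw [← Real.cos_abs] at h1
  rw [← Real.arccos_cos (abs_nonneg _) (Complex.abs_arg_le_pi (1 - p / ζ))]
  exact Real.arccos_le_arccos h1

theorem osc (h : Conf Φ G) {ζ : ℂ} (hζ : ‖ζ‖ = 1) {ρ ε : ℝ} (hρ : 0 < ρ) (hρ1 : ρ < 1) (hε : 0 < ε)
    (hA : ∫⁻ θ in Ioo (-Real.pi) Real.pi,
      ENNReal.ofReal (ρ ^ 2) * dens Φ ζ ((ρ:ℂ) * Complex.exp (θ * Complex.I)) <
        ENNReal.ofReal (ε ^ 2 / 8)) {p p' : ℂ} (hp : ‖p‖ ≤ 1) (hpρ : ‖p - ζ‖ = ρ)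
    (hp' : ‖p'‖ ≤ 1) (hpρ' : ‖p' - ζ‖ = ρ) : dist (Φ p) (Φ p') ≤ ε := by
  obtain ⟨θ, hθ, rfl⟩ := arc_param hζ hρ hp hpρ
  obtain ⟨θ', hθ', rfl⟩ := arc_param hζ hρ hp' hpρ'
  have hpos : 0 < Real.arccos (ρ / 2) := Real.arccos_pos.2 (by linarith)
  set θ0 := Real.arccos (ρ / 2) with hθ0
  set F : ℝ → ℂ := fun θ => Φ (arc ζ ρ θ) with hF
  have hcl : closure (Ioo (-θ0) θ0) = Icc (-θ0) θ0 := closure_Ioo (by linarith)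
  have hFc : ContinuousOn F (closure (Ioo (-θ0) θ0)) := by
    rw [hcl]
    exact h.c.comp (arc_cont ζ ρ).continuousOn (fun θ hθ => by
      simpa using (arc_le hζ hρ).2 (cos_in hρ hρ1 (abs_le.2 hθ)))
  have hd : ediam (closure (F '' Ioo (-θ0) θ0)) ≤ ENNReal.ofReal ε := by
    rw [Metric.ediam_closure]
    refine Metric.ediam_le ?_
    rintro _ ⟨x, hx, rfl⟩ _ ⟨y, hy, rfl⟩
    rw [edist_dist]
    refine ENNReal.ofReal_le_ofReal ?_
    rcases le_total x y with hxy | hxy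
    · rw [dist_comm]; exact h.osc_open hζ hρ hρ1 hε hA hxy hx.1 hy.2
    · exact h.osc_open hζ hρ hρ1 hε hA hxy hy.1 hx.2
  have m : ∀ x ∈ Icc (-θ0) θ0, F x ∈ closure (F '' Ioo (-θ0) θ0) := fun x hx =>
    hFc.image_closure ⟨x, by rwa [hcl], rfl⟩
  have := (Metric.edist_le_ediam_of_mem (m θ hθ) (m θ' hθ')).trans hd
  rw [edist_dist] at this
  exact (ENNReal.ofReal_le_ofReal_iff hε.le).1 this

end Conf

theorem wolff {M : ℝ} {ε δ0 : ℝ} (hε : 0 < ε) (hδ0 : 0 < δ0) (hδ1 : δ0 < 1) :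
    ∃ δ > 0, δ < δ0 ∧ ∀ Φ G, Conf Φ G → G ⊆ ball 0 M → ∀ ζ : ℂ, ‖ζ‖ = 1 → ∃ ρ ∈ Ioo δ δ0,
      ∀ p p', ‖p‖ ≤ 1 → ‖p - ζ‖ = ρ → ‖p'‖ ≤ 1 → ‖p' - ζ‖ = ρ → dist (Φ p) (Φ p') ≤ ε := by
  have hVt : volume (ball (0:ℂ) M) < ⊤ := measure_ball_lt_top
  set V := (volume (ball (0:ℂ) M)).toReal with hV
  have hV0 : 0 ≤ V := ENNReal.toReal_nonneg
  set κ := ε ^ 2 / 8 with hκ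
  have hκ0 : 0 < κ := by positivity
  have hx : 0 < (V + 1) / κ := by positivity
  refine ⟨δ0 * Real.exp (-((V + 1) / κ)), by positivity, ?_, ?_⟩
  · have : Real.exp (-((V + 1) / κ)) < 1 := Real.exp_lt_one_iff.2 (by linarith)
    nlinarith
  · intro Φ G h hG ζ hζ
    have hδlt : δ0 * Real.exp (-((V + 1) / κ)) < δ0 := by
      have : Real.exp (-((V + 1) / κ)) < 1 := Real.exp_lt_one_iff.2 (by linarith)
      nlinarith
    obtain ⟨ρ, hρ, hA⟩ := h.good_radius hζ (δ := δ0 * Real.exp (-((V + 1) / κ))) (by positivity) hδlt hκ0 (by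
      have : δ0 / (δ0 * Real.exp (-((V + 1) / κ))) = Real.exp ((V + 1) / κ) := by
        rw [Real.exp_neg]; field_simp
      rw [this, Real.log_exp, mul_div_cancel₀ _ hκ0.ne']
      refine (measure_mono hG).trans_lt ?_
      rw [← ENNReal.ofReal_toReal hVt.ne, ← hV]
      exact (ENNReal.ofReal_lt_ofReal_iff (by linarith)).2 (by linarith))
    have hρ0 : 0 < ρ := lt_trans (by positivity) hρ.1
    exact ⟨ρ, hρ, fun p p' h1 h2 h3 h4 => h.osc hζ hρ0 (hρ.2.trans hδ1) hε hA h1 h2 h3 h4⟩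

end RMC
end

section
open Set Filter Topology Metric
namespace RMC

theorem Conf.notMem_fr {Φ : ℂ → ℂ} {G : Set ℂ} (h : Conf Φ G) {w : ℂ} (hw : w ∈ ball (0:ℂ) 1) :
    Φ w ∉ frontier G := fun hf => by
  rw [h.o.frontier_eq] at hf; exact hf.2 (h.b.mapsTo hw)

theorem Conf.index {Φ : ℂ → ℂ} {G : Set ℂ} (h : Conf Φ G) {γ : ℝ → ℂ} (hγ : Continuous γ)
    (hfr : frontier G = γ '' Icc 0 3) (hcl : γ 0 = γ 3) {w : ℂ} (hw : w ∈ ball (0:ℂ) 1) :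
    dd γ 0 3 (Φ w) = dd γ 0 3 0 := by
  have hn : ∀ w ∈ ball (0:ℂ) 1, Φ w ∉ γ '' uIcc 0 3 := fun w hw => by
    rw [uIcc_of_le (by norm_num), ← hfr]; exact h.notMem_fr hw
  have h1 : ContinuousOn (fun w => dd γ 0 3 (Φ w)) (ball 0 1) := fun w hw =>
    (dd_continuousAt hγ.continuousOn (hn w hw)).comp_continuousWithinAt (h.d.continuousOn w hw)
  have h2 := const_of_exp (convex_ball (0:ℂ) 1).isPreconnected h1 (fun w hw => by
    rw [dd_exp hγ.continuousOn (hn w hw), hcl, div_self]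
    exact fun h0 => hn w hw ⟨3, right_mem_uIcc, sub_eq_zero.1 h0⟩) hw (mem_ball_self one_pos)
  simpa [h.z] using h2

theorem EQ {γ : ℝ → ℂ} {G : Set ℂ} (hcfg : Cfg γ G) {γn : ℕ → ℝ → ℂ} {Gn : ℕ → Set ℂ}
    (hγn : ∀ n, Continuous (γn n)) (hu : TendstoUniformlyOn γn γ atTop (Icc 0 3))
    (hfr : ∀ n, frontier (Gn n) = γn n '' Icc 0 3) (hcl : ∀ n, γn n 0 = γn n 3)
    {Φn : ℕ → ℂ → ℂ} (hconf : ∀ n, Conf (Φn n) (Gn n)) {M : ℝ} (hM : ∀ n, Gn n ⊆ ball 0 M)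
    {ε : ℝ} (hε : 0 < ε) : ∃ δ > 0, ∃ N, ∀ n ≥ N, ∀ ζ : ℂ, ‖ζ‖ = 1 →
      ∀ w ∈ ball (0:ℂ) 1 ∩ ball ζ δ, ∀ w' ∈ ball (0:ℂ) 1 ∩ ball ζ δ,
        dist (Φn n w) (Φn n w') < ε := by
  by_contra hcon
  push Not at hcon
  have key : ∀ k : ℕ, ∃ n ≥ k, ∃ s t : ℝ, ∃ C : ℝ → ℂ, ∃ B : Set ℂ, ∃ z z' : ℂ, 0 ≤ s ∧ s ≤ t ∧ t ≤ 3 ∧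
      ContinuousOn C (Icc 0 1) ∧ C 0 = γn n t ∧ C 1 = γn n s ∧
      (∀ x ∈ Icc (0:ℝ) 1, dist (C x) (γn n t) ≤ 1 / ((k:ℝ) + 1)) ∧
      (0:ℂ) ∉ γn n '' Icc 0 3 ∧ (0:ℂ) ∉ C '' Icc 0 1 ∧ IsPreconnected B ∧ (∀ z ∈ B, ‖z‖ ≤ M) ∧
      (∀ z ∈ B, z ∉ γn n '' Icc 0 3 ∧ z ∉ C '' Icc 0 1) ∧
      (∀ z ∈ B, dd (γn n) s t z + dd C 0 1 z ≠ dd (γn n) s t 0 + dd C 0 1 0) ∧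
      (∀ z ∈ B, dd (γn n) 0 3 z = dd (γn n) 0 3 0) ∧ z ∈ B ∧ z' ∈ B ∧ ε ≤ dist z z' := by
    intro k
    obtain ⟨δ, hδ, hδ2, hW⟩ := wolff (M := M) (ε := 1 / ((k:ℝ) + 1)) (δ0 := 1 / 2) (by positivity)
      (by norm_num) (by norm_num)
    obtain ⟨n, hn, ζ, hζ, w, hw, w', hw', hd⟩ := hcon δ hδ k
    obtain ⟨ρ, hρ, hosc⟩ := hW (Φn n) (Gn n) (hconf n) (hM n) ζ hζ
    have hρ0 : 0 < ρ := hδ.trans hρ.1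
    have hρ1 : ρ < 1 := by linarith [hρ.2]
    obtain ⟨s, t, C, hs, hst, ht, hC, hC0, hC1, hCp, hJ⟩ := (hconf n).crosscut (hγn n) (hfr n) hζ hρ0 hρ1
    have hzfr : ∀ w ∈ ball (0:ℂ) 1, Φn n w ∉ γn n '' Icc 0 3 := fun w hw => by
      rw [← hfr]; exact (hconf n).notMem_fr hw
    have hzC : ∀ w ∈ ball (0:ℂ) 1, ‖w - ζ‖ ≠ ρ → Φn n w ∉ C '' Icc 0 1 := by
      rintro w hw hne ⟨x, hx, he⟩
      obtain ⟨p, hp, hpρ, hpe⟩ := hCp x hx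
      refine (hconf n).sep hp (by simpa using hw) ?_ (hpe.symm.trans he)
      rintro rfl; exact hne hpρ
    have h0 : (0:ℂ) ∈ ball (0:ℂ) 1 := mem_ball_self one_pos
    have hz := (hconf n).z
    have hin : ∀ w ∈ ball (0:ℂ) 1 ∩ ball ζ ρ, ‖w - ζ‖ ≠ ρ := fun w hw => by
      have : ‖w - ζ‖ < ρ := by simpa [dist_eq_norm] using hw.2
      exact this.ne
    refine ⟨n, hn, s, t, C, Φn n '' (ball 0 1 ∩ ball ζ ρ), Φn n w, Φn n w', hs, hst, ht, hC, hC0, hC1,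
      ?_, ?_, ?_, ?_, ?_, ?_, ?_, ?_, ?_, ?_, hd⟩
    · intro x hx
      obtain ⟨p, hp, hpρ, hpe⟩ := hCp x hx
      obtain ⟨p', hp', hpρ', hpe'⟩ := hCp 0 ⟨le_refl _, zero_le_one⟩
      rw [← hC0, hpe, hpe']
      exact hosc p p' hp hpρ hp' hpρ'
    · have := hzfr 0 h0; rwa [hz] at this
    · have := hzC 0 h0 (by simp [hζ]; linarith)
      rwa [hz] at this
    · exact ((convex_ball (0:ℂ) 1).inter (convex_ball ζ ρ)).isPreconnected.image _
        ((hconf n).d.continuousOn.mono inter_subset_left)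
    · rintro _ ⟨v, hv, rfl⟩
      have := hM n ((hconf n).b.mapsTo hv.1)
      simpa using (mem_ball_zero_iff.1 this).le
    · rintro _ ⟨v, hv, rfl⟩
      exact ⟨hzfr v hv.1, hzC v hv.1 (hin v hv)⟩
    · rintro _ ⟨v, hv, rfl⟩
      exact hJ v hv
    · rintro _ ⟨v, hv, rfl⟩
      exact (hconf n).index (hγn n) (hfr n) (hcl n) hv.1
    · exact ⟨w, ⟨hw.1, ball_subset_ball hρ.1.le hw.2⟩, rfl⟩
    · exact ⟨w', ⟨hw'.1, ball_subset_ball hρ.1.le hw'.2⟩, rfl⟩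
  choose n hn s t C B z z' k1 k2 k3 k4 k5 k6 k7 k8 k9 k10 k11 k12 k13 k14 k15 k16 k17 using key
  have hnt : Tendsto n atTop atTop := tendsto_atTop_mono hn tendsto_id
  let U : Ultrafilter ℕ := Ultrafilter.of atTop
  have hUle : (U : Filter ℕ) ≤ atTop := Ultrafilter.of_le atTop
  have hlim := T3 U hcfg (γk := fun k => γn (n k)) (fun k => hγn _) (by
      intro v hv
      exact (hnt.mono_left hUle).eventually (hu v hv)) k1 k2 k3 k4 k5 k6 (by
      intro η hη
      have : ∀ᶠ k : ℕ in atTop, 1 / ((k:ℝ) + 1) < η :=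
        (tendsto_one_div_add_atTop_nhds_zero_nat (𝕜 := ℝ)).eventually (gt_mem_nhds hη)
      filter_upwards [hUle this] with k hk θ hθ
      exact (k7 k θ hθ).trans_lt hk) k8 k9 k10 k11 k12 k13 k14 k15 k16
  have := hlim.eventually (gt_mem_nhds hε)
  obtain ⟨k, hk⟩ := this.exists
  exact absurd (k17 k) (not_le.2 hk)

end RMC
end

section
open Set Filter Topology Metric
namespace RMC

theorem pre_sub {S u : Set ℂ} (hS : IsPreconnected S) (hu : IsOpen u) (hd : Disjoint S (frontier u))
    {x : ℂ} (hx : x ∈ S) (hxu : x ∈ u) : S ⊆ u := by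
  refine hS.subset_left_of_subset_union hu (isClosed_closure (s := u)).isOpen_compl ?_ ?_ ⟨x, hx, hxu⟩
  · exact disjoint_compl_right.mono_left subset_closure
  · intro y hy
    by_cases h : y ∈ closure u
    · left
      by_contra hyu
      exact Set.disjoint_left.1 hd hy (by rw [hu.frontier_eq]; exact ⟨h, hyu⟩)
    · right; exact h

theorem lip {Φ : ℂ → ℂ} {M : ℝ} (hd : DifferentiableOn ℂ Φ (ball 0 1))
    (hM : ∀ w ∈ ball (0:ℂ) 1, ‖Φ w‖ ≤ M) {w z : ℂ} (hw : ‖w‖ < 1) (hz : z ∈ ball w (1 - ‖w‖)) :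
    dist (Φ z) (Φ w) ≤ 2 * M / (1 - ‖w‖) * dist z w := by
  have hs : ball w (1 - ‖w‖) ⊆ ball (0:ℂ) 1 := ball_subset_ball' (by simp)
  refine Complex.dist_le_div_mul_dist_of_mapsTo_ball (hd.mono hs) ?_ hz
  intro y hy
  have h1 := hM y (hs hy)
  have h2 := hM w (by simpa using hw)
  rw [mem_closedBall, dist_eq_norm]
  linarith [norm_sub_le (Φ y) (Φ w)]

theorem LIM {Φn : ℕ → ℂ → ℂ} {M : ℝ} (hd : ∀ n, DifferentiableOn ℂ (Φn n) (ball 0 1))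
    (hM : ∀ n, ∀ w ∈ ball (0:ℂ) 1, ‖Φn n w‖ ≤ M) (U : Ultrafilter ℕ) :
    ∃ ψ : ℂ → ℂ, TendstoLocallyUniformlyOn Φn ψ U (ball 0 1) := by
  have hp : ∀ w : ℂ, ∃ l : ℂ, w ∈ ball (0:ℂ) 1 → Tendsto (fun n => Φn n w) U (𝓝 l) := by
    intro w
    by_cases hw : w ∈ ball (0:ℂ) 1
    · obtain ⟨l, _, hl⟩ := (isCompact_closedBall (0:ℂ) M).ultrafilter_le_nhds (U.map fun n => Φn n w)
        (by
          rw [le_principal_iff]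
          change _ ∈ Filter.map _ _
          rw [mem_map]
          exact Filter.univ_mem' fun n => by simpa using hM n w hw)
      exact ⟨l, fun _ => hl⟩
    · exact ⟨0, fun h => absurd h hw⟩
  choose ψ hψ using hp
  refine ⟨ψ, ?_⟩
  rw [Metric.tendstoLocallyUniformlyOn_iff]
  intro ε hε w hw
  have hw1 : ‖w‖ < 1 := by simpa using hw
  set K := 2 * M / (1 - ‖w‖) with hK
  have hM0 : 0 ≤ M := (norm_nonneg _).trans (hM 0 w hw)
  have hK0 : 0 ≤ K := div_nonneg (by linarith) (by linarith)
  set η := min (1 - ‖w‖) (ε / (4 * (K + 1))) with hη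
  have hη0 : 0 < η := lt_min (by linarith) (by positivity)
  have hKη : K * η ≤ ε / 4 := by
    calc K * η ≤ (K + 1) * (ε / (4 * (K + 1))) := by
          apply mul_le_mul (by linarith) (min_le_right _ _) hη0.le (by linarith)
      _ = ε / 4 := by field_simp
  have hL : ∀ n, ∀ z ∈ ball w η, dist (Φn n z) (Φn n w) ≤ ε / 4 := fun n z hz =>
    (lip (hd n) (hM n) hw1 (ball_subset_ball (min_le_left _ _) hz)).trans
      ((mul_le_mul_of_nonneg_left (mem_ball.1 hz).le hK0).trans hKη)
  refine ⟨ball w η, mem_nhdsWithin_of_mem_nhds (ball_mem_nhds _ hη0), ?_⟩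
  have h1 : ∀ᶠ n in (U : Filter ℕ), dist (Φn n w) (ψ w) < ε / 4 :=
    (hψ w hw).eventually (ball_mem_nhds _ (by positivity))
  filter_upwards [h1] with n hn z hz
  have hz1 : z ∈ ball (0:ℂ) 1 := ball_subset_ball' (by have := min_le_left (1 - ‖w‖) (ε / (4 * (K + 1))); rw [dist_zero_right]; linarith) hz
  have h2 : dist (ψ z) (ψ w) ≤ ε / 4 :=
    le_of_tendsto ((hψ z hz1).dist (hψ w hw)) (Eventually.of_forall fun n => hL n z hz)
  have := hL n z hz
  calc dist (ψ z) (Φn n z) ≤ dist (ψ z) (ψ w) + dist (ψ w) (Φn n w) + dist (Φn n w) (Φn n z) :=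
        dist_triangle4 _ _ _ _
    _ < ε := by rw [dist_comm (ψ w), dist_comm (Φn n w) (Φn n z)]; linarith

/-- Kernel step: compact connected subsets of G are eventually inside Gn. -/
theorem KER {γ : ℝ → ℂ} {G : Set ℂ} {γn : ℕ → ℝ → ℂ} {Gn : ℕ → Set ℂ}
    (hu : TendstoUniformlyOn γn γ atTop (Icc 0 3))
    (hG : IsOpen G)
    (hfr : frontier G = γ '' Icc 0 3) (hfrn : ∀ n, frontier (Gn n) = γn n '' Icc 0 3)
    (ho : ∀ n, IsOpen (Gn n)) (h0 : ∀ n, (0:ℂ) ∈ Gn n)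
    {K : Set ℂ} (hK : IsCompact K) (hKc : IsPreconnected K) (hK0 : (0:ℂ) ∈ K) (hKG : K ⊆ G) :
    ∀ᶠ n in atTop, K ⊆ Gn n := by
  have hdis : Disjoint K (frontier G) := by
    rw [Set.disjoint_left]
    intro x hx hxf
    rw [hG.frontier_eq] at hxf
    exact hxf.2 (hKG hx)
  obtain ⟨δ, hδ, hdd⟩ := hdis.exists_thickenings hK isClosed_frontier
  rw [Metric.tendstoUniformlyOn_iff] at hu
  filter_upwards [hu δ hδ] with n hn
  refine pre_sub hKc (ho n) ?_ hK0 (h0 n)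
  rw [Set.disjoint_left]
  intro x hx hxf
  rw [hfrn] at hxf
  obtain ⟨t, ht, rfl⟩ := hxf
  refine Set.disjoint_left.1 hdd (self_subset_thickening hδ _ hx) ?_
  rw [mem_thickening_iff]
  exact ⟨γ t, by rw [hfr]; exact ⟨t, ht, rfl⟩, by rw [dist_comm]; exact hn t ht⟩

/-- Schwarz bound for derivatives. -/
theorem SCH {Φ Ψ : ℂ → ℂ} {G H : Set ℂ} (hΦ : Conf Φ G) (hΨ : Conf Ψ H) {r : ℝ} (hr : 0 < r)
    (hr1 : r < 1) (hsub : Φ '' closedBall 0 r ⊆ H) : r * ‖deriv Φ 0‖ ≤ ‖deriv Ψ 0‖ := by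
  obtain ⟨g, hgd, hgm, hg1, hg2, hne⟩ := hΨ.deriv_ne_inv
  have h0 : (0:ℂ) ∈ ball (0:ℂ) 1 := mem_ball_self one_pos
  have hsr : ball (0:ℂ) r ⊆ ball 0 1 := ball_subset_ball hr1.le
  have hm : MapsTo Φ (ball 0 r) H := fun x hx => hsub ⟨x, ball_subset_closedBall hx, rfl⟩
  have hg0 : g 0 = 0 := by have := hg2 0 h0; rwa [hΨ.z] at this
  have hd : DifferentiableOn ℂ (g ∘ Φ) (ball 0 r) := hgd.comp (hΦ.d.mono hsr) hm
  have hs : ‖deriv (g ∘ Φ) 0‖ ≤ 1 / r := by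
    refine Complex.norm_deriv_le_div_of_mapsTo_ball hd ?_ hr
    intro x hx
    have := hgm (hm hx)
    simp only [Function.comp, hΦ.z, hg0]
    exact ball_subset_closedBall this
  have e : Φ =ᶠ[𝓝 0] Ψ ∘ (g ∘ Φ) := by
    filter_upwards [ball_mem_nhds (0:ℂ) hr] with x hx
    exact (hg1 _ (hm hx)).symm
  have hd0 : DifferentiableAt ℂ (g ∘ Φ) 0 := hd.differentiableAt (ball_mem_nhds _ hr)
  have hz : (g ∘ Φ) 0 = 0 := by simp [hΦ.z, hg0]
  have hP : DifferentiableAt ℂ Ψ ((g ∘ Φ) 0) := by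
    rw [hz]; exact hΨ.d.differentiableAt (ball_mem_nhds _ one_pos)
  have := e.deriv_eq
  rw [deriv_comp _ hP hd0, hz] at this
  rw [this, norm_mul]
  calc r * (‖deriv Ψ 0‖ * ‖deriv (g ∘ Φ) 0‖) ≤ r * (‖deriv Ψ 0‖ * (1 / r)) := by gcongr
    _ = ‖deriv Ψ 0‖ := by field_simp

/-- Hurwitz step. -/
theorem HUR {γ : ℝ → ℂ} {G : Set ℂ} {γn : ℕ → ℝ → ℂ} {Gn : ℕ → Set ℂ} {Φn : ℕ → ℂ → ℂ}
    (hu : TendstoUniformlyOn γn γ atTop (Icc 0 3))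
    (hfr : frontier G = γ '' Icc 0 3) (hfrn : ∀ n, frontier (Gn n) = γn n '' Icc 0 3)
    (hconf : ∀ n, Conf (Φn n) (Gn n)) {U : Filter ℕ} [U.NeBot] (hU : U ≤ atTop) {ψ : ℂ → ℂ}
    (hψ : TendstoLocallyUniformlyOn Φn ψ U (ball 0 1)) (hne : deriv ψ 0 ≠ 0)
    {w : ℂ} (hw : w ∈ ball (0:ℂ) 1) : ψ w ∉ frontier G := by
  intro hp
  rw [hfr] at hp
  obtain ⟨t, ht, htp⟩ := hp
  have hd : DifferentiableOn ℂ ψ (ball 0 1) :=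
    hψ.differentiableOn (Eventually.of_forall fun n => (hconf n).d) isOpen_ball
  have han : AnalyticOnNhd ℂ ψ (ball 0 1) := hd.analyticOnNhd isOpen_ball
  have hnc : ∀ᶠ z in 𝓝[≠] w, ψ z ≠ ψ w := by
    have hc : AnalyticOnNhd ℂ (fun _ : ℂ => ψ w) (ball 0 1) := fun _ _ => analyticAt_const
    rcases (han w hw).eventually_eq_or_eventually_ne (hc w hw) with h | h
    · exfalso
      have := han.eqOn_of_preconnected_of_eventuallyEq hc (convex_ball (0:ℂ) 1).isPreconnected hw h
      apply hne
      have e : ψ =ᶠ[𝓝 0] fun _ => ψ w := by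
        filter_upwards [ball_mem_nhds (0:ℂ) one_pos] with x hx using this hx
      rw [e.deriv_eq]; simp
    · exact h
  rw [eventually_nhdsWithin_iff] at hnc
  obtain ⟨r1, hr1, hb1⟩ := Metric.eventually_nhds_iff_ball.1 hnc
  obtain ⟨r2, hr2, hb2⟩ := Metric.isOpen_iff.1 isOpen_ball w hw
  set r := min r1 r2 / 2 with hr
  have hr0 : 0 < r := by positivity
  have hrr1 : r < r1 := by have := min_le_left r1 r2; have := lt_min hr1 hr2; linarith
  have hrr2 : r < r2 := by have := min_le_right r1 r2; have := lt_min hr1 hr2; linarith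
  have hcb : closedBall w r ⊆ ball (0:ℂ) 1 := (closedBall_subset_ball hrr2).trans hb2
  have hcs : ContinuousOn (fun z => ‖ψ z - ψ w‖) (sphere w r) :=
    ((hd.continuousOn.mono (sphere_subset_closedBall.trans hcb)).sub continuousOn_const).norm
  obtain ⟨z0, hz0, hmin⟩ := (isCompact_sphere w r).exists_isMinOn (NormedSpace.sphere_nonempty.2 hr0.le) hcs
  set m := ‖ψ z0 - ψ w‖ with hm
  have hm0 : 0 < m := by
    rw [hm, norm_pos_iff, sub_ne_zero]
    exact hb1 z0 (mem_ball.2 ((mem_sphere.1 hz0).trans_lt hrr1)) (ne_of_mem_sphere hz0 hr0.ne')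
  have hunif := (tendstoLocallyUniformlyOn_iff_forall_isCompact isOpen_ball).1 hψ _ hcb
    (isCompact_closedBall w r)
  rw [Metric.tendstoUniformlyOn_iff] at hunif hu
  have ev := (hunif (m / 8) (by positivity)).and (hU (hu (m / 8) (by positivity)))
  obtain ⟨n, hn1, hn2⟩ := ev.exists
  have hww := hn1 w (mem_closedBall_self hr0.le)
  have hcl : closure (ball w r) = closedBall w r := closure_ball _ hr0.ne'
  have hdc : DiffContOnCl ℂ (Φn n) (ball w r) := by
    refine DifferentiableOn.diffContOnCl ?_
    rw [hcl]; exact (hconf n).d.mono hcb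
  have hbig := hdc.ball_subset_image_closedBall hr0 (ε := m / 2) (by
      intro z hz
      have h1 := hn1 z (sphere_subset_closedBall hz)
      have h2 : m ≤ ‖ψ z - ψ w‖ := hmin hz
      rw [dist_eq_norm] at h1 hww
      have h3 : ‖ψ z - ψ w‖ ≤ ‖ψ z - Φn n z‖ + ‖Φn n z - Φn n w‖ + ‖Φn n w - ψ w‖ := by
        calc ‖ψ z - ψ w‖ = ‖(ψ z - Φn n z) + (Φn n z - Φn n w) + (Φn n w - ψ w)‖ := by congr 1; ring
          _ ≤ _ := norm_add₃_le
      rw [norm_sub_rev (Φn n w)] at h3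
      linarith) (by
      have h1 : ∀ᶠ z in 𝓝[≠] w, Φn n z ≠ Φn n w := by
        rw [eventually_nhdsWithin_iff]
        filter_upwards [isOpen_ball.mem_nhds hw] with z hz hzw he
        exact hzw ((hconf n).b.injOn hz hw he)
      exact h1.frequently.filter_mono nhdsWithin_le_nhds)
  have h2 := hn2 t ht
  have hmem : γn n t ∈ ball (Φn n w) (m / 2 / 2) := by
    rw [mem_ball]
    rw [htp, dist_comm] at h2
    have := dist_triangle (γn n t) (ψ w) (Φn n w)
    linarith
  obtain ⟨v, hv, hve⟩ := hbig hmem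
  apply (hconf n).notMem_fr (hcb hv)
  rw [hve, hfrn]; exact ⟨t, ht, rfl⟩

theorem INT {γ : ℝ → ℂ} {G : Set ℂ} {γn : ℕ → ℝ → ℂ} {Gn : ℕ → Set ℂ} {Φn : ℕ → ℂ → ℂ} {Φ : ℂ → ℂ}
    (hu : TendstoUniformlyOn γn γ atTop (Icc 0 3))
    (hfr : frontier G = γ '' Icc 0 3) (hfrn : ∀ n, frontier (Gn n) = γn n '' Icc 0 3)
    (hconf : ∀ n, Conf (Φn n) (Gn n)) (hΦ : Conf Φ G) {M : ℝ} (hM : ∀ n, Gn n ⊆ ball 0 M)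
    (hdn : ∀ n, (deriv (Φn n) 0).im = 0 ∧ 0 < (deriv (Φn n) 0).re)
    (hd : (deriv Φ 0).im = 0 ∧ 0 < (deriv Φ 0).re) {w : ℂ} (hw : w ∈ ball (0:ℂ) 1) :
    Tendsto (fun n => Φn n w) atTop (𝓝 (Φ w)) := by
  rw [Filter.tendsto_iff_ultrafilter]
  intro U hU
  have hM' : ∀ n, ∀ w ∈ ball (0:ℂ) 1, ‖Φn n w‖ ≤ M := fun n w hw => by
    have := hM n ((hconf n).b.mapsTo hw)
    simpa using (mem_ball_zero_iff.1 this).le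
  obtain ⟨ψ, hψ⟩ := LIM (fun n => (hconf n).d) hM' U
  have hpt : ∀ w ∈ ball (0:ℂ) 1, Tendsto (fun n => Φn n w) U (𝓝 (ψ w)) := fun w hw => hψ.tendsto_at hw
  have h00 : (0:ℂ) ∈ ball (0:ℂ) 1 := mem_ball_self one_pos
  have hG0 : (0:ℂ) ∈ G := by have := hΦ.b.mapsTo h00; rwa [hΦ.z] at this
  have hGn0 : ∀ n, (0:ℂ) ∈ Gn n := fun n => by
    have := (hconf n).b.mapsTo h00; rwa [(hconf n).z] at this
  have hψd : DifferentiableOn ℂ ψ (ball 0 1) :=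
    hψ.differentiableOn (Eventually.of_forall fun n => (hconf n).d) isOpen_ball
  have hψ0 : ψ 0 = 0 := by
    refine tendsto_nhds_unique (hpt 0 h00) ?_
    simp only [(hconf _).z]; exact tendsto_const_nhds
  have hder : Tendsto (fun n => deriv (Φn n) 0) U (𝓝 (deriv ψ 0)) :=
    (hψ.deriv (Eventually.of_forall fun n => (hconf n).d) isOpen_ball).tendsto_at h00
  have hnorm : ∀ z : ℂ, (z.im = 0 ∧ 0 < z.re) → z = (‖z‖ : ℂ) := by
    rintro z ⟨h1, h2⟩
    have : z = (z.re : ℂ) := Complex.ext (by simp) (by simp [h1])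
    rw [this]; simp [abs_of_pos h2]
  have hge : ∀ r : ℝ, 0 < r → r < 1 → r * ‖deriv Φ 0‖ ≤ ‖deriv ψ 0‖ := by
    intro r hr hr1
    have hcb : closedBall (0:ℂ) r ⊆ ball 0 1 := closedBall_subset_ball hr1
    have hk := KER hu hΦ.o hfr hfrn (fun n => (hconf n).o) hGn0
      (K := Φ '' closedBall 0 r)
      ((isCompact_closedBall _ _).image_of_continuousOn (hΦ.d.continuousOn.mono hcb))
      ((convex_closedBall (0:ℂ) r).isPreconnected.image _ (hΦ.d.continuousOn.mono hcb))
      ⟨0, mem_closedBall_self hr.le, hΦ.z⟩ (by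
        rintro _ ⟨x, hx, rfl⟩; exact hΦ.b.mapsTo (hcb hx))
    refine ge_of_tendsto hder.norm ?_
    filter_upwards [hU hk] with n hn
    exact SCH hΦ (hconf n) hr hr1 hn
  have hge1 : ‖deriv Φ 0‖ ≤ ‖deriv ψ 0‖ := by
    have h1 : Tendsto (fun r : ℝ => r * ‖deriv Φ 0‖) (𝓝[<] 1) (𝓝 (1 * ‖deriv Φ 0‖)) :=
      ((continuous_id.mul continuous_const).tendsto 1).mono_left nhdsWithin_le_nhds
    rw [one_mul] at h1
    refine le_of_tendsto h1 ?_
    filter_upwards [Ioo_mem_nhdsLT (zero_lt_one' ℝ)] with r hr using hge r hr.1 hr.2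
  have hΦpos : 0 < ‖deriv Φ 0‖ := by
    rw [norm_pos_iff]; intro h; rw [h] at hd; simp at hd
  have hψne : deriv ψ 0 ≠ 0 := norm_pos_iff.1 (hΦpos.trans_le hge1)
  have hψnorm : deriv ψ 0 = (‖deriv ψ 0‖ : ℂ) := by
    refine tendsto_nhds_unique hder ?_
    have : (fun n => deriv (Φn n) 0) = fun n => ((‖deriv (Φn n) 0‖ : ℝ) : ℂ) :=
      funext fun n => hnorm _ (hdn n)
    rw [this]
    exact (Complex.continuous_ofReal.tendsto _).comp hder.norm
  have hψG : ψ '' ball 0 1 ⊆ G := by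
    refine pre_sub ((convex_ball (0:ℂ) 1).isPreconnected.image _ hψd.continuousOn) hΦ.o ?_
      ⟨0, h00, hψ0⟩ hG0
    rw [Set.disjoint_left]
    rintro _ ⟨x, hx, rfl⟩
    exact HUR hu hfr hfrn hconf hU hψ hψne hx
  obtain ⟨g, hgd, hgm, hg1, hg2, hne⟩ := hΦ.deriv_ne_inv
  have hg0 : g 0 = 0 := by have := hg2 0 h00; rwa [hΦ.z] at this
  have hm : MapsTo ψ (ball 0 1) G := fun x hx => hψG ⟨x, hx, rfl⟩
  set f := g ∘ ψ with hf
  have hfd : DifferentiableOn ℂ f (ball 0 1) := hgd.comp hψd hm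
  have hf0 : f 0 = 0 := by simp [hf, hψ0, hg0]
  have hfm : MapsTo f (ball 0 1) (closedBall (f 0) 1) := by
    intro x hx
    rw [hf0]; exact ball_subset_closedBall (hgm (hm hx))
  have hfle : ‖deriv f 0‖ ≤ 1 := by
    simpa using Complex.norm_deriv_le_div_of_mapsTo_ball hfd hfm one_pos
  have hchain : deriv ψ 0 = deriv Φ 0 * deriv f 0 := by
    have e : ψ =ᶠ[𝓝 0] Φ ∘ f := by
      filter_upwards [ball_mem_nhds (0:ℂ) one_pos] with x hx
      exact (hg1 _ (hm hx)).symm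
    have hP : DifferentiableAt ℂ Φ (f 0) := by
      rw [hf0]; exact hΦ.d.differentiableAt (ball_mem_nhds _ one_pos)
    rw [e.deriv_eq, deriv_comp _ hP (hfd.differentiableAt (ball_mem_nhds _ one_pos)), hf0]
  have hnn : ‖deriv ψ 0‖ = ‖deriv Φ 0‖ := by
    refine le_antisymm ?_ hge1
    rw [hchain, norm_mul]
    exact mul_le_of_le_one_right hΦpos.le hfle
  have hf1 : deriv f 0 = 1 := by
    have h1 : deriv ψ 0 = deriv Φ 0 := by rw [hψnorm, hnn, ← hnorm _ hd]
    rw [h1] at hchain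
    exact (mul_eq_left₀ (norm_pos_iff.1 hΦpos)).1 hchain.symm
  have haff := Complex.affine_of_mapsTo_ball_of_norm_dslope_eq_div hfd hfm h00 (by
    rw [dslope_same, hf1]; simp)
  have hfw : f w = w := by
    have := haff hw
    simpa [hf0, dslope_same, hf1] using this
  have : ψ w = Φ w := by rw [← hg1 _ (hm hw)]; exact congrArg Φ hfw
  rw [← this]; exact hpt w hw

end RMC
end

section
open Set Filter Topology Metric
namespace RMC

theorem BND {γ : ℝ → ℂ} {γn : ℕ → ℝ → ℂ} {Gn : ℕ → Set ℂ} (hγ : Continuous γ)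
    (hγn : ∀ n, Continuous (γn n))
    (hu : TendstoUniformlyOn γn γ atTop (Icc 0 3))
    (hfr : ∀ n, frontier (Gn n) = γn n '' Icc 0 3) (hb : ∀ n, Bornology.IsBounded (Gn n)) :
    ∃ M : ℝ, ∀ n, Gn n ⊆ ball 0 M := by
  have hbd : ∀ f : ℝ → ℂ, Continuous f → ∃ C : ℝ, ∀ t ∈ Icc (0:ℝ) 3, ‖f t‖ ≤ C := fun f hf =>
    isCompact_Icc.exists_bound_of_continuousOn hf.continuousOn
  obtain ⟨C, hC⟩ := hbd γ hγ
  choose B hB using fun n => hbd (γn n) (hγn n)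
  rw [Metric.tendstoUniformlyOn_iff] at hu
  obtain ⟨N, hN⟩ := eventually_atTop.1 (hu 1 one_pos)
  obtain ⟨B', hB'⟩ := ((Finset.range N).image B).exists_le
  have key : ∀ n, ∀ t ∈ Icc (0:ℝ) 3, ‖γn n t‖ ≤ max (C + 1) B' := by
    intro n t ht
    by_cases hn : N ≤ n
    · have h1 := hN n hn t ht
      have h2 := hC t ht
      rw [dist_comm, dist_eq_norm] at h1
      have h3 : ‖γn n t‖ ≤ ‖γn n t - γ t‖ + ‖γ t‖ := by
        simpa using norm_add_le (γn n t - γ t) (γ t)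
      exact le_max_of_le_left (by linarith)
    · exact le_max_of_le_right ((hB n t ht).trans (hB' _ (Finset.mem_image_of_mem _ (by simpa using hn))))
  refine ⟨max (C + 1) B' + 1, fun n z hz => ?_⟩
  have := Complex.norm_le_of_forall_mem_frontier_norm_le (f := fun z : ℂ => z) (hb n)
    (differentiable_id.diffContOnCl) (C := max (C + 1) B') (by
      intro z hz
      rw [hfr] at hz
      obtain ⟨t, ht, rfl⟩ := hz
      exact key n t ht) (subset_closure hz)
  rw [mem_ball_zero_iff]; linarith

theorem UNI {γ : ℝ → ℂ} {G : Set ℂ} (hcfg : Cfg γ G) {γn : ℕ → ℝ → ℂ} {Gn : ℕ → Set ℂ}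
    (hγn : ∀ n, Continuous (γn n))
    (hu : TendstoUniformlyOn γn γ atTop (Icc 0 3)) (hfrn : ∀ n, frontier (Gn n) = γn n '' Icc 0 3)
    (hcl : ∀ n, γn n 0 = γn n 3) {Φn : ℕ → ℂ → ℂ} {Φ : ℂ → ℂ}
    (hconf : ∀ n, Conf (Φn n) (Gn n)) (hΦ : Conf Φ G) (hb : ∀ n, Bornology.IsBounded (Gn n))
    (hdn : ∀ n, (deriv (Φn n) 0).im = 0 ∧ 0 < (deriv (Φn n) 0).re)
    (hd : (deriv Φ 0).im = 0 ∧ 0 < (deriv Φ 0).re) :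
    TendstoUniformlyOn Φn Φ atTop (closedBall 0 1) := by
  obtain ⟨M, hM⟩ := BND hcfg.cont hγn hu hfrn hb
  have hM' : ∀ n, ∀ w ∈ ball (0:ℂ) 1, ‖Φn n w‖ ≤ M := fun n w hw => by
    have := hM n ((hconf n).b.mapsTo hw)
    simpa using (mem_ball_zero_iff.1 this).le
  have hpw : ∀ w ∈ ball (0:ℂ) 1, Tendsto (fun n => Φn n w) atTop (𝓝 (Φ w)) := fun w hw =>
    INT hu hcfg.fr hfrn hconf hΦ hM hdn hd hw
  rw [← tendstoLocallyUniformlyOn_iff_tendstoUniformlyOn_of_compact (isCompact_closedBall _ _),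
    Metric.tendstoLocallyUniformlyOn_iff]
  intro ε hε ζ hζ
  -- it suffices to find a neighbourhood, a reference point and an equicontinuity estimate
  suffices H : ∃ t ∈ 𝓝 ζ, ∃ w ∈ ball (0:ℂ) 1, w ∈ t ∧ ∀ᶠ n in atTop, ∀ z ∈ t ∩ closedBall (0:ℂ) 1,
      dist (Φn n z) (Φn n w) ≤ ε / 5 by
    obtain ⟨t, ht, w, hw, hwt, hev⟩ := H
    have hc : ∀ᶠ z in 𝓝[closedBall 0 1] ζ, dist (Φ z) (Φ ζ) < ε / 5 :=
      (hΦ.c ζ hζ).eventually (ball_mem_nhds _ (by positivity))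
    obtain ⟨s, hs, hsc⟩ := eventually_iff_exists_mem.1 hc
    have hcw : dist (Φ ζ) (Φ w) ≤ ε / 5 := by
      -- limit of interior points near ζ
      have hcl1 : ζ ∈ closure (ball (0:ℂ) 1) := by rwa [closure_ball (0:ℂ) one_ne_zero]
      have : (𝓝[ball (0:ℂ) 1] ζ).NeBot := mem_closure_iff_nhdsWithin_neBot.1 hcl1
      refine le_of_tendsto ((((hΦ.c ζ hζ).mono ball_subset_closedBall).tendsto).dist tendsto_const_nhds) ?_
      filter_upwards [mem_nhdsWithin_of_mem_nhds ht, self_mem_nhdsWithin] with z hz hz1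
      refine le_of_tendsto ((hpw z hz1).dist (hpw w hw)) ?_
      filter_upwards [hev] with n hn using hn z ⟨hz, ball_subset_closedBall hz1⟩
    refine ⟨s ∩ t ∩ closedBall 0 1, inter_mem (inter_mem hs (mem_nhdsWithin_of_mem_nhds ht))
      self_mem_nhdsWithin, ?_⟩
    have h1 : ∀ᶠ n in atTop, dist (Φn n w) (Φ w) < ε / 5 :=
      (hpw w hw).eventually (ball_mem_nhds _ (by positivity))
    filter_upwards [hev, h1] with n hn hn1 z hz
    have a1 := hsc z hz.1.1
    have a2 := hn z ⟨hz.1.2, hz.2⟩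
    have b1 := dist_triangle4 (Φ z) (Φ ζ) (Φ w) (Φn n w)
    have b2 := dist_triangle (Φ z) (Φn n w) (Φn n z)
    rw [dist_comm (Φ w)] at b1
    rw [dist_comm (Φn n w) (Φn n z)] at b2
    linarith
  rcases (mem_closedBall_zero_iff.1 hζ).lt_or_eq with hlt | heq
  · set K := 2 * M / (1 - ‖ζ‖) with hK
    have hM0 : 0 ≤ M := (norm_nonneg _).trans (hM' 0 ζ (by simpa using hlt))
    have hK0 : 0 ≤ K := div_nonneg (by linarith) (by linarith)
    set η := min (1 - ‖ζ‖) (ε / (5 * (K + 1))) with hη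
    have hη0 : 0 < η := lt_min (by linarith) (by positivity)
    have hKη : K * η ≤ ε / 5 := by
      calc K * η ≤ (K + 1) * (ε / (5 * (K + 1))) := by
            apply mul_le_mul (by linarith) (min_le_right _ _) hη0.le (by linarith)
        _ = ε / 5 := by field_simp
    refine ⟨ball ζ η, ball_mem_nhds _ hη0, ζ, by simpa using hlt, mem_ball_self hη0,
      Eventually.of_forall fun n z hz => ?_⟩
    exact (lip (hconf n).d (hM' n) hlt (ball_subset_ball (min_le_left _ _) hz.1)).trans
      ((mul_le_mul_of_nonneg_left (mem_ball.1 hz.1).le hK0).trans hKη)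
  · obtain ⟨δ, hδ, N, hN⟩ := EQ hcfg hγn hu hfrn hcl hconf hM (ε := ε / 5) (by positivity)
    have hcl1 : ∀ z ∈ closedBall (0:ℂ) 1, (𝓝[ball (0:ℂ) 1] z).NeBot := fun z hz =>
      mem_closure_iff_nhdsWithin_neBot.1 (by rwa [closure_ball (0:ℂ) one_ne_zero])
    have : (𝓝[ball (0:ℂ) 1] ζ).NeBot := hcl1 ζ hζ
    obtain ⟨w, hw1, hw2⟩ : ∃ w, w ∈ ball ζ δ ∧ w ∈ ball (0:ℂ) 1 :=
      Filter.nonempty_of_mem (inter_mem (mem_nhdsWithin_of_mem_nhds (ball_mem_nhds ζ hδ))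
        (self_mem_nhdsWithin (a := ζ) (s := ball (0:ℂ) 1)))
    refine ⟨ball ζ δ, ball_mem_nhds _ hδ, w, hw2, hw1, ?_⟩
    filter_upwards [eventually_ge_atTop N] with n hn z hz
    have := hcl1 z hz.2
    refine le_of_tendsto (((((hconf n).c z hz.2).mono ball_subset_closedBall).tendsto).dist
      (tendsto_const_nhds (x := Φn n w))) ?_
    filter_upwards [mem_nhdsWithin_of_mem_nhds (isOpen_ball.mem_nhds hz.1), self_mem_nhdsWithin] with y hy hy1
    exact (hN n hn ζ heq y ⟨hy1, hy⟩ w ⟨hw2, hw1⟩).le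

end RMC
end

section
open Set Filter Topology Metric
namespace RMC

theorem curve_reparam (K J : C(unitInterval, ℂ)) {κ : ℝ} (hκ : 0 < κ) :
    ∃ θ : unitInterval → unitInterval, Continuous θ ∧ Function.Surjective θ ∧ θ 0 = 0 ∧ θ 1 = 1 ∧
      ∀ t, dist (K (θ t)) (J t) ≤ curveDist K J + κ := by
  have hne : { r : ℝ | 0 ≤ r ∧ ∃ φ ψ : unitInterval → unitInterval,
    IsReparam φ ∧ IsReparam ψ ∧ ∀ t, dist (K (φ t)) (J (ψ t)) ≤ r }.Nonempty := by
    obtain ⟨C, hC⟩ := isCompact_univ.exists_bound_of_continuousOn (f := fun t => dist (K t) (J t))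
      (K.continuous.dist J.continuous).continuousOn
    refine ⟨max C 0, le_max_right _ _, id, id, ⟨continuous_id, monotone_id, rfl, rfl⟩,
      ⟨continuous_id, monotone_id, rfl, rfl⟩, fun t => le_max_of_le_left ?_⟩
    simpa using (le_abs_self _).trans (hC t (mem_univ _))
  obtain ⟨r, ⟨hr0, φ, ψ, hφ, hψ, hd⟩, hr⟩ := exists_lt_of_csInf_lt hne
    (show curveDist K J < curveDist K J + κ / 2 by linarith)
  have hUC : UniformContinuous J := CompactSpace.uniformContinuous_of_continuous J.continuous
  obtain ⟨η', hη', hJ⟩ := Metric.uniformContinuous_iff.1 hUC (κ / 2) (by positivity)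
  set η := min (η' / 2) 1 with hη
  have hη0 : 0 < η := by positivity
  have hη1 : η ≤ 1 := min_le_right _ _
  have hηη : η < η' := (min_le_left _ _).trans_lt (by linarith)
  have hmem : ∀ t : unitInterval, (1 - η) * (ψ t : ℝ) + η * (t : ℝ) ∈ unitInterval := by
    intro t
    have h1 := (ψ t).2; have h2 := t.2
    refine ⟨add_nonneg (mul_nonneg (by linarith) h1.1) (mul_nonneg hη0.le h2.1), ?_⟩
    have := mul_le_mul_of_nonneg_left h1.2 (sub_nonneg.2 hη1)
    have := mul_le_mul_of_nonneg_left h2.2 hη0.le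
    linarith
  let p : unitInterval → unitInterval := fun t => ⟨_, hmem t⟩
  have hpc : Continuous p := by
    have := hψ.1
    exact Continuous.subtype_mk (by fun_prop) _
  have hp0 : p 0 = 0 := Subtype.ext (by simp [p, hψ.2.2.1])
  have hp1 : p 1 = 1 := Subtype.ext (by simp [p, hψ.2.2.2])
  have hpm : StrictMono p := by
    intro s t hst
    have h1 : (ψ s : ℝ) ≤ ψ t := hψ.2.1 hst.le
    have h2 : (s : ℝ) < t := hst
    change (1 - η) * (ψ s : ℝ) + η * (s : ℝ) < (1 - η) * (ψ t : ℝ) + η * (t : ℝ)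
    have := mul_le_mul_of_nonneg_left h1 (sub_nonneg.2 hη1)
    have := mul_lt_mul_of_pos_left h2 hη0
    linarith
  have hsurj : ∀ q : unitInterval → unitInterval, Continuous q → q 0 = 0 → q 1 = 1 →
      Function.Surjective q := by
    intro q hq h0 h1 c
    exact mem_range_of_exists_le_of_exists_ge hq ⟨0, by rw [h0]; exact unitInterval.nonneg'⟩
      ⟨1, by rw [h1]; exact unitInterval.le_one'⟩
  let e : unitInterval ≃o unitInterval := hpm.orderIsoOfSurjective p (hsurj p hpc hp0 hp1)
  have he : ∀ t, p (e.symm t) = t := fun t => e.apply_symm_apply t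
  have hec : Continuous (φ ∘ e.symm) := hφ.1.comp e.symm.continuous
  have he0 : e.symm 0 = 0 := hpm.injective (by rw [he, hp0])
  have he1 : e.symm 1 = 1 := hpm.injective (by rw [he, hp1])
  have q0 : (φ ∘ e.symm) 0 = 0 := by simp only [Function.comp, he0, hφ.2.2.1]
  have q1 : (φ ∘ e.symm) 1 = 1 := by simp only [Function.comp, he1, hφ.2.2.2]
  refine ⟨φ ∘ e.symm, hec, hsurj _ hec q0 q1, q0, q1, fun t => ?_⟩
  have a1 := hd (e.symm t)
  have a2 : dist (J (ψ (e.symm t))) (J t) < κ / 2 := by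
    apply hJ
    nth_rewrite 2 [← he t]
    generalize e.symm t = s
    rw [Subtype.dist_eq, Real.dist_eq]
    have : (ψ s : ℝ) - (p s : ℝ) = η * ((ψ s : ℝ) - s) := by simp only [p]; ring
    rw [this, abs_mul, abs_of_pos hη0]
    have h1 := (ψ s).2; have h2 := s.2
    have : |(ψ s : ℝ) - s| ≤ 1 := abs_le.2 ⟨by linarith [h1.1, h2.2], by linarith [h1.2, h2.1]⟩
    calc η * |(ψ s : ℝ) - s| ≤ η * 1 := by gcongr
      _ < η' := by linarith
  have := dist_triangle (K (φ (e.symm t))) (J (ψ (e.symm t))) (J t)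
  simp only [Function.comp]
  linarith

/-- Concatenation of three paths, parametrized by `[0,3]`. -/
noncomputable def cat (K1 K2 K3 : C(unitInterval, ℂ)) (t : ℝ) : ℂ :=
  K1 (projIcc 0 1 zero_le_one t) + (K2 (projIcc 0 1 zero_le_one (t - 1)) - K2 0) +
    (K3 (projIcc 0 1 zero_le_one (t - 2)) - K3 0)

theorem cat_cont (K1 K2 K3 : C(unitInterval, ℂ)) : Continuous (cat K1 K2 K3) := by
  have : Continuous (projIcc (0:ℝ) 1 zero_le_one) := continuous_projIcc
  unfold cat
  have h1 : Continuous fun t : ℝ => projIcc (0:ℝ) 1 zero_le_one t := this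
  have h2 : Continuous fun t : ℝ => projIcc (0:ℝ) 1 zero_le_one (t - 1) := this.comp (by fun_prop)
  have h3 : Continuous fun t : ℝ => projIcc (0:ℝ) 1 zero_le_one (t - 2) := this.comp (by fun_prop)
  exact ((K1.continuous.comp h1).add ((K2.continuous.comp h2).sub continuous_const)).add
    ((K3.continuous.comp h3).sub continuous_const)

section
variable {K1 K2 K3 : C(unitInterval, ℂ)}

theorem pl {t : ℝ} (h : t ≤ 0) : projIcc (0:ℝ) 1 zero_le_one t = (0 : unitInterval) :=
  projIcc_of_le_left _ h
theorem pr {t : ℝ} (h : 1 ≤ t) : projIcc (0:ℝ) 1 zero_le_one t = (1 : unitInterval) :=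
  projIcc_of_right_le _ h

theorem cat_1 {t : ℝ} (ht : t ∈ Icc (0:ℝ) 1) : cat K1 K2 K3 t = K1 ⟨t, ht⟩ := by
  unfold cat
  rw [projIcc_of_mem _ ht, pl (t := t - 1) (by linarith [ht.2]), pl (t := t - 2) (by linarith [ht.2])]
  simp

theorem cat_2 (h12 : K1 1 = K2 0) {t : ℝ} (ht : t - 1 ∈ Icc (0:ℝ) 1) :
    cat K1 K2 K3 t = K2 ⟨t - 1, ht⟩ := by
  unfold cat
  rw [projIcc_of_mem _ ht, pr (t := t) (by linarith [ht.1]), pl (t := t - 2) (by linarith [ht.2]), h12]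
  ring

theorem cat_3 (h12 : K1 1 = K2 0) (h23 : K2 1 = K3 0) {t : ℝ} (ht : t - 2 ∈ Icc (0:ℝ) 1) :
    cat K1 K2 K3 t = K3 ⟨t - 2, ht⟩ := by
  unfold cat
  rw [projIcc_of_mem _ ht, pr (t := t) (by linarith [ht.1]), pr (t := t - 1) (by linarith [ht.1]), h12, h23]
  ring

theorem cat_image (h12 : K1 1 = K2 0) (h23 : K2 1 = K3 0) :
    cat K1 K2 K3 '' Icc 0 3 = range K1 ∪ range K2 ∪ range K3 := by
  ext z
  constructor
  · rintro ⟨t, ht, rfl⟩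
    rcases le_total t 1 with h1 | h1
    · exact Or.inl (Or.inl ⟨_, (cat_1 ⟨ht.1, h1⟩).symm⟩)
    · rcases le_total t 2 with h2 | h2
      · exact Or.inl (Or.inr ⟨_, (cat_2 h12 ⟨by linarith, by linarith⟩).symm⟩)
      · exact Or.inr ⟨_, (cat_3 h12 h23 ⟨by linarith, by linarith [ht.2]⟩).symm⟩
  · rintro ((⟨s, rfl⟩ | ⟨s, rfl⟩) | ⟨s, rfl⟩)
    · exact ⟨s, ⟨s.2.1, by linarith [s.2.2]⟩, cat_1 s.2⟩
    · refine ⟨s + 1, ⟨by linarith [s.2.1], by linarith [s.2.2]⟩, ?_⟩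
      rw [cat_2 h12 (by simpa using s.2)]; congr 1; exact Subtype.ext (by simp)
    · refine ⟨s + 2, ⟨by linarith [s.2.1], by linarith [s.2.2]⟩, ?_⟩
      rw [cat_3 h12 h23 (by simpa using s.2)]; congr 1; exact Subtype.ext (by simp)

theorem cat_dist {L1 L2 L3 : C(unitInterval, ℂ)} (h12 : K1 1 = K2 0) (h23 : K2 1 = K3 0)
    (g12 : L1 1 = L2 0) (g23 : L2 1 = L3 0) {ε : ℝ} (h1 : ∀ t, dist (K1 t) (L1 t) < ε)
    (h2 : ∀ t, dist (K2 t) (L2 t) < ε) (h3 : ∀ t, dist (K3 t) (L3 t) < ε) {t : ℝ}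
    (ht : t ∈ Icc (0:ℝ) 3) : dist (cat K1 K2 K3 t) (cat L1 L2 L3 t) < ε := by
  rcases le_total t 1 with k1 | k1
  · rw [cat_1 ⟨ht.1, k1⟩, cat_1 ⟨ht.1, k1⟩]; exact h1 _
  · rcases le_total t 2 with k2 | k2
    · rw [cat_2 h12 ⟨by linarith, by linarith⟩, cat_2 g12 ⟨by linarith, by linarith⟩]; exact h2 _
    · rw [cat_3 h12 h23 ⟨by linarith, by linarith [ht.2]⟩,
        cat_3 g12 g23 ⟨by linarith, by linarith [ht.2]⟩]; exact h3 _
end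

theorem cat_zero {K1 K2 K3 : C(unitInterval, ℂ)} : cat K1 K2 K3 0 = K1 0 :=
  cat_1 ⟨le_refl _, zero_le_one⟩

theorem cat_three {K1 K2 K3 : C(unitInterval, ℂ)} (h12 : K1 1 = K2 0) (h23 : K2 1 = K3 0) :
    cat K1 K2 K3 3 = K3 1 := by
  rw [cat_3 h12 h23 (by norm_num)]; congr 1; exact Subtype.ext (by norm_num)

theorem cfg_of (D : AdmissibleDomain) (h0 : (0:ℂ) ∈ D.G) : Cfg (cat D.J1 D.J2 D.J3) D.G := by
  have h12 : D.J1 1 = D.J2 0 := by rw [D.e11, D.e20]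
  have h23 : D.J2 1 = D.J3 0 := by rw [D.e21, D.e30]
  have m2 : ∀ {t : ℝ}, t ∈ Icc (1:ℝ) 2 → t - 1 ∈ Icc (0:ℝ) 1 := fun h =>
    ⟨by linarith [h.1], by linarith [h.2]⟩
  have m3 : ∀ {t : ℝ}, t ∈ Icc (2:ℝ) 3 → t - 2 ∈ Icc (0:ℝ) 1 := fun h =>
    ⟨by linarith [h.1], by linarith [h.2]⟩
  have nt1 : ∀ x y, D.J3 x = D.J1 y → y = 0 ∨ y = 1 := by
    intro x y h
    by_contra hcon
    push Not at hcon
    have : D.J3 x ∈ range D.J3 ∩ (range D.J1 \ {D.d, D.a}) := by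
      refine ⟨⟨x, rfl⟩, ⟨y, h.symm⟩, ?_⟩
      rw [h]
      rintro (k | k)
      · exact hcon.1 (D.inj1 (k.trans D.e10.symm))
      · exact hcon.2 (D.inj1 (k.trans D.e11.symm))
    rw [D.noTouch1] at this; exact this
  have nt2 : ∀ x y, D.J3 x = D.J2 y → y = 0 ∨ y = 1 := by
    intro x y h
    by_contra hcon
    push Not at hcon
    have : D.J3 x ∈ range D.J3 ∩ (range D.J2 \ {D.a, D.c}) := by
      refine ⟨⟨x, rfl⟩, ⟨y, h.symm⟩, ?_⟩
      rw [h]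
      rintro (k | k)
      · exact hcon.1 (D.inj2 (k.trans D.e20.symm))
      · exact hcon.2 (D.inj2 (k.trans D.e21.symm))
    rw [D.noTouch2] at this; exact this
  have h01 : (0 : unitInterval) ≠ 1 := zero_ne_one
  refine ⟨cat_cont _ _ _, ?_, ?_, ?_, ?_, ?_, ?_, ?_, D.isOpen, D.connected.isPreconnected, h0, ?_⟩
  · intro s hs t ht h
    rw [cat_1 hs, cat_1 ht] at h
    simpa using congrArg Subtype.val (D.inj1 h)
  · intro s hs t ht h
    rw [cat_2 h12 (m2 hs), cat_2 h12 (m2 ht)] at h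
    simpa using congrArg Subtype.val (D.inj2 h)
  · intro s hs t ht h
    rw [cat_3 h12 h23 (m3 hs), cat_3 h12 h23 (m3 ht)] at h
    simpa using congrArg Subtype.val (D.inj3 h)
  · intro τ hτ σ hσ h
    rw [cat_3 h12 h23 (m3 hτ), cat_1 hσ] at h
    rcases nt1 _ _ h with k | k
    · left; simpa using congrArg Subtype.val k
    · right; simpa using congrArg Subtype.val k
  · intro τ hτ σ hσ h
    rw [cat_3 h12 h23 (m3 hτ), cat_2 h12 (m2 hσ)] at h
    rcases nt2 _ _ h with k | k
    · left
      have : σ - 1 = 0 := congrArg Subtype.val k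
      linarith
    · right
      have : σ - 1 = 1 := congrArg Subtype.val k
      linarith
  · rw [cat_zero, cat_three h12 h23, D.e10, D.e31]
  · rintro ⟨s, hs, h⟩
    have e2 : cat D.J1 D.J2 D.J3 2 = D.J3 0 := by
      rw [cat_3 h12 h23 (by norm_num)]; congr 1; exact Subtype.ext (by norm_num)
    rw [cat_1 hs, e2] at h
    rcases nt1 _ _ h.symm with k | k
    · rw [k, D.e10, ← D.e31] at h
      exact h01 (D.inj3 h.symm)
    · rw [k, h12, ← h23] at h
      exact h01 (D.inj2 h)
  · rw [cat_image h12 h23, D.boundary]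

theorem curves_of (Dn : ℕ → AdmissibleDomain) (D : AdmissibleDomain) (h : AdmConverges Dn D) :
    ∃ γn : ℕ → ℝ → ℂ, (∀ n, Continuous (γn n)) ∧
      TendstoUniformlyOn γn (cat D.J1 D.J2 D.J3) atTop (Icc 0 3) ∧
      (∀ n, frontier (Dn n).G = γn n '' Icc 0 3) ∧ ∀ n, γn n 0 = γn n 3 := by
  obtain ⟨c1, c2, c3, -⟩ := h
  have hpos : ∀ n : ℕ, (0:ℝ) < 1 / ((n:ℝ) + 1) := fun n => by positivity
  choose θ1 k1 s1 a1 b1 d1 using fun n => curve_reparam (Dn n).J1 D.J1 (hpos n)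
  choose θ2 k2 s2 a2 b2 d2 using fun n => curve_reparam (Dn n).J2 D.J2 (hpos n)
  choose θ3 k3 s3 a3 b3 d3 using fun n => curve_reparam (Dn n).J3 D.J3 (hpos n)
  let K1 : ℕ → C(unitInterval, ℂ) := fun n => (Dn n).J1.comp ⟨θ1 n, k1 n⟩
  let K2 : ℕ → C(unitInterval, ℂ) := fun n => (Dn n).J2.comp ⟨θ2 n, k2 n⟩
  let K3 : ℕ → C(unitInterval, ℂ) := fun n => (Dn n).J3.comp ⟨θ3 n, k3 n⟩
  have e1 : ∀ n t, K1 n t = (Dn n).J1 (θ1 n t) := fun _ _ => rfl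
  have e2 : ∀ n t, K2 n t = (Dn n).J2 (θ2 n t) := fun _ _ => rfl
  have e3 : ∀ n t, K3 n t = (Dn n).J3 (θ3 n t) := fun _ _ => rfl
  have h12 : ∀ n, K1 n 1 = K2 n 0 := fun n => by rw [e1, e2, b1, a2, (Dn n).e11, (Dn n).e20]
  have h23 : ∀ n, K2 n 1 = K3 n 0 := fun n => by rw [e2, e3, b2, a3, (Dn n).e21, (Dn n).e30]
  have r1 : ∀ n, range (K1 n) = range (Dn n).J1 := fun n => (s1 n).range_comp _
  have r2 : ∀ n, range (K2 n) = range (Dn n).J2 := fun n => (s2 n).range_comp _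
  have r3 : ∀ n, range (K3 n) = range (Dn n).J3 := fun n => (s3 n).range_comp _
  refine ⟨fun n => cat (K1 n) (K2 n) (K3 n), fun n => cat_cont _ _ _, ?_, ?_, ?_⟩
  · rw [Metric.tendstoUniformlyOn_iff]
    intro ε hε
    have hz := tendsto_one_div_add_atTop_nhds_zero_nat (𝕜 := ℝ)
    have t1 := (c1.add hz).eventually (gt_mem_nhds (by simpa using hε))
    have t2 := (c2.add hz).eventually (gt_mem_nhds (by simpa using hε))
    have t3 := (c3.add hz).eventually (gt_mem_nhds (by simpa using hε))
    filter_upwards [t1, t2, t3] with n q1 q2 q3 t ht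
    rw [dist_comm]
    exact cat_dist (h12 n) (h23 n) (by rw [D.e11, D.e20]) (by rw [D.e21, D.e30])
      (fun t => (d1 n t).trans_lt q1) (fun t => (d2 n t).trans_lt q2)
      (fun t => (d3 n t).trans_lt q3) ht
  · intro n
    simp only
    rw [cat_image (h12 n) (h23 n), r1, r2, r3, (Dn n).boundary]
  · intro n
    simp only
    rw [cat_zero, cat_three (h12 n) (h23 n), e1, e3, a1, b3, (Dn n).e10, (Dn n).e31]

theorem conf_of {φ Φ : ℂ → ℂ} {G : Set ℂ} (ho : IsOpen G) (hd : DifferentiableOn ℂ φ (ball 0 1))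
    (hb : BijOn φ (ball 0 1) G) (h0 : φ 0 = 0)
    (hΦ : ContinuousOn Φ (closedBall 0 1) ∧ EqOn Φ φ (ball 0 1)) :
    Conf Φ G ∧ deriv Φ 0 = deriv φ 0 := by
  refine ⟨⟨hd.congr hΦ.2, hb.congr hΦ.2.symm, ?_, hΦ.1, ho⟩, ?_⟩
  · rw [hΦ.2 (mem_ball_self one_pos), h0]
  · exact (hΦ.2.eventuallyEq_of_mem (ball_mem_nhds _ one_pos)).deriv_eq

end RMC
end

/-- If admissible domains `(Gₙ, aₙ, cₙ, dₙ)` containing `0` converge to an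
admissible domain `(G, a, c, d)` containing `0`, then the normalized Riemann maps
`φₙ : 𝔻 → Gₙ` (with `φₙ(0) = 0`, `φₙ'(0) > 0`) converge uniformly on the closed
disc to the normalized Riemann map `φ : 𝔻 → G`. -/
theorem riemann_maps_converge_uniformly
    (Dn : ℕ → AdmissibleDomain) (D : AdmissibleDomain) (h : AdmConverges Dn D)
    (h0n : ∀ n, (0:ℂ) ∈ (Dn n).G) (h0 : (0:ℂ) ∈ D.G)
    (φn Φn : ℕ → ℂ → ℂ) (φ Φ : ℂ → ℂ)
    (hφnd : ∀ n, DifferentiableOn ℂ (φn n) (Metric.ball 0 1))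
    (hφnb : ∀ n, Set.BijOn (φn n) (Metric.ball 0 1) (Dn n).G)
    (hφn0 : ∀ n, φn n 0 = 0)
    (hφn' : ∀ n, (deriv (φn n) 0).im = 0 ∧ 0 < (deriv (φn n) 0).re)
    (hφd : DifferentiableOn ℂ φ (Metric.ball 0 1))
    (hφb : Set.BijOn φ (Metric.ball 0 1) D.G)
    (hφ0 : φ 0 = 0)
    (hφ' : (deriv φ 0).im = 0 ∧ 0 < (deriv φ 0).re)
    (hΦn : ∀ n, ContinuousOn (Φn n) (Metric.closedBall 0 1) ∧
      Set.EqOn (Φn n) (φn n) (Metric.ball 0 1))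
    (hΦ : ContinuousOn Φ (Metric.closedBall 0 1) ∧
      Set.EqOn Φ φ (Metric.ball 0 1)) :
    TendstoUniformlyOn (fun n => Φn n) Φ Filter.atTop (Metric.closedBall 0 1) := by
  obtain ⟨γn, hγn, hu, hfrn, hcl⟩ := RMC.curves_of Dn D h
  have hc := fun n => RMC.conf_of (Dn n).isOpen (hφnd n) (hφnb n) (hφn0 n) (hΦn n)
  have hc0 := RMC.conf_of D.isOpen hφd hφb hφ0 hΦ
  exact RMC.UNI (RMC.cfg_of D h0) hγn hu hfrn hcl (fun n => (hc n).1) hc0.1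
    (fun n => (Dn n).bounded) (fun n => by rw [(hc n).2]; exact hφn' n)
    (by rw [hc0.2]; exact hφ')
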